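/- arXiv:1512.06145 — 7 statements merged into one kernel-verified Lean document; each statement's English description precedes it below -/
import Mathlib

section
/- Let (s_n) be a positive sequence with s_n → ∞ and let (f_n) be continuous, strictly increasing, differentiable functions from (0,∞) to (0,∞) for which there exist ε₀ > 0, δ₀ ∈ (0,1] and n₀ such that x f_n′(x) ≥ ε₀ s_n f_n(x) for all x ≥ 1 − δ₀ and all n ≥ n₀. Then for every ε > 0 and ε̄ > 0 there exist n₁ ∈ ℕ and K < ∞ such that for all n ≥ n₁ and all t ≥ 0: ∫_0^∞ e^{−ε (f_n(x) − t)/f_n(1)} · 1{ f_n(x) − t ≥ K f_n(1) } dx ≤ ε̄/s_n. -/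
open MeasureTheory Filter

lemma growth_aux (g g' : ℝ → ℝ) (c : ℝ) (hc : 1 ≤ c)
    (hpos : ∀ x, 0 < x → 0 < g x)
    (hd : ∀ x, 0 < x → HasDerivAt g (g' x) x)
    (hl : ∀ x, 1 ≤ x → c * g x ≤ x * g' x) (y x : ℝ) (hy : 1 ≤ y) (hyx : y ≤ x) :
    c * g 1 * (x - y) ≤ g x - g y := by
  have hdiv : ∀ x, 0 < x → HasDerivAt (fun x => g x / x) ((g' x * x - g x * 1) / x ^ 2) x :=
    fun x hx => (hd x hx).fun_div (hasDerivAt_id x) hx.ne'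
  have hmono : MonotoneOn (fun x => g x / x) (Set.Ici 1) := by
    apply monotoneOn_of_deriv_nonneg (convex_Ici 1)
    · intro x hx
      have hx1 : (1:ℝ) ≤ x := hx
      exact (hdiv x (by linarith)).continuousAt.continuousWithinAt
    · intro x hx
      rw [interior_Ici] at hx
      have hx1 : (1:ℝ) < x := hx
      exact (hdiv x (by linarith)).differentiableAt.differentiableWithinAt
    · intro x hx
      rw [interior_Ici] at hx
      have hx1 : (1:ℝ) < x := hx
      rw [(hdiv x (by linarith)).deriv]
      apply div_nonneg _ (by positivity)
      have h1 := hl x hx1.le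
      have h2 := hpos x (by linarith)
      nlinarith
  have hder : ∀ x, 1 ≤ x → c * g 1 ≤ g' x := by
    intro x hx
    have hx0 : 0 < x := by linarith
    have h1 : g 1 / 1 ≤ g x / x := hmono (Set.mem_Ici.2 le_rfl) (Set.mem_Ici.2 hx) hx
    rw [div_one, le_div_iff₀ hx0] at h1
    have h2 := hl x hx
    have h3 : c * (g 1 * x) ≤ c * g x := mul_le_mul_of_nonneg_left h1 (by linarith)
    have h4 : x * (c * g 1) ≤ x * g' x := by linarith
    exact le_of_mul_le_mul_left h4 hx0
  apply (convex_Ici (1:ℝ)).mul_sub_le_image_sub_of_le_deriv (f := g) _ _ _ y hy x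
    (Set.mem_Ici.2 (hy.trans hyx)) hyx
  · intro x hx
    have hx1 : (1:ℝ) ≤ x := hx
    exact (hd x (by linarith)).continuousAt.continuousWithinAt
  · intro x hx
    rw [interior_Ici] at hx
    have hx1 : (1:ℝ) < x := hx
    exact (hd x (by linarith)).differentiableAt.differentiableWithinAt
  · intro x hx
    rw [interior_Ici] at hx
    have hx1 : (1:ℝ) < x := hx
    rw [(hd x (by linarith)).deriv]
    exact hder x hx1.le

/-- under the combined lower density bound, the tail contribution of the translated
image measure `μ_n(t + dy)` with exponential discounting is at most `ε̄/s_n` for `K` large. -/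
theorem statement6 (s : ℕ → ℝ) (hs_pos : ∀ n, 0 < s n) (hs : Tendsto s atTop atTop)
    (f f' : ℕ → ℝ → ℝ)
    (hf_cont : ∀ n, ContinuousOn (f n) (Set.Ioi 0))
    (hf_mono : ∀ n, StrictMonoOn (f n) (Set.Ioi 0))
    (hf_pos : ∀ n x, 0 < x → 0 < f n x)
    (hf_deriv : ∀ n x, 0 < x → HasDerivAt (f n) (f' n x) x)
    (hlower : ∃ ε₀ : ℝ, 0 < ε₀ ∧ ∃ δ₀ ∈ Set.Ioc (0:ℝ) 1, ∃ n₀ : ℕ,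
      ∀ n ≥ n₀, ∀ x : ℝ, 0 < x → 1 - δ₀ ≤ x → ε₀ * s n * f n x ≤ x * f' n x) :
    ∀ ε : ℝ, 0 < ε → ∀ ε' : ℝ, 0 < ε' → ∃ n₁ : ℕ, ∃ K : ℝ,
      ∀ n ≥ n₁, ∀ t : ℝ, 0 ≤ t →
        ∫⁻ x in Set.Ioi (0:ℝ),
            Set.indicator {x : ℝ | K * f n 1 ≤ f n x - t}
              (fun x => ENNReal.ofReal (Real.exp (-(ε * (f n x - t) / f n 1)))) x
          ≤ ENNReal.ofReal (ε' / s n) := by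
  obtain ⟨ε₀, hε₀, δ₀, hδ₀, n₀, hl⟩ := hlower
  intro ε hε ε' hε'
  obtain ⟨n₂, hn₂⟩ := eventually_atTop.1 (hs.eventually_ge_atTop (1 / ε₀))
  refine ⟨max n₀ n₂, max 1 (-(Real.log (ε' * ε * ε₀)) / ε), ?_⟩
  intro n hn t ht
  set K : ℝ := max 1 (-(Real.log (ε' * ε * ε₀)) / ε) with hK
  have hK1 : 1 ≤ K := le_max_left _ _
  have hK2 : Real.exp (-(ε * K)) ≤ ε' * ε * ε₀ := by
    rw [← Real.le_log_iff_exp_le (by positivity)]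
    have h : -(Real.log (ε' * ε * ε₀)) / ε ≤ K := le_max_right _ _
    rw [div_le_iff₀ hε] at h
    linarith
  have hsn := hs_pos n
  have hf1 := hf_pos n 1 one_pos
  have hc : 1 ≤ ε₀ * s n := by
    have h := hn₂ n ((le_max_right _ _).trans hn)
    rw [div_le_iff₀ hε₀] at h
    linarith
  have hg := growth_aux (f n) (f' n) (ε₀ * s n) hc (hf_pos n) (hf_deriv n)
    (fun x hx => hl n ((le_max_left _ _).trans hn) x (by linarith) (by linarith [hδ₀.1]))
  set S : Set ℝ := {x : ℝ | 1 ≤ x ∧ K * f n 1 ≤ f n x - t} with hS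
  set a := sInf S with ha
  have hSbdd : BddBelow S := ⟨1, fun x hx => hx.1⟩
  have hkey : ∀ x ∈ S, a ≤ x ∧ K * f n 1 + ε₀ * s n * f n 1 * (x - a) ≤ f n x - t := by
    intro x hx
    refine ⟨csInf_le hSbdd hx, ?_⟩
    have hcp : 0 < ε₀ * s n * f n 1 := by positivity
    have : x - (f n x - t - K * f n 1) / (ε₀ * s n * f n 1) ≤ a := by
      apply le_csInf ⟨x, hx⟩
      intro y hy
      rw [sub_le_comm, le_div_iff₀ hcp]
      rcases le_total y x with h | h
      · have := hg y x hy.1 h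
        have := hy.2
        linarith
      · have := hx.2
        have := mul_nonneg (sub_nonneg.2 h) hcp.le
        linarith
    rw [sub_le_comm, le_div_iff₀ hcp] at this
    linarith
  have hb : -(ε * ε₀ * s n) < 0 := by
    have : 0 < ε * ε₀ * s n := by positivity
    linarith
  set G : ℝ → ℝ := fun x => Real.exp (-(ε * K) + ε * ε₀ * s n * a) *
    Real.exp (-(ε * ε₀ * s n) * x) with hG
  have hGint : IntegrableOn G (Set.Ioi a) := (integrableOn_exp_mul_Ioi hb a).const_mul _
  have hGval : ∫ x in Set.Ioi a, G x = Real.exp (-(ε * K)) / (ε * ε₀ * s n) := by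
    rw [hG, integral_const_mul, integral_exp_mul_Ioi hb, neg_div_neg_eq, ← mul_div_assoc,
      ← Real.exp_add]
    congr 2
    ring
  calc _ ≤ ∫⁻ x in Set.Ioi (0:ℝ), (Set.Ici a).indicator (fun x => ENNReal.ofReal (G x)) x := by
        apply setLIntegral_mono' measurableSet_Ioi
        intro x hx
        by_cases hxS : K * f n 1 ≤ f n x - t
        · have hx1 : 1 ≤ x := by
            by_contra h
            have := hf_mono n hx (Set.mem_Ioi.2 one_pos) (not_le.1 h)
            nlinarith
          obtain ⟨hax, hk⟩ := hkey x ⟨hx1, hxS⟩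
          rw [Set.indicator_of_mem (show x ∈ {x : ℝ | K * f n 1 ≤ f n x - t} from hxS),
            Set.indicator_of_mem (Set.mem_Ici.2 hax)]
          apply ENNReal.ofReal_le_ofReal
          rw [hG]
          simp only
          rw [← Real.exp_add]
          apply Real.exp_le_exp.2
          have h5 : ε * (K + ε₀ * s n * (x - a)) ≤ ε * (f n x - t) / f n 1 := by
            rw [le_div_iff₀ hf1]
            have := mul_le_mul_of_nonneg_left hk hε.le
            linarith
          linarith
        · rw [Set.indicator_of_notMem (show x ∉ {x : ℝ | K * f n 1 ≤ f n x - t} from hxS)]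
          exact zero_le
    _ ≤ ∫⁻ x, (Set.Ici a).indicator (fun x => ENNReal.ofReal (G x)) x :=
        setLIntegral_le_lintegral _ _
    _ = ∫⁻ x in Set.Ioi a, ENNReal.ofReal (G x) := by
        rw [lintegral_indicator measurableSet_Ici, restrict_Ioi_eq_restrict_Ici]
    _ = ENNReal.ofReal (Real.exp (-(ε * K)) / (ε * ε₀ * s n)) := by
        rw [← hGval, ofReal_integral_eq_lintegral_ofReal hGint]
        exact Eventually.of_forall fun x => by positivity
    _ ≤ ENNReal.ofReal (ε' / s n) := by
        apply ENNReal.ofReal_le_ofReal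
        rw [div_le_div_iff₀ (by positivity) hsn]
        nlinarith
end

section
/- Let (s_n) be a positive sequence with s_n → ∞ and (f_n) continuous strictly increasing functions from (0,∞) to (0,∞) satisfying Condition (S) and Condition (W). For all sufficiently large n, let λ_n > 0 satisfy ∫_0^∞ e^{−λ_n f_n(x)} dx = 1. Then for every K < ∞ there exist ε_K > 0 and n₀ ∈ ℕ such that for all n ≥ n₀ and all t with 0 ≤ t ≤ K f_n(1): ∫_0^∞ 1{ f_n(x) ≥ t } e^{−λ_n (f_n(x) − t)} dx ≥ ε_K/s_n. -/
open MeasureTheory Filter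

/-- Upper bound on `lam * f 1`. -/
lemma lam_bound (s ε lam : ℝ) (f : ℝ → ℝ) (hs1 : 1 ≤ s) (hε : 0 < ε) (hsε : 1 ≤ s * ε)
    (hmono : StrictMonoOn f (Set.Ioi 0)) (hpos : ∀ x, 0 < x → 0 < f x)
    (hq : f 1 / 4 ≤ f ((1 / 2 : ℝ) ^ (1 / s)))
    (hW : ∀ x : ℝ, 1 ≤ x → f 1 * x ^ ε ≤ f (x ^ (1 / s)))
    (hl : 0 < lam) (hint : ∫ x in Set.Ioi (0:ℝ), Real.exp (-(lam * f x)) = 1) :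
    lam * f 1 ≤ 4 + 8 / ε := by
  have hf1 : 0 < f 1 := hpos 1 one_pos
  by_contra hcon
  push Not at hcon
  have h8 : 0 < 8 / ε := by positivity
  have hs0 : 0 < s := by linarith
  set a := lam * f 1 with ha
  have ha0 : 0 < a := by positivity
  have ha4 : 4 < a := by linarith
  have haε : 8 < a * ε := by
    have : 8 / ε < a := by linarith
    rwa [div_lt_iff₀ hε] at this
  set q := (1 / 2 : ℝ) ^ (1 / s) with hqdef
  have hq0 : 0 < q := by positivity
  have hq1 : q ≤ 1 := Real.rpow_le_one (by norm_num) (by norm_num) (by positivity)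
  have hlog : (1:ℝ) / 2 ≤ Real.log 2 := by linarith [Real.log_two_gt_d9]
  have hqu : 1 / (4 * s) ≤ 1 - q := by
    have e1 : q * Real.exp (Real.log 2 / s) = 1 := by
      rw [hqdef, Real.rpow_def_of_pos (by norm_num), ← Real.exp_add]
      rw [show Real.log (1/2) = - Real.log 2 by rw [one_div, Real.log_inv]]
      rw [show -Real.log 2 * (1 / s) + Real.log 2 / s = 0 by ring, Real.exp_zero]
    have e2 : 1 + 1 / (2 * s) ≤ Real.exp (Real.log 2 / s) := by
      have := Real.add_one_le_exp (Real.log 2 / s)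
      have h3 : 1 / (2 * s) ≤ Real.log 2 / s := by
        rw [show 1 / (2 * s) = (1/2) / s by field_simp]
        gcongr
      linarith
    have e3 : q * (1 + 1 / (2 * s)) ≤ 1 := by
      exact le_trans (by gcongr) e1.le
    have e4 : 1 / (2 * s) ≤ 1 := by
      rw [div_le_one (by positivity)]; linarith
    have e5 : 1 / (4 * s) = (1 / (2 * s)) / 2 := by field_simp; norm_num
    have e6 : 0 < 1 / (2 * s) := by positivity
    rw [e5]
    set u := 1 / (2 * s)
    by_contra hc
    push Not at hc
    nlinarith
  have hI : IntegrableOn (fun x => Real.exp (-(lam * f x))) (Set.Ioi 0) := by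
    by_contra hc
    rw [integral_undef hc] at hint
    exact zero_ne_one hint
  have hs1' : Set.Ioi (0:ℝ) = (Set.Ioc 0 q ∪ Set.Ioc q 1) ∪ Set.Ioi 1 := by
    rw [Set.Ioc_union_Ioc_eq_Ioc hq0.le hq1, Set.Ioc_union_Ioi_eq_Ioi zero_le_one]
  have hI1 : IntegrableOn (fun x => Real.exp (-(lam * f x))) (Set.Ioc 0 q) :=
    hI.mono_set (fun x hx => hx.1)
  have hI2 : IntegrableOn (fun x => Real.exp (-(lam * f x))) (Set.Ioc q 1) :=
    hI.mono_set (fun x hx => hq0.trans hx.1)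
  have hI3 : IntegrableOn (fun x => Real.exp (-(lam * f x))) (Set.Ioi 1) :=
    hI.mono_set (fun x (hx : 1 < x) => zero_lt_one.trans hx)
  rw [hs1', setIntegral_union _ measurableSet_Ioi (hI1.union hI2) hI3,
    setIntegral_union _ measurableSet_Ioc hI1 hI2] at hint
  rotate_left
  · rw [Set.disjoint_left]; intro x hx hy; exact absurd hx.2 (not_le.2 hy.1)
  · rw [Set.Ioc_union_Ioc_eq_Ioc hq0.le hq1, Set.disjoint_left]
    intro x hx hy; exact absurd hx.2 (not_le.2 hy)
  have b1 : ∫ x in Set.Ioc 0 q, Real.exp (-(lam * f x)) ≤ q := by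
    have : ∫ x in Set.Ioc 0 q, Real.exp (-(lam * f x)) ≤ ∫ x in Set.Ioc 0 q, (1:ℝ) := by
      refine setIntegral_mono_on hI1 (integrableOn_const (by simp)) measurableSet_Ioc ?_
      intro x hx
      rw [Real.exp_le_one_iff]
      have := mul_pos hl (hpos x hx.1)
      linarith
    simpa [hq0.le] using this
  have b2 : ∫ x in Set.Ioc q 1, Real.exp (-(lam * f x)) ≤ (1 - q) * (1 / 2) := by
    have : ∫ x in Set.Ioc q 1, Real.exp (-(lam * f x)) ≤ ∫ x in Set.Ioc q 1, (1/2:ℝ) := by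
      refine setIntegral_mono_on hI2 (integrableOn_const (by simp)) measurableSet_Ioc ?_
      intro x hx
      have h1 : f q < f x := hmono hq0 (hq0.trans hx.1) hx.1
      have h2 : lam * (f 1 / 4) ≤ lam * f x := by gcongr; linarith
      have h3 : Real.exp (-(lam * f x)) ≤ Real.exp (-1) := by
        apply Real.exp_le_exp.2; linarith
      linarith [Real.exp_neg_one_lt_d9]
    refine this.trans (le_of_eq ?_)
    simp [hq1]
  have b3 : ∫ x in Set.Ioi 1, Real.exp (-(lam * f x)) ≤ 1 / (a * (s * ε)) := by
    have hc : -(a * (s * ε)) < 0 := by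
      have : 0 < a * (s * ε) := by positivity
      linarith
    have hJ := integrableOn_exp_mul_Ioi hc 1
    have : ∫ x in Set.Ioi 1, Real.exp (-(lam * f x)) ≤
        ∫ x in Set.Ioi 1, Real.exp (a * (s * ε)) * Real.exp (-(a * (s * ε)) * x) := by
      refine setIntegral_mono_on hI3 (hJ.const_mul _) measurableSet_Ioi ?_
      intro x hx
      have hx1 : 1 < x := hx
      have hx0 : 0 < x := by linarith
      rw [← Real.exp_add]
      apply Real.exp_le_exp.2
      have w := hW (x ^ s) (Real.one_le_rpow hx1.le hs0.le)
      rw [← Real.rpow_mul hx0.le, ← Real.rpow_mul hx0.le, mul_one_div_cancel hs0.ne',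
        Real.rpow_one] at w
      have bern : 1 + (s * ε) * (x - 1) ≤ x ^ (s * ε) := by
        have := one_add_mul_self_le_rpow_one_add (s := x - 1) (by linarith) hsε
        simpa using this
      have w2 : lam * (f 1 * (1 + (s * ε) * (x - 1))) ≤ lam * f x := by
        gcongr
        exact le_trans (by gcongr) w
      have : lam * (f 1 * (1 + (s * ε) * (x - 1))) = a + a * (s * ε) * (x - 1) := by
        rw [ha]; ring
      linarith
    refine this.trans (le_of_eq ?_)
    rw [integral_const_mul, integral_exp_mul_Ioi hc]
    rw [mul_one, neg_div_neg_eq, ← mul_div_assoc, ← Real.exp_add, add_neg_cancel, Real.exp_zero]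
  have b4 : 1 / (a * (s * ε)) < 1 / (8 * s) := by
    apply one_div_lt_one_div_of_lt (by positivity)
    nlinarith
  have b5 : 1 / (8 * s) = 1 / (4 * s) * (1 / 2) := by field_simp; norm_num
  linarith

/-- under Conditions (S) and (W), for `0 ≤ t ≤ K f_n(1)` one has
`∫ e^{-λ_n y} μ_n(t + dy) ≥ ε_K / s_n` for large `n`. -/
theorem statement7 (s : ℕ → ℝ) (hs_pos : ∀ n, 0 < s n) (hs : Tendsto s atTop atTop)
    (f : ℕ → ℝ → ℝ)
    (hf_cont : ∀ n, ContinuousOn (f n) (Set.Ioi 0))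
    (hf_mono : ∀ n, StrictMonoOn (f n) (Set.Ioi 0))
    (hf_pos : ∀ n x, 0 < x → 0 < f n x)
    -- Condition (S)
    (hS : ∀ x : ℝ, 0 ≤ x → Tendsto (fun n => f n (x ^ (1 / s n)) / f n 1) atTop (nhds x))
    -- Condition (W)
    (hW : ∃ ε₀ : ℝ, 0 < ε₀ ∧ ∃ δ : ℕ → ℝ, (∀ n, δ n ∈ Set.Ioc (0:ℝ) 1) ∧
      Tendsto (fun n => s n * f n (1 - δ n) / f n 1) atTop (nhds 0) ∧
      (∀ n, ∀ x : ℝ, 1 ≤ x → f n 1 * x ^ ε₀ ≤ f n (x ^ (1 / s n))) ∧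
      (∀ n, ∀ x : ℝ, (1 - δ n) ^ s n ≤ x → x ≤ 1 → f n (x ^ (1 / s n)) ≤ f n 1 * x ^ ε₀))
    -- the Malthusian parameters, defined for sufficiently large n
    (lam : ℕ → ℝ) (n₁ : ℕ)
    (hlam : ∀ n ≥ n₁, 0 < lam n ∧
      ∫ x in Set.Ioi (0:ℝ), Real.exp (-(lam n * f n x)) = 1) :
    ∀ K : ℝ, ∃ εK : ℝ, 0 < εK ∧ ∃ n₀ : ℕ, ∀ n ≥ n₀, ∀ t : ℝ, 0 ≤ t → t ≤ K * f n 1 →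
      ENNReal.ofReal (εK / s n) ≤
        ∫⁻ x in Set.Ioi (0:ℝ),
          Set.indicator {x : ℝ | t ≤ f n x}
            (fun x => ENNReal.ofReal (Real.exp (-(lam n * (f n x - t))))) x := by
  intro K
  obtain ⟨ε, hε, δ, -, -, hW1, -⟩ := hW
  set M := max K 1 with hM
  have hM1 : 1 ≤ M := le_max_right _ _
  have hM0 : 0 < M := by linarith
  have hKM : K ≤ M := le_max_left _ _
  set C := 4 + 8 / ε with hC
  refine ⟨Real.exp (-(5 * M * C)) * (1 / 2), by positivity, ?_⟩
  have E1 := (hS (1/2) (by norm_num)).eventually (lt_mem_nhds (show (1/4:ℝ) < 1/2 by norm_num))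
  have E2 := (hS (2 * M) (by positivity)).eventually (lt_mem_nhds (show M < 2 * M by linarith))
  have E3 := (hS (4 * M) (by positivity)).eventually
    (gt_mem_nhds (show 4 * M < 5 * M by linarith))
  have E := (eventually_ge_atTop n₁).and <| (hs.eventually_ge_atTop 1).and <|
    (hs.eventually_ge_atTop (1 / ε)).and <| E1.and <| E2.and E3
  obtain ⟨n₀, hn₀⟩ := eventually_atTop.1 E
  refine ⟨n₀, fun n hn t ht0 htK => ?_⟩
  obtain ⟨hn1, hs1, hsε, e1, e2, e3⟩ := hn₀ n hn
  have hf1 : 0 < f n 1 := hf_pos n 1 one_pos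
  rw [lt_div_iff₀ hf1] at e1 e2
  rw [div_lt_iff₀ hf1] at e3
  rw [div_le_iff₀ hε] at hsε
  obtain ⟨hl, hint⟩ := hlam n hn1
  have hb := lam_bound (s n) ε (lam n) (f n) hs1 hε hsε (hf_mono n) (hf_pos n)
    (by linarith) (hW1 n) hl hint
  have hs0 := hs_pos n
  set p := (2 * M) ^ (1 / s n) with hp
  set r := (4 * M) ^ (1 / s n) with hr
  have hp1 : 1 ≤ p := Real.one_le_rpow (by linarith) (by positivity)
  have hp0 : 0 < p := by linarith
  have hrp : 1 / 2 / s n ≤ r - p := by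
    have h1 : r = p * Real.exp (Real.log 2 / s n) := by
      rw [hr, show 4 * M = (2 * M) * 2 by ring, Real.mul_rpow (by positivity) (by norm_num), hp,
        Real.rpow_def_of_pos (show (0:ℝ) < 2 by norm_num), mul_one_div]
    have h2 := Real.add_one_le_exp (Real.log 2 / s n)
    have h3 : 1 / 2 / s n ≤ Real.log 2 / s n := by
      gcongr; linarith [Real.log_two_gt_d9]
    have h4 : 0 < 1 / 2 / s n := by positivity
    rw [h1]
    nlinarith
  have hr0 : 0 < r := by positivity
  have key : ∀ x ∈ Set.Ioo p r, ENNReal.ofReal (Real.exp (-(5 * M * C))) ≤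
      Set.indicator {x : ℝ | t ≤ f n x}
        (fun x => ENNReal.ofReal (Real.exp (-(lam n * (f n x - t))))) x := by
    intro x hx
    have hx0 : 0 < x := hp0.trans hx.1
    have k1 : f n p < f n x := hf_mono n hp0 hx0 hx.1
    have k2 : f n x < f n r := hf_mono n hx0 hr0 hx.2
    have k3 : K * f n 1 ≤ M * f n 1 := by gcongr
    have hxt : x ∈ {x : ℝ | t ≤ f n x} := by
      show t ≤ f n x
      linarith
    rw [Set.indicator_of_mem hxt]
    apply ENNReal.ofReal_le_ofReal
    apply Real.exp_le_exp.2
    have k4 : lam n * (f n x - t) ≤ lam n * (5 * M * f n 1) := by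
      gcongr; linarith
    have k5 : 5 * M * (lam n * f n 1) ≤ 5 * M * C := by gcongr
    linarith
  calc ENNReal.ofReal (Real.exp (-(5 * M * C)) * (1 / 2) / s n)
      ≤ ENNReal.ofReal (Real.exp (-(5 * M * C)) * (r - p)) := by
        apply ENNReal.ofReal_le_ofReal
        rw [mul_div_assoc]
        gcongr
    _ = ∫⁻ x in Set.Ioo p r, ENNReal.ofReal (Real.exp (-(5 * M * C))) := by
        rw [setLIntegral_const, Real.volume_Ioo, ENNReal.ofReal_mul (Real.exp_pos _).le]
    _ ≤ ∫⁻ x in Set.Ioo p r, Set.indicator {x : ℝ | t ≤ f n x}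
        (fun x => ENNReal.ofReal (Real.exp (-(lam n * (f n x - t))))) x :=
        setLIntegral_mono' measurableSet_Ioo key
    _ ≤ _ := lintegral_mono_set (fun x hx => hp0.trans hx.1)
end

section
/- Let (s_n) be a positive sequence and (f_n) differentiable strictly increasing functions from (0,∞) to (0,∞) satisfying Condition (D1) with δ₀ ∈ (0,1) strictly less than 1: there exist ε₀ > 0, δ₀ ∈ (0,1) and n₀ such that ε₀ s_n ≤ x f_n′(x)/f_n(x) ≤ s_n/ε₀ whenever 1 − δ₀ ≤ x ≤ 1 and n ≥ n₀. Then there exists a constant C < ∞ (independent of n) such that for all n ≥ n₀ and all u with f_n(1−δ₀) ≤ u ≤ f_n(1): f_n^{−1}(u) ≤ 1 − (1/(C s_n)) · log( f_n(1)/u ). -/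
/-- under Condition (D1) with `δ₀ < 1`, there is a constant `C < ∞` such that
`f_n^{-1}(u) ≤ 1 - log(f_n(1)/u)/(C s_n)` for all `u ∈ [f_n(1-δ₀), f_n(1)]` and `n ≥ n₀`. -/
theorem statement8 (s : ℕ → ℝ) (hs_pos : ∀ n, 0 < s n)
    (f f' g : ℕ → ℝ → ℝ)
    (hf_mono : ∀ n, StrictMonoOn (f n) (Set.Ioi 0))
    (hf_pos : ∀ n x, 0 < x → 0 < f n x)
    (hf_deriv : ∀ n x, 0 < x → HasDerivAt (f n) (f' n x) x)
    (hg : ∀ n x, 0 < x → g n (f n x) = x)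
    (ε₀ δ₀ : ℝ) (n₀ : ℕ) (hε₀ : 0 < ε₀) (hδ₀ : δ₀ ∈ Set.Ioo (0:ℝ) 1)
    -- Condition (D1), with δ₀ < 1
    (hD1 : ∀ n ≥ n₀, ∀ x : ℝ, 1 - δ₀ ≤ x → x ≤ 1 →
      ε₀ * s n ≤ x * f' n x / f n x ∧ x * f' n x / f n x ≤ s n / ε₀) :
    ∃ C : ℝ, 0 < C ∧ ∀ n ≥ n₀, ∀ u : ℝ, f n (1 - δ₀) ≤ u → u ≤ f n 1 →
      g n u ≤ 1 - 1 / (C * s n) * Real.log (f n 1 / u) := by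
  obtain ⟨hd0, hd1⟩ := hδ₀
  have hd : 0 < 1 - δ₀ := by linarith
  refine ⟨1 / (ε₀ * (1 - δ₀)), by positivity, ?_⟩
  intro n hn u hu1 hu2
  have hcont : ContinuousOn (f n) (Set.Icc (1 - δ₀) 1) := fun y hy =>
    (hf_deriv n y (by linarith [hy.1])).continuousAt.continuousWithinAt
  obtain ⟨x, ⟨hx1, hx2⟩, rfl⟩ :=
    intermediate_value_Icc (by linarith : 1 - δ₀ ≤ 1) hcont ⟨hu1, hu2⟩
  have hx0 : 0 < x := by linarith
  have hs := hs_pos n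
  rw [hg n x hx0, Real.log_div (hf_pos n 1 one_pos).ne' (hf_pos n x hx0).ne']
  have key : Real.log (f n 1) - Real.log (f n x) ≤ s n / (ε₀ * (1 - δ₀)) * (1 - x) := by
    rcases hx2.eq_or_lt with h | h
    · subst h; simp
    have hder : ∀ y, 0 < y → HasDerivAt (fun z => Real.log (f n z)) (f' n y / f n y) y :=
      fun y hy => (hf_deriv n y hy).log (hf_pos n y hy).ne'
    obtain ⟨c, ⟨hc1, hc2⟩, hc⟩ := exists_hasDerivAt_eq_slope
      (fun z => Real.log (f n z)) (fun y => f' n y / f n y) h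
      (fun y hy => (hder y (by linarith [hy.1])).continuousAt.continuousWithinAt)
      (fun y hy => hder y (by linarith [hy.1]))
    have h1x : 0 < 1 - x := by linarith
    have hc0 : 0 < c := by linarith
    rw [eq_div_iff h1x.ne'] at hc
    rw [← hc]
    refine mul_le_mul_of_nonneg_right ?_ h1x.le
    have hb := (hD1 n hn c (by linarith) hc2.le).2
    rw [mul_div_assoc] at hb
    have h3 : f' n c / f n c ≤ s n / ε₀ / c := by
      rw [le_div_iff₀ hc0]; linarith
    refine h3.trans ?_
    rw [div_div]
    gcongr
    linarith
  have h4 : 1 / (1 / (ε₀ * (1 - δ₀)) * s n) * (Real.log (f n 1) - Real.log (f n x))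
      ≤ 1 / (1 / (ε₀ * (1 - δ₀)) * s n) * (s n / (ε₀ * (1 - δ₀)) * (1 - x)) :=
    mul_le_mul_of_nonneg_left key (by positivity)
  have h5 : 1 / (1 / (ε₀ * (1 - δ₀)) * s n) * (s n / (ε₀ * (1 - δ₀)) * (1 - x)) = 1 - x := by
    have := hd.ne'
    field_simp
  linarith
end

section
/- Let (s_n) be a positive sequence with s_n → ∞ and (f_n) continuous strictly increasing functions from (0,∞) to (0,∞) satisfying Conditions (S) and (W). Write μ̂_n(λ) = ∫_0^∞ e^{−λ f_n(x)} dx and ã = a^{1/s_n}. Then for every a > 0, for all sufficiently large n there is a unique λ_n(ã) > 0 with ã μ̂_n(λ_n(ã)) = 1, and as n → ∞: (i) f_n(1) · λ_n(ã) → a e^{−γ}; (ii) s_n λ_n(ã) · ∫_0^∞ f_n(x) ã e^{−λ_n(ã) f_n(x)} dx → 1; (iii) s_n λ_n(ã)^2 · ∫_0^∞ f_n(x)^2 ã e^{−λ_n(ã) f_n(x)} dx → 1; (iv) for every β > 0, a · ( μ̂_n( β λ_n(ã) ) )^{s_n} → 1/β. Moreover, given any compact subset A of (0,∞), all four convergences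 hold uniformly for a ∈ A, and the convergence in (iv) holds uniformly for a, β ∈ A. -/
open MeasureTheory Filter

section Aux

open Set Topology

structure Cond {ι : Type} (l : Filter ι) (s : ι → ℝ) (f : ι → ℝ → ℝ) (ε : ℝ) (δ : ι → ℝ) : Prop where
  s_pos : ∀ n, 0 < s n
  s_top : Tendsto s l atTop
  cont : ∀ n, ContinuousOn (f n) (Set.Ioi 0)
  mono : ∀ n, StrictMonoOn (f n) (Set.Ioi 0)
  pos : ∀ n x, 0 < x → 0 < f n x
  scal : ∀ x : ℝ, 0 ≤ x → Tendsto (fun n => f n (x ^ (1 / s n)) / f n 1) l (nhds x)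
  eps : 0 < ε
  del : ∀ n, δ n ∈ Set.Ioc (0:ℝ) 1
  small : Tendsto (fun n => s n * f n (1 - δ n) / f n 1) l (nhds 0)
  lower : ∀ n, ∀ x : ℝ, 1 ≤ x → f n 1 * x ^ ε ≤ f n (x ^ (1 / s n))
  upper : ∀ n, ∀ x : ℝ, (1 - δ n) ^ s n ≤ x → x ≤ 1 → f n (x ^ (1 / s n)) ≤ f n 1 * x ^ ε

theorem Cond.comp {ι κ : Type} {l : Filter ι} {s f ε δ} (h : Cond l s f ε δ) {l' : Filter κ}
    {N : κ → ι} (hN : Tendsto N l' l) :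
    Cond l' (fun k => s (N k)) (fun k => f (N k)) ε (fun k => δ (N k)) where
  s_pos _ := h.s_pos _
  s_top := h.s_top.comp hN
  cont _ := h.cont _
  mono _ := h.mono _
  pos _ := h.pos _
  scal x hx := (h.scal x hx).comp hN
  eps := h.eps
  del _ := h.del _
  small := h.small.comp hN
  lower _ := h.lower _
  upper _ := h.upper _

noncomputable def Psi (φ₁ φ₂ : ℝ → ℝ) (y u : ℝ) : ℝ := if y ≤ 1 then φ₁ u else φ₂ u

theorem Psi_meas {φ₁ φ₂ : ℝ → ℝ} (h1 : Continuous φ₁) (h2 : Continuous φ₂) :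
    Measurable (fun q : ℝ × ℝ => Psi φ₁ φ₂ q.1 q.2) := by
  unfold Psi
  exact Measurable.ite (measurableSet_le measurable_fst measurable_const)
    (h1.measurable.comp measurable_snd) (h2.measurable.comp measurable_snd)

theorem Psi_aemeas {φ₁ φ₂ : ℝ → ℝ} (h1 : Continuous φ₁) (h2 : Continuous φ₂) {g : ℝ → ℝ}
    (hg : ContinuousOn g (Ioi 0)) :
    AEMeasurable (fun y => Psi φ₁ φ₂ y (g y)) (volume.restrict (Ioi 0)) :=
  (Psi_meas h1 h2).comp_aemeasurable
    (aemeasurable_id.prodMk (hg.aemeasurable measurableSet_Ioi))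

theorem lower' {ι : Type} {l : Filter ι} {s f ε δ} (h : Cond l s f ε δ) (n : ι) {y : ℝ} (hy : 1 ≤ y) :
    y ^ (s n * ε) ≤ f n y / f n 1 := by
  have hy0 : 0 ≤ y := by linarith
  have := h.lower n (y ^ s n) (Real.one_le_rpow hy (h.s_pos n).le)
  rw [← Real.rpow_mul hy0, ← Real.rpow_mul hy0, mul_one_div_cancel (h.s_pos n).ne', Real.rpow_one] at this
  rw [le_div_iff₀ (h.pos n 1 one_pos)]
  linarith

theorem Psi_int {ι : Type} {l : Filter ι} {s f ε δ} (h : Cond l s f ε δ) (n : ι)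
    {φ₁ φ₂ : ℝ → ℝ} (h1 : Continuous φ₁) (h2 : Continuous φ₂) {K : ℝ} (hK : 0 ≤ K)
    (hφ₁ : ∀ u, 0 ≤ u → |φ₁ u| ≤ K * u) (hφ₂ : ∀ u, 0 ≤ u → |φ₂ u| ≤ K * Real.exp (-(u / 2)))
    {c : ℝ} (hc : 0 < c) :
    IntegrableOn (fun y => Psi φ₁ φ₂ y (c * (f n y / f n 1))) (Ioi 0) := by
  have hf1 := h.pos n 1 one_pos
  have i1 : IntegrableOn ((Ioc (0:ℝ) 1).indicator (fun _ => K * c)) (Ioi 0) := by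
    apply IntegrableOn.integrable_indicator _ measurableSet_Ioc |>.integrableOn
    exact integrableOn_const (by simp)
  have i2 : IntegrableOn (fun y : ℝ => y ^ (0:ℝ) * Real.exp (-(c/2) * y ^ (s n * ε))) (Ioi 0) :=
    integrableOn_rpow_mul_exp_neg_mul_rpow (by norm_num) (mul_pos (h.s_pos n) h.eps) (by positivity)
  refine Integrable.mono' (i1.add (i2.const_mul K)) (Psi_aemeas h1 h2
    (continuousOn_const.mul ((h.cont n).div_const _))).aestronglyMeasurable ?_
  filter_upwards [ae_restrict_mem measurableSet_Ioi] with y hy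
  have hy : 0 < y := hy
  have hp : 0 ≤ c * (f n y / f n 1) := mul_nonneg hc.le (div_nonneg (h.pos n y hy).le hf1.le)
  simp only [Pi.add_apply, Real.norm_eq_abs, Real.rpow_zero, one_mul]
  by_cases hy1 : y ≤ 1
  · rw [indicator_of_mem (show y ∈ Ioc (0:ℝ) 1 from ⟨hy, hy1⟩), Psi, if_pos hy1]
    have : f n y / f n 1 ≤ 1 := by
      rw [div_le_one hf1]
      exact (h.mono n).monotoneOn hy (mem_Ioi.2 one_pos) hy1
    have h3 : K * (c * (f n y / f n 1)) ≤ K * c := by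
      apply mul_le_mul_of_nonneg_left _ hK
      exact mul_le_of_le_one_right hc.le this
    have : 0 ≤ K * Real.exp (-(c / 2) * y ^ (s n * ε)) := by positivity
    linarith [hφ₁ _ hp]
  · rw [indicator_of_notMem (fun h => hy1 h.2), Psi, if_neg hy1, zero_add]
    refine (hφ₂ _ hp).trans ?_
    have := lower' h n (not_le.1 hy1).le
    gcongr
    nlinarith

theorem core {ι : Type} {l : Filter ι} [l.IsCountablyGenerated] {s f ε δ} (h : Cond l s f ε δ)
    {φ₁ φ₂ : ℝ → ℝ} (h1 : Continuous φ₁) (h2 : Continuous φ₂) {K : ℝ} (hK : 0 ≤ K)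
    (hφ₁ : ∀ u, 0 ≤ u → |φ₁ u| ≤ K * u) (hφ₂ : ∀ u, 0 ≤ u → |φ₂ u| ≤ K * Real.exp (-(u / 2)))
    {c : ι → ℝ} {c₀ : ℝ} (hc₀ : 0 < c₀) (hc : Tendsto c l (𝓝 c₀)) :
    Tendsto (fun n => s n * ∫ y in Ioi 0, Psi φ₁ φ₂ y (c n * (f n y / f n 1))) l
      (𝓝 (∫ x in Ioi 0, x⁻¹ * Psi φ₁ φ₂ x (c₀ * x))) := by
  have hs1 : ∀ᶠ n in l, 1 ≤ s n := h.s_top.eventually_ge_atTop 1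
  have hc1 : ∀ᶠ n in l, c₀ / 2 < c n := hc.eventually_const_lt (by linarith)
  have hc2 : ∀ᶠ n in l, c n < 2 * c₀ := hc.eventually_lt_const (by linarith)
  have hsm : Tendsto (fun n => f n (1 - δ n) / f n 1) l (𝓝 0) := by
    have h0 : Tendsto (fun n => ‖s n * f n (1 - δ n) / f n 1‖) l (𝓝 0) := by
      have := h.small.norm
      rwa [norm_zero] at this
    apply squeeze_zero_norm' _ h0
    filter_upwards [hs1] with n hn
    rw [mul_div_assoc, norm_mul]
    apply le_mul_of_one_le_left (norm_nonneg _)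
    rw [Real.norm_eq_abs]; exact hn.trans (le_abs_self _)
  -- the two parts
  have split : ∀ᶠ n in l, s n * ∫ y in Ioi 0, Psi φ₁ φ₂ y (c n * (f n y / f n 1)) =
      s n * (∫ y in Ioi 0, (Iio (1 - δ n)).indicator
        (fun y => Psi φ₁ φ₂ y (c n * (f n y / f n 1))) y)
      + ∫ x in Ioi 0, x ^ (1 / s n - 1) * (Ici (1 - δ n)).indicator
        (fun y => Psi φ₁ φ₂ y (c n * (f n y / f n 1))) (x ^ (1 / s n)) := by
    filter_upwards [hc1] with n hn
    have hsp := h.s_pos n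
    have I := Psi_int h n h1 h2 hK hφ₁ hφ₂ (c := c n) (by linarith)
    set G := fun y => Psi φ₁ φ₂ y (c n * (f n y / f n 1)) with hG
    have e1 : ∫ y in Ioi 0, G y = (∫ y in Ioi 0, (Iio (1 - δ n)).indicator G y) +
        ∫ y in Ioi 0, (Ici (1 - δ n)).indicator G y := by
      rw [← integral_add (I.indicator measurableSet_Iio) (I.indicator measurableSet_Ici)]
      congr 1; ext y
      by_cases hy : y < 1 - δ n
      · simp [indicator, hy, not_le.2 hy]
      · simp [indicator, hy, not_lt.1 hy]
    have e2 := integral_comp_rpow_Ioi ((Ici (1 - δ n)).indicator G) (p := 1 / s n) (by positivity)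
    rw [e1, mul_add, ← e2]
    congr 1
    rw [← integral_const_mul]
    apply setIntegral_congr_fun measurableSet_Ioi
    intro x hx
    simp only [smul_eq_mul]
    rw [abs_of_pos (by positivity)]
    field_simp
  refine Tendsto.congr' (EventuallyEq.symm split) ?_
  rw [← zero_add (∫ x in Ioi 0, x⁻¹ * Psi φ₁ φ₂ x (c₀ * x))]
  apply Tendsto.add
  · -- small part
    have : Tendsto (fun n => K * (2 * c₀) * |s n * f n (1 - δ n) / f n 1|) l (𝓝 0) := by
      simpa using (h.small.abs.const_mul (K * (2 * c₀)))
    apply squeeze_zero_norm' _ this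
    filter_upwards [hc1, hc2] with n hn1 hn2
    have hsp := h.s_pos n
    have hf1 := h.pos n 1 one_pos
    have hd := h.del n
    rw [norm_mul, Real.norm_of_nonneg hsp.le, setIntegral_indicator measurableSet_Iio]
    have hset : Ioi (0:ℝ) ∩ Iio (1 - δ n) = Ioo 0 (1 - δ n) := rfl
    rw [hset]
    rcases hd.2.lt_or_eq with hlt | heq
    · have hpos := h.pos n (1 - δ n) (by linarith)
      have hb : ‖∫ y in Ioo 0 (1 - δ n), Psi φ₁ φ₂ y (c n * (f n y / f n 1))‖ ≤
          (K * (c n * (f n (1 - δ n) / f n 1))) * volume.real (Ioo 0 (1 - δ n)) := by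
        apply norm_setIntegral_le_of_norm_le_const (by simp)
        intro y hy
        have hy0 := hy.1
        rw [Psi, if_pos (by linarith [hy.2, hd.1])]
        have hc0 : 0 ≤ c n := by linarith
        refine (hφ₁ _ (mul_nonneg hc0 (div_nonneg (h.pos n y hy0).le hf1.le))).trans ?_
        have := (h.mono n).monotoneOn hy0 (show 1 - δ n ∈ Ioi 0 from hy0.trans hy.2) hy.2.le
        gcongr
      rw [Real.volume_real_Ioo_of_le (by linarith)] at hb
      have hb2 : (K * (c n * (f n (1 - δ n) / f n 1))) * (1 - δ n - 0) ≤
          K * (2 * c₀ * (f n (1 - δ n) / f n 1)) := by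
        refine (mul_le_of_le_one_right ?_ (by linarith [hd.1])).trans ?_
        · have hc0 : 0 ≤ c n := by linarith
          positivity
        · gcongr
      have := mul_le_mul_of_nonneg_left (hb.trans hb2) hsp.le
      refine this.trans (le_of_eq ?_)
      rw [abs_of_pos (by positivity)]
      ring
    · rw [heq]; simp
      positivity
  · -- main part
    have i1 : IntegrableOn ((Ioc (0:ℝ) 1).indicator (fun x => 2 * K * c₀ * x ^ (ε - 1))) (Ioi 0) := by
      apply IntegrableOn.integrable_indicator _ measurableSet_Ioc |>.integrableOn
      have := (intervalIntegral.intervalIntegrable_rpow' (a := 0) (b := 1) (r := ε - 1)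
        (by linarith [h.eps])).const_mul (2 * K * c₀)
      exact (intervalIntegrable_iff_integrableOn_Ioc_of_le zero_le_one).1 this
    have i2 : IntegrableOn (fun y : ℝ => y ^ (0:ℝ) * Real.exp (-(c₀/4) * y ^ ε)) (Ioi 0) :=
      integrableOn_rpow_mul_exp_neg_mul_rpow (by norm_num) h.eps (by positivity)
    refine tendsto_integral_filter_of_dominated_convergence _ ?_ ?_ (i1.add (i2.const_mul K)) ?_
    · refine Eventually.of_forall fun n => ?_
      have hsp := h.s_pos n
      have cp : ∀ r : ℝ, ContinuousOn (fun x : ℝ => x ^ r) (Ioi 0) := fun r =>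
        continuousOn_id.rpow_const (fun x hx => Or.inl (ne_of_gt hx))
      have m1 := (cp (1 / s n - 1)).aemeasurable (μ := volume) measurableSet_Ioi
      have m2 := (cp (1 / s n)).aemeasurable (μ := volume) measurableSet_Ioi
      have m3 : AEMeasurable (fun x => c n * (f n (x ^ (1 / s n)) / f n 1))
          (volume.restrict (Ioi 0)) := by
        refine ContinuousOn.aemeasurable ?_ measurableSet_Ioi
        refine continuousOn_const.mul (ContinuousOn.div_const ?_ _)
        exact (h.cont n).comp (cp _) (fun x hx => Real.rpow_pos_of_pos hx _)
      have m4 : Measurable (fun q : ℝ × ℝ => if 1 - δ n ≤ q.1 then Psi φ₁ φ₂ q.1 q.2 else 0) :=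
        Measurable.ite (measurableSet_le measurable_const measurable_fst) (Psi_meas h1 h2)
          measurable_const
      exact (m1.mul (m4.comp_aemeasurable (m2.prodMk m3))).aestronglyMeasurable
    · filter_upwards [hs1, hc1, hc2] with n hn hn1 hn2
      filter_upwards [ae_restrict_mem measurableSet_Ioi] with x hx
      have hx : 0 < x := hx
      have hsp := h.s_pos n
      have hf1 := h.pos n 1 one_pos
      have hc0 : 0 ≤ c n := by linarith
      have hp1 : 1 / s n ≤ 1 := by rw [div_le_one hsp]; exact hn
      have hxp : 0 < x ^ (1 / s n) := Real.rpow_pos_of_pos hx _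
      have hp : 0 ≤ c n * (f n (x ^ (1 / s n)) / f n 1) :=
        mul_nonneg hc0 (div_nonneg (h.pos n _ hxp).le hf1.le)
      simp only [Pi.add_apply, Real.rpow_zero, one_mul]
      rw [norm_mul, Real.norm_of_nonneg (Real.rpow_nonneg hx.le _)]
      have hr0 := Real.rpow_nonneg hx.le (1 / s n - 1)
      have hr1 := Real.rpow_nonneg hx.le (ε - 1)
      have he := Real.exp_pos (-(c₀ / 4) * x ^ ε)
      by_cases hcut : 1 - δ n ≤ x ^ (1 / s n)
      · rw [indicator_of_mem (show x ^ (1 / s n) ∈ Ici (1 - δ n) from hcut)]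
        by_cases hx1 : x ≤ 1
        · rw [indicator_of_mem (show x ∈ Ioc (0:ℝ) 1 from ⟨hx, hx1⟩), Psi,
            if_pos (Real.rpow_le_one hx.le hx1 (by positivity))]
          have hu : f n (x ^ (1 / s n)) / f n 1 ≤ x ^ ε := by
            rw [div_le_iff₀ hf1, mul_comm]
            apply h.upper n x _ hx1
            have := Real.rpow_le_rpow (by linarith [(h.del n).2]) hcut hsp.le
            rwa [← Real.rpow_mul hx.le, one_div_mul_cancel hsp.ne', Real.rpow_one] at this
          have h3 : ‖φ₁ (c n * (f n (x ^ (1 / s n)) / f n 1))‖ ≤ K * (2 * c₀ * x ^ ε) := by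
            refine (hφ₁ _ hp).trans ?_
            have := div_nonneg (h.pos n _ hxp).le hf1.le
            gcongr
          have h4 : x ^ (1 / s n - 1) ≤ x ^ (-1:ℝ) :=
            Real.rpow_le_rpow_of_exponent_ge hx hx1 (by
              have : 0 < 1 / s n := by positivity
              linarith)
          have h5 := mul_le_mul h4 h3 (norm_nonneg _) (Real.rpow_nonneg hx.le _)
          have h6 : x ^ (ε - 1) = x ^ (-1:ℝ) * x ^ ε := by
            rw [← Real.rpow_add hx]; congr 1; ring
          have : 0 ≤ K * Real.exp (-(c₀ / 4) * x ^ ε) := by positivity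
          refine h5.trans ?_
          rw [h6]
          linarith
        · have hx1' := (not_le.1 hx1)
          rw [indicator_of_notMem (fun h => hx1 h.2), Psi,
            if_neg (not_le.2 (Real.one_lt_rpow hx1' (by positivity))), zero_add]
          have hl : x ^ ε ≤ f n (x ^ (1 / s n)) / f n 1 := by
            rw [le_div_iff₀ hf1, mul_comm]
            exact h.lower n x hx1'.le
          have h3 : ‖φ₂ (c n * (f n (x ^ (1 / s n)) / f n 1))‖ ≤
              K * Real.exp (-(c₀ / 4) * x ^ ε) := by
            refine (hφ₂ _ hp).trans ?_
            have h0 := Real.rpow_nonneg hx.le ε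
            gcongr
            nlinarith
          have h4 : x ^ (1 / s n - 1) ≤ 1 :=
            Real.rpow_le_one_of_one_le_of_nonpos hx1'.le (by linarith)
          calc _ ≤ 1 * (K * Real.exp (-(c₀ / 4) * x ^ ε)) :=
                mul_le_mul h4 h3 (norm_nonneg _) zero_le_one
            _ = _ := one_mul _
      · rw [indicator_of_notMem (show x ^ (1 / s n) ∉ Ici (1 - δ n) from hcut), norm_zero, mul_zero]
        apply add_nonneg
        · apply indicator_nonneg
          intro y hy
          have := Real.rpow_nonneg hy.1.le (ε - 1)
          positivity
        · positivity
    · filter_upwards [ae_restrict_mem measurableSet_Ioi] with x hx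
      have hx : 0 < x := hx
      have hp0 : Tendsto (fun n => 1 / s n) l (𝓝 0) := by
        simp only [one_div]; exact h.s_top.inv_tendsto_atTop
      have hr : Tendsto (fun n => x ^ (1 / s n - 1)) l (𝓝 (x⁻¹)) := by
        have := (Real.continuous_const_rpow hx.ne').tendsto (0 - 1)
        have := this.comp (hp0.sub_const 1)
        rw [zero_sub, Real.rpow_neg_one] at this
        exact this
      have hg := h.scal x hx.le
      have hcg := hc.mul hg
      have e1 : ∀ᶠ n in l, x / 2 < f n (x ^ (1 / s n)) / f n 1 :=
        hg.eventually_const_lt (by linarith)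
      have e2 : ∀ᶠ n in l, f n (1 - δ n) / f n 1 < x / 2 :=
        hsm.eventually_lt_const (by linarith)
      have hcut : ∀ᶠ n in l, 1 - δ n ≤ x ^ (1 / s n) := by
        filter_upwards [e1, e2] with n a1 a2
        by_contra hlt
        push Not at hlt
        have hxp : 0 < x ^ (1 / s n) := Real.rpow_pos_of_pos hx _
        have := (h.mono n) hxp (show 1 - δ n ∈ Ioi 0 from hxp.trans hlt) hlt
        have := div_lt_div_of_pos_right this (h.pos n 1 one_pos)
        linarith
      apply hr.mul
      have key : Tendsto (fun n => Psi φ₁ φ₂ x (c n * (f n (x ^ (1 / s n)) / f n 1))) l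
          (𝓝 (Psi φ₁ φ₂ x (c₀ * x))) := by
        unfold Psi
        split_ifs
        · exact (h1.tendsto _).comp hcg
        · exact (h2.tendsto _).comp hcg
      refine key.congr' ?_
      filter_upwards [hcut] with n hn
      rw [indicator_of_mem (show x ^ (1 / s n) ∈ Ici (1 - δ n) from hn)]
      have hsp := h.s_pos n
      unfold Psi
      have : x ^ (1 / s n) ≤ 1 ↔ x ≤ 1 := by
        constructor
        · intro hh
          by_contra hx1
          exact absurd (Real.one_lt_rpow (not_le.1 hx1) (by positivity)) (not_lt.2 hh)
        · intro hx1
          exact Real.rpow_le_one hx.le hx1 (by positivity)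
      simp only [this]

/-- version with `t n` instead of `c n / f n 1`. -/
theorem core' {ι : Type} {l : Filter ι} [l.IsCountablyGenerated] {s f ε δ} (h : Cond l s f ε δ)
    {φ₁ φ₂ : ℝ → ℝ} (h1 : Continuous φ₁) (h2 : Continuous φ₂) {K : ℝ} (hK : 0 ≤ K)
    (hφ₁ : ∀ u, 0 ≤ u → |φ₁ u| ≤ K * u) (hφ₂ : ∀ u, 0 ≤ u → |φ₂ u| ≤ K * Real.exp (-(u / 2)))
    {t : ι → ℝ} {c₀ : ℝ} (hc₀ : 0 < c₀) (hc : Tendsto (fun n => f n 1 * t n) l (𝓝 c₀)) :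
    Tendsto (fun n => s n * ∫ y in Ioi 0, Psi φ₁ φ₂ y (t n * f n y)) l
      (𝓝 (∫ x in Ioi 0, x⁻¹ * Psi φ₁ φ₂ x (c₀ * x))) := by
  refine (core h h1 h2 hK hφ₁ hφ₂ hc₀ hc).congr fun n => ?_
  have := (h.pos n 1 one_pos).ne'
  congr 2; ext y
  congr 1
  field_simp

theorem core_same {ι : Type} {l : Filter ι} [l.IsCountablyGenerated] {s f ε δ} (h : Cond l s f ε δ)
    {φ : ℝ → ℝ} (h1 : Continuous φ) {K : ℝ} (hK : 0 ≤ K)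
    (hφ₁ : ∀ u, 0 ≤ u → |φ u| ≤ K * u) (hφ₂ : ∀ u, 0 ≤ u → |φ u| ≤ K * Real.exp (-(u / 2)))
    {t : ι → ℝ} {c₀ : ℝ} (hc₀ : 0 < c₀) (hc : Tendsto (fun n => f n 1 * t n) l (𝓝 c₀)) :
    Tendsto (fun n => s n * ∫ y in Ioi 0, φ (t n * f n y)) l
      (𝓝 (∫ x in Ioi 0, x⁻¹ * φ (c₀ * x))) := by
  simpa [Psi] using core' h h1 h1 hK hφ₁ hφ₂ hc₀ hc

theorem bd1 (u : ℝ) (hu : 0 ≤ u) : |Real.exp (-u) - 1| ≤ 1 * u := by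
  have := Real.add_one_le_exp (-u)
  have h2 : Real.exp (-u) ≤ 1 := by simpa using hu
  rw [abs_le]; constructor <;> linarith

theorem bd2 (u : ℝ) (hu : 0 ≤ u) : |Real.exp (-u)| ≤ 1 * Real.exp (-(u / 2)) := by
  rw [abs_of_pos (Real.exp_pos _), one_mul, Real.exp_le_exp]; linarith

theorem bd3 (u : ℝ) (hu : 0 ≤ u) : |u * Real.exp (-u)| ≤ 2 * u := by
  have h2 : Real.exp (-u) ≤ 1 := by simpa using hu
  rw [abs_of_nonneg (by positivity)]
  nlinarith

theorem bd4 (u : ℝ) (hu : 0 ≤ u) : |u * Real.exp (-u)| ≤ 2 * Real.exp (-(u / 2)) := by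
  have h2 : u / 2 ≤ Real.exp (u / 2) := by linarith [Real.add_one_le_exp (u/2)]
  rw [abs_of_nonneg (by positivity)]
  have e : Real.exp (-(u/2)) = Real.exp (u / 2) * Real.exp (-u) := by
    rw [← Real.exp_add]; congr 1; ring
  rw [e]
  nlinarith [Real.exp_pos (-u)]

theorem bd5 (u : ℝ) (hu : 0 ≤ u) : |u ^ 2 * Real.exp (-u)| ≤ 16 * u := by
  have h2 : u * Real.exp (-u) ≤ 1 := by
    have := Real.add_one_le_exp u
    rw [Real.exp_neg, ← div_eq_mul_inv, div_le_one (Real.exp_pos _)]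
    linarith
  rw [abs_of_nonneg (by positivity)]
  nlinarith

theorem bd6 (u : ℝ) (hu : 0 ≤ u) : |u ^ 2 * Real.exp (-u)| ≤ 16 * Real.exp (-(u / 2)) := by
  have h2 : u / 4 ≤ Real.exp (u / 4) := by linarith [Real.add_one_le_exp (u/4)]
  rw [abs_of_nonneg (by positivity)]
  have e : Real.exp (-(u/2)) = Real.exp (u / 4) ^ 2 * Real.exp (-u) := by
    rw [← Real.exp_nat_mul, ← Real.exp_add]; congr 1; push_cast; ring
  have h3 : u ^ 2 ≤ 16 * Real.exp (u / 4) ^ 2 := by nlinarith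
  rw [e]
  nlinarith [Real.exp_pos (-u)]

/-- Laplace transform -/
noncomputable def Mh (g : ℝ → ℝ) (t : ℝ) : ℝ := ∫ x in Ioi (0:ℝ), Real.exp (-(t * g x))

noncomputable def PsiE : ℝ → ℝ → ℝ := Psi (fun u => Real.exp (-u) - 1) (fun u => Real.exp (-u))

theorem PsiE_eq (y u : ℝ) (hy : 0 < y) :
    Real.exp (-u) = (Ioc (0:ℝ) 1).indicator (fun _ => (1:ℝ)) y + PsiE y u := by
  unfold PsiE Psi
  by_cases h : y ≤ 1
  · simp [h, hy]
  · simp [h]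

theorem PsiE_int {ι : Type} {l : Filter ι} {s f ε δ} (h : Cond l s f ε δ) (n : ι)
    {t : ℝ} (ht : 0 < t) : IntegrableOn (fun y => PsiE y (t * f n y)) (Ioi 0) := by
  have hf1 := h.pos n 1 one_pos
  have := Psi_int h n (φ₁ := fun u => Real.exp (-u) - 1) (φ₂ := fun u => Real.exp (-u))
    (by fun_prop) (by fun_prop) zero_le_one bd1 bd2 (c := f n 1 * t) (by positivity)
  convert this using 2 with y
  unfold PsiE
  congr 1
  field_simp

theorem one_int : IntegrableOn ((Ioc (0:ℝ) 1).indicator (fun _ => (1:ℝ))) (Ioi 0) := by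
  apply IntegrableOn.integrable_indicator _ measurableSet_Ioc |>.integrableOn
  exact integrableOn_const (by simp)

theorem exp_int {ι : Type} {l : Filter ι} {s f ε δ} (h : Cond l s f ε δ) (n : ι)
    {t : ℝ} (ht : 0 < t) : IntegrableOn (fun y => Real.exp (-(t * f n y))) (Ioi 0) := by
  refine IntegrableOn.congr_fun (one_int.add (PsiE_int h n ht)) ?_ measurableSet_Ioi
  intro y hy
  exact (PsiE_eq y _ hy).symm

theorem Mh_eq {ι : Type} {l : Filter ι} {s f ε δ} (h : Cond l s f ε δ) (n : ι)
    {t : ℝ} (ht : 0 < t) : Mh (f n) t = 1 + ∫ y in Ioi 0, PsiE y (t * f n y) := by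
  have e : Mh (f n) t = ∫ y in Ioi 0, ((Ioc (0:ℝ) 1).indicator (fun _ => (1:ℝ)) y
      + PsiE y (t * f n y)) :=
    setIntegral_congr_fun measurableSet_Ioi fun y hy => PsiE_eq y _ hy
  rw [e, integral_add one_int (PsiE_int h n ht)]
  congr 1
  rw [setIntegral_indicator measurableSet_Ioc]
  have : Ioi (0:ℝ) ∩ Ioc 0 1 = Ioc 0 1 := inter_eq_right.2 fun x hx => hx.1
  rw [this]; simp

theorem Mh_lim0 {ι : Type} {l : Filter ι} [l.IsCountablyGenerated] {s f ε δ} (h : Cond l s f ε δ)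
    {t : ι → ℝ} {c₀ : ℝ} (hc₀ : 0 < c₀) (hc : Tendsto (fun n => f n 1 * t n) l (𝓝 c₀)) :
    Tendsto (fun n => s n * (Mh (f n) (t n) - 1)) l
      (𝓝 (∫ x in Ioi 0, x⁻¹ * PsiE x (c₀ * x))) := by
  refine (core' h (φ₁ := fun u => Real.exp (-u) - 1) (φ₂ := fun u => Real.exp (-u))
    (by fun_prop) (by fun_prop) zero_le_one bd1 bd2 hc₀ hc).congr' ?_
  filter_upwards [hc.eventually_const_lt hc₀] with n hn
  have ht : 0 < t n := pos_of_mul_pos_right hn (h.pos n 1 one_pos).le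
  rw [Mh_eq h n ht]
  simp [PsiE]

theorem powCond : Cond atTop (fun n : ℕ => (n:ℝ) + 1) (fun n x => x ^ ((n:ℝ) + 1)) 1 (fun _ => 1) where
  s_pos n := by positivity
  s_top := tendsto_atTop_add_const_right _ _ tendsto_natCast_atTop_atTop
  cont n := continuousOn_id.rpow_const (fun x hx => Or.inl (ne_of_gt hx))
  mono n := fun x hx y _ hxy => Real.rpow_lt_rpow (le_of_lt hx) hxy (by positivity)
  pos n x hx := Real.rpow_pos_of_pos hx _
  scal x hx := by
    refine tendsto_const_nhds.congr fun n => ?_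
    rw [← Real.rpow_mul hx, one_div_mul_cancel (by positivity)]
    simp
  eps := one_pos
  del n := by simp
  small := by
    refine tendsto_const_nhds.congr fun n => ?_
    rw [sub_self, Real.zero_rpow (by positivity)]; simp
  lower n x hx := by
    rw [← Real.rpow_mul (by linarith), one_div_mul_cancel (by positivity)]
    simp
  upper n x hx _ := by
    rw [sub_self, Real.zero_rpow (by positivity)] at hx
    rw [← Real.rpow_mul (by linarith), one_div_mul_cancel (by positivity)]
    simp

theorem const_eq {c : ℝ} (hc : 0 < c) :
    ∫ x in Ioi 0, x⁻¹ * PsiE x (c * x) = -Real.eulerMascheroniConstant - Real.log c := by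
  have A := Mh_lim0 powCond (t := fun _ => c) hc (by simp)
  refine tendsto_nhds_unique A ?_
  have d : HasDerivAt (fun u : ℝ => c ^ (-u) * Real.Gamma (u + 1))
      (-Real.eulerMascheroniConstant - Real.log c) 0 := by
    have d1 : HasDerivAt (fun u : ℝ => c ^ (-u)) (-Real.log c) 0 := by
      have := (hasDerivAt_neg (0:ℝ)).const_rpow hc
      simpa using this
    have d2 : HasDerivAt (fun u : ℝ => Real.Gamma (u + 1)) (-Real.eulerMascheroniConstant) 0 := by
      have := Real.hasDerivAt_Gamma_one
      rw [← zero_add (1:ℝ)] at this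
      exact this.comp_add_const 0 1
    have := d1.mul d2
    refine this.congr_deriv ?_
    simp; ring
  have T := d.tendsto_slope_zero_right
  have hs : Tendsto (fun n : ℕ => ((n:ℝ) + 1)⁻¹) atTop (𝓝[>] 0) :=
    tendsto_inv_atTop_nhdsGT_zero.comp powCond.s_top
  refine (T.comp hs).congr fun n => ?_
  have := integral_exp_neg_mul_rpow (p := (n:ℝ) + 1) (b := c) (by positivity) hc
  simp only [Mh, Function.comp, smul_eq_mul, inv_inv, zero_add, neg_zero, Real.rpow_zero,
    Real.Gamma_one, mul_one, ← neg_mul]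
  rw [this]
  congr 4
  · field_simp
  · simp

theorem Mh_lim {ι : Type} {l : Filter ι} [l.IsCountablyGenerated] {s f ε δ} (h : Cond l s f ε δ)
    {t : ι → ℝ} {c₀ : ℝ} (hc₀ : 0 < c₀) (hc : Tendsto (fun n => f n 1 * t n) l (𝓝 c₀)) :
    Tendsto (fun n => Mh (f n) (t n) ^ s n) l
      (𝓝 (Real.exp (-Real.eulerMascheroniConstant) / c₀)) := by
  have A := Mh_lim0 h hc₀ hc
  rw [const_eq hc₀] at A
  set L := -Real.eulerMascheroniConstant - Real.log c₀
  have hL : Real.exp (-Real.eulerMascheroniConstant) / c₀ = Real.exp L := by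
    rw [Real.exp_sub, Real.exp_log hc₀]
  have hp0 : Tendsto (fun n => (s n)⁻¹) l (𝓝 0) := h.s_top.inv_tendsto_atTop
  have B : Tendsto (fun n => Mh (f n) (t n)) l (𝓝 1) := by
    have := (A.mul hp0).add_const 1
    rw [mul_zero, zero_add] at this
    refine this.congr fun n => ?_
    have := (h.s_pos n).ne'
    field_simp
    ring
  have C : Tendsto (fun n => s n * (Mh (f n) (t n) - 1) / Mh (f n) (t n)) l (𝓝 L) := by
    have := A.div B one_ne_zero
    rw [div_one] at this
    exact this
  have hpos : ∀ᶠ n in l, 0 < Mh (f n) (t n) := B.eventually_const_lt one_pos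
  have D : Tendsto (fun n => Real.log (Mh (f n) (t n)) * s n) l (𝓝 L) := by
    refine tendsto_of_tendsto_of_tendsto_of_le_of_le' C A ?_ ?_
    · filter_upwards [hpos] with n hn
      have := Real.one_sub_inv_le_log_of_pos hn
      have h2 := mul_le_mul_of_nonneg_left this (h.s_pos n).le
      rw [mul_div_assoc, sub_div, div_self hn.ne', one_div]
      linarith
    · filter_upwards [hpos] with n hn
      have := Real.log_le_sub_one_of_pos hn
      have h2 := mul_le_mul_of_nonneg_left this (h.s_pos n).le
      linarith
  rw [hL]
  refine ((Real.continuous_exp.tendsto _).comp D).congr' ?_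
  filter_upwards [hpos] with n hn
  simp [Real.rpow_def_of_pos hn]

theorem Mh_lt {ι : Type} {l : Filter ι} {s f ε δ} (h : Cond l s f ε δ) (n : ι)
    {t u : ℝ} (ht : 0 < t) (hu : t < u) : Mh (f n) u < Mh (f n) t := by
  have It := exp_int h n ht
  have Iu := exp_int h n (ht.trans hu)
  have hlt : ∀ x ∈ Ioi (0:ℝ), Real.exp (-(u * f n x)) < Real.exp (-(t * f n x)) := by
    intro x hx
    have := h.pos n x hx
    rw [Real.exp_lt_exp]
    nlinarith
  rw [← sub_pos, Mh, Mh, ← integral_sub It Iu]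
  refine (integral_pos_iff_support_of_nonneg_ae ?_ (It.sub Iu)).2 ?_
  rotate_left
  · refine lt_of_lt_of_le ?_ (measure_mono (s := Ioi 0) ?_)
    · simp
    · intro x hx
      exact (sub_pos.2 (hlt x hx)).ne'
  · filter_upwards [ae_restrict_mem measurableSet_Ioi] with x hx
    exact (sub_pos.2 (hlt x hx)).le

theorem Mh_inj {ι : Type} {l : Filter ι} {s f ε δ} (h : Cond l s f ε δ) (n : ι)
    {t u : ℝ} (ht : 0 < t) (hu : 0 < u) (e : Mh (f n) t = Mh (f n) u) : t = u := by
  rcases lt_trichotomy t u with H | H | H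
  · exact absurd e (Mh_lt h n ht H).ne'
  · exact H
  · exact absurd e (Mh_lt h n hu H).ne

theorem Mh_cont {ι : Type} {l : Filter ι} {s f ε δ} (h : Cond l s f ε δ) (n : ι)
    {t u : ℝ} (ht : 0 < t) : ContinuousOn (Mh (f n)) (Icc t u) := by
  unfold Mh
  refine continuousOn_of_dominated (bound := fun x => Real.exp (-(t * f n x))) ?_ ?_
    (exp_int h n ht) ?_
  · intro v hv
    exact (exp_int h n (ht.trans_le hv.1)).aestronglyMeasurable
  · intro v hv
    filter_upwards [ae_restrict_mem measurableSet_Ioi] with x hx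
    have := h.pos n x hx
    rw [Real.norm_of_nonneg (Real.exp_pos _).le, Real.exp_le_exp]
    nlinarith [hv.1]
  · refine Eventually.of_forall fun x => ?_
    fun_prop

theorem Mh_nonneg (g : ℝ → ℝ) (t : ℝ) : 0 ≤ Mh g t := integral_nonneg fun _ => (Real.exp_pos _).le

/-- Existence, localised. -/
theorem exists_root {s f ε δ} (h : Cond (atTop : Filter ℕ) s f ε δ) {a : ℝ} (ha : 0 < a)
    {c₁ c₂ : ℝ} (hc1 : 0 < c₁) (h1 : c₁ < a * Real.exp (-Real.eulerMascheroniConstant))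
    (h2 : a * Real.exp (-Real.eulerMascheroniConstant) < c₂) :
    ∀ᶠ q : ℕ × ℝ in atTop ×ˢ 𝓝 a, ∃ t, 0 < t ∧ q.2 ^ (1 / s q.1) * Mh (f q.1) t = 1 ∧
      c₁ ≤ f q.1 1 * t ∧ f q.1 1 * t ≤ c₂ := by
  have hc2 : 0 < c₂ := by linarith
  have T : ∀ c : ℝ, 0 < c → Tendsto (fun q : ℕ × ℝ => q.2 * Mh (f q.1) (c / f q.1 1) ^ s q.1)
      (atTop ×ˢ 𝓝 a) (𝓝 (a * (Real.exp (-Real.eulerMascheroniConstant) / c))) := by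
    intro c hc
    have := Mh_lim h (t := fun n => c / f n 1) hc (by
      refine tendsto_const_nhds.congr fun n => ?_
      have := (h.pos n 1 one_pos).ne'
      field_simp)
    exact tendsto_snd.mul (this.comp tendsto_fst)
  have E1 := (T c₁ hc1).eventually_const_lt (u := 1) (by
    rw [← mul_div_assoc, one_lt_div hc1]; exact h1)
  have E2 := (T c₂ hc2).eventually_lt_const (u := 1) (by
    rw [← mul_div_assoc, div_lt_one hc2]; exact h2)
  have E3 : ∀ᶠ q : ℕ × ℝ in atTop ×ˢ 𝓝 a, 0 < q.2 := tendsto_snd.eventually_const_lt ha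
  filter_upwards [E1, E2, E3] with ⟨n, b⟩ e1 e2 e3
  simp only at e1 e2 e3 ⊢
  have hf1 := h.pos n 1 one_pos
  have hsp := h.s_pos n
  have key : ∀ t, (b ^ (1 / s n) * Mh (f n) t) ^ s n = b * Mh (f n) t ^ s n := by
    intro t
    rw [Real.mul_rpow (by positivity) (Mh_nonneg _ _), ← Real.rpow_mul e3.le,
      one_div_mul_cancel hsp.ne', Real.rpow_one]
  rw [← key] at e1 e2
  have nn : ∀ t, 0 ≤ b ^ (1 / s n) * Mh (f n) t :=
    fun t => mul_nonneg (by positivity) (Mh_nonneg _ _)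
  have g1 : 1 ≤ b ^ (1 / s n) * Mh (f n) (c₁ / f n 1) := by
    by_contra hh
    exact absurd (Real.rpow_le_one (nn _) (not_le.1 hh).le hsp.le) (not_le.2 e1)
  have g2 : b ^ (1 / s n) * Mh (f n) (c₂ / f n 1) ≤ 1 := by
    by_contra hh
    exact absurd (Real.one_le_rpow (not_le.1 hh).le hsp.le) (not_le.2 e2)
  have hle : c₁ / f n 1 ≤ c₂ / f n 1 := by gcongr; linarith
  have hc : ContinuousOn (fun t => b ^ (1 / s n) * Mh (f n) t) (Icc (c₁ / f n 1) (c₂ / f n 1)) :=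
    continuousOn_const.mul (Mh_cont h n (by positivity))
  obtain ⟨t, ht, hte⟩ := intermediate_value_Icc' hle hc ⟨g2, g1⟩
  refine ⟨t, lt_of_lt_of_le (by positivity) ht.1, hte, ?_, ?_⟩
  · have := ht.1; rw [div_le_iff₀ hf1] at this; linarith
  · have := ht.2; rw [le_div_iff₀ hf1] at this; linarith

open Classical in
noncomputable def lamF (s : ℕ → ℝ) (f : ℕ → ℝ → ℝ) (n : ℕ) (a : ℝ) : ℝ :=
  if h : ∃ t, 0 < t ∧ a ^ (1 / s n) * Mh (f n) t = 1 then h.choose else 0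

theorem lamF_eq {s f ε δ} (h : Cond (atTop : Filter ℕ) s f ε δ) {n : ℕ} {a t : ℝ}
    (ht : 0 < t) (e : a ^ (1 / s n) * Mh (f n) t = 1) : t = lamF s f n a := by
  have hex : ∃ t, 0 < t ∧ a ^ (1 / s n) * Mh (f n) t = 1 := ⟨t, ht, e⟩
  rw [lamF, dif_pos hex]
  have hs := hex.choose_spec
  refine Mh_inj h n ht hs.1 ?_
  have h0 : a ^ (1 / s n) ≠ 0 := by
    intro h0; rw [h0, zero_mul] at e; exact zero_ne_one e
  exact mul_left_cancel₀ h0 (e.trans hs.2.symm)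

theorem lamF_spec {s f ε δ} (h : Cond (atTop : Filter ℕ) s f ε δ) {a : ℝ} (ha : 0 < a) :
    ∀ᶠ q : ℕ × ℝ in atTop ×ˢ 𝓝 a, 0 < lamF s f q.1 q.2 ∧
      q.2 ^ (1 / s q.1) * Mh (f q.1) (lamF s f q.1 q.2) = 1 := by
  have hp : 0 < a * Real.exp (-Real.eulerMascheroniConstant) := by positivity
  filter_upwards [exists_root h ha (half_pos hp) (half_lt_self hp) (lt_add_one _)]
    with q ⟨t, ht, e, _⟩
  rw [← lamF_eq h ht e]
  exact ⟨ht, e⟩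

theorem lamF_lim {s f ε δ} (h : Cond (atTop : Filter ℕ) s f ε δ) {a : ℝ} (ha : 0 < a) :
    Tendsto (fun q : ℕ × ℝ => f q.1 1 * lamF s f q.1 q.2) (atTop ×ˢ 𝓝 a)
      (𝓝 (a * Real.exp (-Real.eulerMascheroniConstant))) := by
  have hp : 0 < a * Real.exp (-Real.eulerMascheroniConstant) := by positivity
  refine tendsto_order.2 ⟨fun b hb => ?_, fun b hb => ?_⟩
  · obtain ⟨c, hc, hc'⟩ := exists_between (max_lt hb hp)
    filter_upwards [exists_root h ha ((le_max_right _ _).trans_lt hc) hc' (lt_add_one _)]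
      with q ⟨t, ht, e, h1, _⟩
    rw [← lamF_eq h ht e]
    exact ((le_max_left _ _).trans_lt hc).trans_le h1
  · obtain ⟨c, hc, hc'⟩ := exists_between hb
    filter_upwards [exists_root h ha (half_pos hp) (half_lt_self hp) hc]
      with q ⟨t, ht, e, _, h1⟩
    rw [← lamF_eq h ht e]
    exact h1.trans_lt hc'

theorem int_a {c : ℝ} (hc : 0 < c) : ∫ x in Ioi (0:ℝ), x⁻¹ * (c * x * Real.exp (-(c * x))) = 1 := by
  have := Real.integral_rpow_mul_exp_neg_mul_Ioi one_pos hc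
  rw [Real.rpow_one, Real.Gamma_one, mul_one] at this
  have e : ∫ x in Ioi (0:ℝ), x⁻¹ * (c * x * Real.exp (-(c * x))) =
      ∫ x in Ioi (0:ℝ), c * (x ^ ((1:ℝ) - 1) * Real.exp (-(c * x))) := by
    refine setIntegral_congr_fun measurableSet_Ioi fun x hx => ?_
    have : x ≠ 0 := ne_of_gt hx
    simp
    field_simp
  rw [e, integral_const_mul, this]
  field_simp

theorem int_b {c : ℝ} (hc : 0 < c) :
    ∫ x in Ioi (0:ℝ), x⁻¹ * ((c * x) ^ 2 * Real.exp (-(c * x))) = 1 := by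
  have := Real.integral_rpow_mul_exp_neg_mul_Ioi two_pos hc
  rw [Real.Gamma_two, mul_one] at this
  have e : ∫ x in Ioi (0:ℝ), x⁻¹ * ((c * x) ^ 2 * Real.exp (-(c * x))) =
      ∫ x in Ioi (0:ℝ), c ^ 2 * (x ^ ((2:ℝ) - 1) * Real.exp (-(c * x))) := by
    refine setIntegral_congr_fun measurableSet_Ioi fun x hx => ?_
    have : x ≠ 0 := ne_of_gt hx
    have h21 : (2:ℝ) - 1 = 1 := by norm_num
    simp only [h21, Real.rpow_one]
    field_simp
  rw [e, integral_const_mul, this]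
  norm_num
  field_simp

theorem atilde {s : ℕ → ℝ} (hs : Tendsto s atTop atTop) {a : ℝ} (ha : 0 < a) :
    Tendsto (fun q : ℕ × ℝ => q.2 ^ (1 / s q.1)) (atTop ×ˢ 𝓝 a) (𝓝 1) := by
  have hp0 : Tendsto (fun q : ℕ × ℝ => 1 / s q.1) (atTop ×ˢ 𝓝 a) (𝓝 0) := by
    simp only [one_div]
    exact (hs.comp tendsto_fst).inv_tendsto_atTop
  have h2 : Tendsto (fun q : ℕ × ℝ => q.2) (atTop ×ˢ 𝓝 a) (𝓝 a) := tendsto_snd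
  simpa using h2.rpow hp0 (Or.inl ha.ne')

theorem lim2 {s f ε δ} (h : Cond (atTop : Filter ℕ) s f ε δ) {a : ℝ} (ha : 0 < a) :
    Tendsto (fun q : ℕ × ℝ => s q.1 * lamF s f q.1 q.2 * ∫ x in Ioi (0:ℝ), f q.1 x *
      (q.2 ^ (1 / s q.1) * Real.exp (-(lamF s f q.1 q.2 * f q.1 x)))) (atTop ×ˢ 𝓝 a) (𝓝 1) := by
  have hp : 0 < a * Real.exp (-Real.eulerMascheroniConstant) := by positivity
  have h' : Cond (atTop ×ˢ 𝓝 a) _ _ _ _ := h.comp (tendsto_fst (f := atTop) (g := 𝓝 a))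
  have := core_same h' (φ := fun u => u * Real.exp (-u)) (by fun_prop) zero_le_two bd3 bd4 hp
    (lamF_lim h ha)
  rw [int_a hp] at this
  have := (atilde h.s_top ha).mul this
  rw [mul_one] at this
  refine this.congr fun q => ?_
  rw [mul_left_comm, mul_assoc, ← integral_const_mul (q.2 ^ (1 / s q.1)),
    ← integral_const_mul (lamF s f q.1 q.2)]
  congr 1
  refine integral_congr_ae (Eventually.of_forall fun x => ?_)
  simp only
  ring

theorem lim3 {s f ε δ} (h : Cond (atTop : Filter ℕ) s f ε δ) {a : ℝ} (ha : 0 < a) :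
    Tendsto (fun q : ℕ × ℝ => s q.1 * lamF s f q.1 q.2 ^ 2 * ∫ x in Ioi (0:ℝ), f q.1 x ^ 2 *
      (q.2 ^ (1 / s q.1) * Real.exp (-(lamF s f q.1 q.2 * f q.1 x)))) (atTop ×ˢ 𝓝 a) (𝓝 1) := by
  have hp : 0 < a * Real.exp (-Real.eulerMascheroniConstant) := by positivity
  have h' : Cond (atTop ×ˢ 𝓝 a) _ _ _ _ := h.comp (tendsto_fst (f := atTop) (g := 𝓝 a))
  have := core_same h' (φ := fun u => u ^ 2 * Real.exp (-u)) (by fun_prop)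
    (by norm_num : (0:ℝ) ≤ 16) bd5 bd6 hp (lamF_lim h ha)
  rw [int_b hp] at this
  have := (atilde h.s_top ha).mul this
  rw [mul_one] at this
  refine this.congr fun q => ?_
  rw [mul_left_comm, mul_assoc, ← integral_const_mul (q.2 ^ (1 / s q.1)),
    ← integral_const_mul (lamF s f q.1 q.2 ^ 2)]
  congr 1
  refine integral_congr_ae (Eventually.of_forall fun x => ?_)
  simp only
  ring

theorem lim4 {s f ε δ} (h : Cond (atTop : Filter ℕ) s f ε δ) {p : ℝ × ℝ} (ha : 0 < p.1)
    (hb : 0 < p.2) :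
    Tendsto (fun q : ℕ × (ℝ × ℝ) => q.2.1 * (∫ x in Ioi (0:ℝ),
      Real.exp (-(q.2.2 * lamF s f q.1 q.2.1 * f q.1 x))) ^ s q.1) (atTop ×ˢ 𝓝 p)
      (𝓝 (1 / p.2)) := by
  have hp : 0 < p.2 * (p.1 * Real.exp (-Real.eulerMascheroniConstant)) := by positivity
  have h' : Cond (atTop ×ˢ 𝓝 p) _ _ _ _ := h.comp (tendsto_fst (f := atTop) (g := 𝓝 p))
  have t1 : Tendsto (fun q : ℕ × (ℝ × ℝ) => q.2.1) (atTop ×ˢ 𝓝 p) (𝓝 p.1) :=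
    (continuous_fst.tendsto p).comp tendsto_snd
  have t2 : Tendsto (fun q : ℕ × (ℝ × ℝ) => q.2.2) (atTop ×ˢ 𝓝 p) (𝓝 p.2) :=
    (continuous_snd.tendsto p).comp tendsto_snd
  have t3 := (lamF_lim h ha).comp (tendsto_fst.prodMk t1)
  have t4 : Tendsto (fun q : ℕ × (ℝ × ℝ) => f q.1 1 * (q.2.2 * lamF s f q.1 q.2.1)) (atTop ×ˢ 𝓝 p)
      (𝓝 (p.2 * (p.1 * Real.exp (-Real.eulerMascheroniConstant)))) := by
    refine (t2.mul t3).congr fun q => ?_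
    simp only [Function.comp]; ring
  have := t1.mul (Mh_lim h' hp t4)
  have e : 1 / p.2 = p.1 * (Real.exp (-Real.eulerMascheroniConstant) /
      (p.2 * (p.1 * Real.exp (-Real.eulerMascheroniConstant)))) := by
    have := Real.exp_pos (-Real.eulerMascheroniConstant)
    field_simp
  rw [e]
  exact this

theorem unif {α : Type} [TopologicalSpace α] {F : ℕ → α → ℝ} {g : α → ℝ} {A : Set α}
    (hA : IsCompact A) (hg : ContinuousOn g A)
    (hF : ∀ a ∈ A, Tendsto (fun q : ℕ × α => F q.1 q.2) (atTop ×ˢ 𝓝 a) (𝓝 (g a))) :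
    TendstoUniformlyOn F g atTop A := by
  rw [← tendstoLocallyUniformlyOn_iff_tendstoUniformlyOn_of_compact hA,
    tendstoLocallyUniformlyOn_iff_filter]
  intro a ha
  rw [tendstoUniformlyOnFilter_iff_tendsto]
  have t1 : Tendsto (fun q : ℕ × α => g q.2) (atTop ×ˢ 𝓝[A] a) (𝓝 (g a)) :=
    (hg a ha).tendsto.comp tendsto_snd
  have t2 : Tendsto (fun q : ℕ × α => F q.1 q.2) (atTop ×ˢ 𝓝[A] a) (𝓝 (g a)) :=
    (hF a ha).mono_left (prod_mono le_rfl nhdsWithin_le_nhds)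
  exact (t1.prodMk_nhds t2).mono_right (nhds_le_uniformity (g a))

theorem ptw {α : Type} [TopologicalSpace α] (a : α) :
    Tendsto (fun n : ℕ => (n, a)) atTop (atTop ×ˢ 𝓝 a) :=
  tendsto_id.prodMk tendsto_const_nhds

end Aux


/-- random walk convergence: existence, uniqueness and asymptotics of the
parameters `λ_n(a^{1/s_n})`, with uniformity on compact subsets of `(0,∞)`. -/
theorem statement10 (s : ℕ → ℝ) (hs_pos : ∀ n, 0 < s n) (hs : Tendsto s atTop atTop)
    (f : ℕ → ℝ → ℝ)
    (hf_cont : ∀ n, ContinuousOn (f n) (Set.Ioi 0))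
    (hf_mono : ∀ n, StrictMonoOn (f n) (Set.Ioi 0))
    (hf_pos : ∀ n x, 0 < x → 0 < f n x)
    -- Condition (S)
    (hS : ∀ x : ℝ, 0 ≤ x → Tendsto (fun n => f n (x ^ (1 / s n)) / f n 1) atTop (nhds x))
    -- Condition (W)
    (hW : ∃ ε₀ : ℝ, 0 < ε₀ ∧ ∃ δ : ℕ → ℝ, (∀ n, δ n ∈ Set.Ioc (0:ℝ) 1) ∧
      Tendsto (fun n => s n * f n (1 - δ n) / f n 1) atTop (nhds 0) ∧
      (∀ n, ∀ x : ℝ, 1 ≤ x → f n 1 * x ^ ε₀ ≤ f n (x ^ (1 / s n))) ∧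
      (∀ n, ∀ x : ℝ, (1 - δ n) ^ s n ≤ x → x ≤ 1 → f n (x ^ (1 / s n)) ≤ f n 1 * x ^ ε₀)) :
    ∃ lam : ℕ → ℝ → ℝ,
      (∀ a : ℝ, 0 < a →
        -- existence and uniqueness of `λ_n(a^{1/s_n})` for sufficiently large n
        (∀ᶠ n in atTop,
          (0 < lam n a ∧
            a ^ (1 / s n) * ∫ x in Set.Ioi (0:ℝ), Real.exp (-(lam n a * f n x)) = 1) ∧
          ∀ l : ℝ, 0 < l →
            a ^ (1 / s n) * ∫ x in Set.Ioi (0:ℝ), Real.exp (-(l * f n x)) = 1 →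
            l = lam n a) ∧
        -- (i)
        Tendsto (fun n => f n 1 * lam n a) atTop
          (nhds (a * Real.exp (-Real.eulerMascheroniConstant))) ∧
        -- (ii)
        Tendsto (fun n => s n * lam n a *
            ∫ x in Set.Ioi (0:ℝ), f n x * (a ^ (1 / s n) * Real.exp (-(lam n a * f n x))))
          atTop (nhds 1) ∧
        -- (iii)
        Tendsto (fun n => s n * lam n a ^ 2 *
            ∫ x in Set.Ioi (0:ℝ), f n x ^ 2 * (a ^ (1 / s n) * Real.exp (-(lam n a * f n x))))
          atTop (nhds 1) ∧
        -- (iv)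
        (∀ β : ℝ, 0 < β →
          Tendsto (fun n =>
              a * (∫ x in Set.Ioi (0:ℝ), Real.exp (-(β * lam n a * f n x))) ^ s n)
            atTop (nhds (1 / β)))) ∧
      -- uniformity on compact subsets
      (∀ A : Set ℝ, IsCompact A → A ⊆ Set.Ioi 0 →
        TendstoUniformlyOn (fun n a => f n 1 * lam n a)
          (fun a => a * Real.exp (-Real.eulerMascheroniConstant)) atTop A ∧
        TendstoUniformlyOn (fun n a => s n * lam n a *
            ∫ x in Set.Ioi (0:ℝ), f n x * (a ^ (1 / s n) * Real.exp (-(lam n a * f n x))))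
          (fun _ => 1) atTop A ∧
        TendstoUniformlyOn (fun n a => s n * lam n a ^ 2 *
            ∫ x in Set.Ioi (0:ℝ), f n x ^ 2 * (a ^ (1 / s n) * Real.exp (-(lam n a * f n x))))
          (fun _ => 1) atTop A ∧
        TendstoUniformlyOn (fun n (p : ℝ × ℝ) => p.1 *
            (∫ x in Set.Ioi (0:ℝ), Real.exp (-(p.2 * lam n p.1 * f n x))) ^ s n)
          (fun p => 1 / p.2) atTop (A ×ˢ A)) := by
  obtain ⟨ε, hε, δ, hδ, hsm, hlo, hup⟩ := hW
  have h : Cond atTop s f ε δ :=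
    ⟨hs_pos, hs, hf_cont, hf_mono, hf_pos, hS, hε, hδ, hsm, hlo, hup⟩
  refine ⟨lamF s f, fun a ha => ⟨?_, ?_, ?_, ?_, ?_⟩, fun A hA hA0 => ⟨?_, ?_, ?_, ?_⟩⟩
  · filter_upwards [(ptw a).eventually (lamF_spec h ha)] with n hn
    exact ⟨hn, fun l hl e => lamF_eq h hl e⟩
  · exact (lamF_lim h ha).comp (ptw a)
  · exact (lim2 h ha).comp (ptw a)
  · exact (lim3 h ha).comp (ptw a)
  · intro β hβ
    exact (lim4 h (p := (a, β)) ha hβ).comp (ptw (a, β))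
  · exact unif hA (by fun_prop) fun a ha => lamF_lim h (hA0 ha)
  · exact unif hA (by fun_prop) fun a ha => lim2 h (hA0 ha)
  · exact unif hA (by fun_prop) fun a ha => lim3 h (hA0 ha)
  · refine unif (hA.prod hA) ?_ fun p hp => lim4 h (hA0 hp.1) (hA0 hp.2)
    exact continuousOn_const.div continuousOn_snd fun p hp => (ne_of_gt (hA0 hp.2))
end

section
/- Let (s_n) be a positive sequence with s_n → ∞ and (f_n) continuous strictly increasing functions from (0,∞) to (0,∞) satisfying Conditions (S) and (W). Fix a > 0, write ã = a^{1/s_n}, and for all sufficiently large n let λ_n(ã) > 0 be the unique solution of ã ∫_0^∞ e^{−λ f_n(x)} dx = 1, and let ν_ã be the probability measure on (0,∞) with ν_ã(B) = ∫_0^∞ 1_B(f_n(x)) ã e^{−λ_n(ã) f_n(x)} dx. Then for every t > 0, the law of λ_n(ã) · (D_1 + ⋯ + D_{⌊s_n t⌋}), where D_1, …, D_{⌊s_n t⌋} are i.i.d. with law ν_ã, converges weakly as n → ∞ to the Gamma distribution with shape parameter t and rate 1 (density z^{t−1} e^{−z}/Γ(t) on (0,∞)). -/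
open MeasureTheory Filter

/-- The probability measure `ν_ã` on `(0,∞)` with `ν_ã(B) = ∫_0^∞ 1_B(f(x)) ã e^{-λ f(x)} dx`. -/
noncomputable def nuMeasure (f : ℝ → ℝ) (atil lam : ℝ) : Measure ℝ :=
  Measure.map f ((volume.restrict (Set.Ioi 0)).withDensity
    fun x => ENNReal.ofReal (atil * Real.exp (-(lam * f x))))

/-- The law of the random walk `S_j = D_1 + ⋯ + D_j` with i.i.d. steps of law `ν`. -/
noncomputable def sumLaw (ν : Measure ℝ) : ℕ → Measure ℝ
  | 0 => Measure.dirac 0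
  | j + 1 => Measure.map (fun p : ℝ × ℝ => p.1 + p.2) ((sumLaw ν j).prod ν)

/-- limiting integrand -/
noncomputable def limFun (μ : ℂ) (y : ℝ) : ℂ :=
  (Complex.exp (-(μ * y)) - (if y ≤ 1 then 1 else 0)) / y

noncomputable def limL (μ : ℂ) : ℂ := ∫ y in Set.Ioi (0:ℝ), limFun μ y

lemma norm_exp_neg_sub_one_le' {z : ℂ} (hz : 0 ≤ z.re) : ‖Complex.exp (-z) - 1‖ ≤ 2 * ‖z‖ := by
  by_cases h : ‖z‖ ≤ 1
  · have := Complex.norm_exp_sub_one_le (x := -z) (by simpa using h)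
    simpa using this
  · push Not at h
    have h1 : ‖Complex.exp (-z)‖ ≤ 1 := by
      rw [Complex.norm_exp]; simpa using hz
    have := norm_sub_le (Complex.exp (-z)) 1
    simp only [norm_one] at this
    linarith

lemma measurable_limFun (μ : ℂ) : Measurable (limFun μ) := by
  unfold limFun
  refine Measurable.div (Measurable.sub (by fun_prop) ?_) (by fun_prop)
  exact Measurable.ite measurableSet_Iic measurable_const measurable_const

lemma integrable_limFun {μ : ℂ} (hμ : 0 < μ.re) :
    Integrable (limFun μ) (volume.restrict (Set.Ioi 0)) := by
  have hE : IntegrableOn (fun y : ℝ => Real.exp (-μ.re * y)) (Set.Ioi 0) :=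
    exp_neg_integrableOn_Ioi 0 hμ
  have h1 : IntegrableOn (limFun μ) (Set.Ioc 0 1) := by
    refine Measure.integrableOn_of_bounded (M := 2 * ‖μ‖) (by simp)
      (measurable_limFun μ).aestronglyMeasurable ?_
    refine (ae_restrict_iff' measurableSet_Ioc).2 (ae_of_all _ fun y hy => ?_)
    unfold limFun
    rw [if_pos hy.2, norm_div]
    have h0 : ‖(y:ℂ)‖ = y := by simp [abs_of_pos hy.1]
    rw [h0, div_le_iff₀ hy.1]
    have := norm_exp_neg_sub_one_le' (z := μ * y) (by simp; exact mul_nonneg hμ.le hy.1.le)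
    rw [norm_mul, h0] at this
    linarith
  have h2 : IntegrableOn (limFun μ) (Set.Ioi 1) := by
    refine Integrable.mono' (hE.mono_set (Set.Ioi_subset_Ioi zero_le_one))
      (measurable_limFun μ).aestronglyMeasurable ?_
    refine (ae_restrict_iff' measurableSet_Ioi).2 (ae_of_all _ fun y (hy : 1 < y) => ?_)
    unfold limFun
    rw [if_neg (not_le.2 hy), norm_div, sub_zero, Complex.norm_exp]
    have h0 : ‖(y:ℂ)‖ = y := by simp [abs_of_pos (zero_lt_one.trans hy)]
    rw [h0]
    have : (-(μ * (y:ℂ))).re = -μ.re * y := by simp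
    rw [this]
    exact div_le_self (Real.exp_pos _).le hy.le
  have := h1.union h2
  rwa [Set.Ioc_union_Ioi_eq_Ioi zero_le_one] at this

lemma hasDerivAt_limL {μ : ℂ} (hμ : 0 < μ.re) : HasDerivAt limL (-(1/μ)) μ := by
  have hint : IntegrableOn (fun y : ℝ => Real.exp (-(μ.re/2) * y)) (Set.Ioi 0) :=
    exp_neg_integrableOn_Ioi 0 (by linarith)
  have key := hasDerivAt_integral_of_dominated_loc_of_deriv_le
    (μ := volume.restrict (Set.Ioi (0:ℝ))) (F := limFun) (x₀ := μ)
    (s := {z : ℂ | μ.re / 2 < z.re}) (F' := fun z y => -Complex.exp (-z * y))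
    (bound := fun y : ℝ => Real.exp (-(μ.re/2) * y))
    ((isOpen_lt continuous_const Complex.continuous_re).mem_nhds (by simp; linarith))
    (Eventually.of_forall fun z => (measurable_limFun z).aestronglyMeasurable)
    (integrable_limFun hμ)
    (by fun_prop)
    ?_ hint ?_
  · have := key.2
    rw [integral_neg, integral_exp_mul_complex_Ioi (by simpa using hμ)] at this
    refine this.congr_deriv ?_
    simp [div_eq_mul_inv]
  · refine (ae_restrict_iff' measurableSet_Ioi).2 (ae_of_all _ fun y (hy : 0 < y) z hz => ?_)
    rw [norm_neg, Complex.norm_exp]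
    simp at hz ⊢
    nlinarith
  · refine (ae_restrict_iff' measurableSet_Ioi).2 (ae_of_all _ fun y (hy : 0 < y) z hz => ?_)
    unfold limFun
    have hy' : (y:ℂ) ≠ 0 := by exact_mod_cast hy.ne'
    have h1 : HasDerivAt (fun z : ℂ => -(z * y)) (-(1 * (y:ℂ))) z :=
      ((hasDerivAt_id z).mul_const (y:ℂ)).neg
    have := ((h1.cexp).sub_const (if y ≤ 1 then (1:ℂ) else 0)).div_const (y:ℂ)
    refine this.congr_deriv ?_
    rw [neg_mul]
    field_simp

lemma limL_eq {μ : ℂ} (hμ : 0 < μ.re) : limL μ = limL 1 - Complex.log μ := by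
  have hd : ∀ z ∈ {z : ℂ | 0 < z.re}, HasDerivAt (fun z => limL z + Complex.log z) 0 z := by
    intro z hz
    have := (hasDerivAt_limL hz).add (Complex.hasDerivAt_log (Or.inl hz))
    exact this.congr_deriv (by simp)
  have := IsOpen.is_const_of_deriv_eq_zero (f := fun z => limL z + Complex.log z)
    (isOpen_lt continuous_const Complex.continuous_re)
    (convex_halfSpace_re_gt 0).isPreconnected
    (fun z hz => (hd z hz).differentiableAt.differentiableWithinAt)
    (fun z hz => (hd z hz).deriv) (x := μ) (y := 1) hμ (by simp)
  simp at this
  rw [← this]; ring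

lemma limL_one_real : limL 1 = ((limL 1).re : ℂ) := by
  have : limL 1 = ((∫ y in Set.Ioi (0:ℝ), (Real.exp (-y) - (if y ≤ 1 then 1 else 0)) / y : ℝ) : ℂ) := by
    rw [← integral_complex_ofReal]
    unfold limL limFun
    congr 1; ext y
    push_cast
    split_ifs <;> simp
  rw [this]; simp

lemma pow_lim {s : ℕ → ℝ} (hs_pos : ∀ n, 0 < s n) (hs : Tendsto s atTop atTop) {φ : ℕ → ℂ} {w : ℂ}
    (h : Tendsto (fun n => (s n : ℂ) * (φ n - 1)) atTop (nhds w)) {t : ℝ} (ht : 0 < t) :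
    Tendsto (fun n => φ n ^ ⌊s n * t⌋₊) atTop (nhds (Complex.exp (t * w))) := by
  have hsne : ∀ n, (s n : ℂ) ≠ 0 := fun n => by exact_mod_cast (hs_pos n).ne'
  have hinv : Tendsto (fun n => ((s n : ℂ))⁻¹) atTop (nhds 0) := by
    have := (Complex.continuous_ofReal.tendsto 0).comp (tendsto_inv_atTop_zero.comp hs)
    simpa [Function.comp_def] using this
  have hu : Tendsto (fun n => φ n - 1) atTop (nhds 0) := by
    have := hinv.mul h
    rw [zero_mul] at this
    refine this.congr fun n => ?_
    field_simp [hsne n]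
  have hk : Tendsto (fun n => ((⌊s n * t⌋₊ : ℝ) : ℂ) / s n) atTop (nhds t) := by
    have := (Complex.continuous_ofReal.tendsto t).comp
      ((tendsto_nat_floor_mul_div_atTop ht.le).comp hs)
    refine this.congr fun n => ?_
    simp [mul_comm]
  have hku : Tendsto (fun n => (⌊s n * t⌋₊ : ℂ) * (φ n - 1)) atTop (nhds (t * w)) := by
    refine (hk.mul h).congr fun n => ?_
    have := hsne n
    push_cast
    field_simp
  have hsmall : ∀ᶠ n in atTop, ‖φ n - 1‖ < 1/2 := by
    have := hu.norm
    rw [norm_zero] at this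
    exact this.eventually_lt_const (by norm_num)
  have hlog : Tendsto (fun n => (⌊s n * t⌋₊ : ℂ) * Complex.log (φ n)) atTop (nhds (t * w)) := by
    have hdiff : Tendsto (fun n => (⌊s n * t⌋₊ : ℂ) * (Complex.log (φ n) - (φ n - 1)))
        atTop (nhds 0) := by
      have hb := hku.norm.mul hu.norm
      rw [norm_zero, mul_zero] at hb
      refine squeeze_zero_norm' ?_ hb
      filter_upwards [hsmall] with n hn
      have := Complex.norm_log_one_add_sub_self_le (z := φ n - 1) (by linarith)
      rw [add_sub_cancel] at this
      rw [norm_mul, norm_mul, mul_assoc]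
      refine mul_le_mul_of_nonneg_left (this.trans ?_) (norm_nonneg _)
      have h2 : (1 - ‖φ n - 1‖)⁻¹ ≤ 2 := by
        rw [inv_le_comm₀ (by linarith) (by norm_num)]; linarith
      nlinarith [norm_nonneg (φ n - 1), sq_nonneg ‖φ n - 1‖]
    have := hdiff.add hku
    rw [zero_add] at this
    refine this.congr fun n => ?_
    ring
  refine ((Complex.continuous_exp.tendsto _).comp hlog).congr' ?_
  filter_upwards [hsmall] with n hn
  have hne : φ n ≠ 0 := by
    intro h0
    rw [h0] at hn
    norm_num at hn
  simp only [Function.comp]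
  rw [Complex.exp_nat_mul, Complex.exp_log hne]

lemma norm_cpow_exp_le {t y : ℝ} (hy : 0 < y) (z : ℂ) :
    ‖((y ^ (t - 1) : ℝ) : ℂ) * Complex.exp (-z * y)‖ = y ^ (t-1) * Real.exp (-z.re * y) := by
  rw [norm_mul, Complex.norm_exp, Complex.norm_real, Real.norm_eq_abs,
    abs_of_pos (Real.rpow_pos_of_pos hy _)]
  simp

lemma integrable_gammaC {t : ℝ} (ht : 0 < t) {z : ℂ} (hz : 0 < z.re) :
    Integrable (fun y : ℝ => ((y ^ (t - 1) : ℝ) : ℂ) * Complex.exp (-z * y))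
      (volume.restrict (Set.Ioi 0)) := by
  have := integrableOn_rpow_mul_exp_neg_mul_rpow (s := t - 1) (p := 1) (b := z.re)
    (by linarith) one_pos hz
  simp only [Real.rpow_one] at this
  refine Integrable.mono' this (by fun_prop) ?_
  refine (ae_restrict_iff' measurableSet_Ioi).2 (ae_of_all _ fun y (hy : 0 < y) => ?_)
  exact (norm_cpow_exp_le hy z).le

lemma gammaC_integral {t : ℝ} (ht : 0 < t) {z : ℂ} (hz : 0 < z.re) :
    ∫ y in Set.Ioi (0:ℝ), ((y ^ (t - 1) : ℝ) : ℂ) * Complex.exp (-z * y)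
      = Real.Gamma t * Complex.exp (-(t * Complex.log z)) := by
  have hopen : IsOpen {z : ℂ | 0 < z.re} := isOpen_lt continuous_const Complex.continuous_re
  have hd1 : DifferentiableOn ℂ (fun z : ℂ =>
      ∫ y in Set.Ioi (0:ℝ), ((y ^ (t - 1) : ℝ) : ℂ) * Complex.exp (-z * y)) {z : ℂ | 0 < z.re} := by
    intro μ hμ
    have hμ : 0 < μ.re := hμ
    have hint := integrableOn_rpow_mul_exp_neg_mul_rpow (s := t) (p := 1) (b := μ.re / 2)
      (by linarith) one_pos (by linarith)
    simp only [Real.rpow_one] at hint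
    have key := hasDerivAt_integral_of_dominated_loc_of_deriv_le
      (μ := volume.restrict (Set.Ioi (0:ℝ)))
      (F := fun (z : ℂ) (y : ℝ) => ((y ^ (t - 1) : ℝ) : ℂ) * Complex.exp (-z * y)) (x₀ := μ)
      (s := {z : ℂ | μ.re / 2 < z.re})
      (F' := fun z y => ((y ^ (t - 1) : ℝ) : ℂ) * (Complex.exp (-z * y) * (-1 * y)))
      (bound := fun y : ℝ => y ^ t * Real.exp (-(μ.re/2) * y))
      ((isOpen_lt continuous_const Complex.continuous_re).mem_nhds (by simp; linarith))
      (Eventually.of_forall fun z => by fun_prop)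
      (integrable_gammaC ht hμ)
      (by fun_prop)
      ?_ hint ?_
    · exact key.2.differentiableAt.differentiableWithinAt
    · refine (ae_restrict_iff' measurableSet_Ioi).2 (ae_of_all _ fun y (hy : 0 < y) z hz => ?_)
      rw [← mul_assoc, norm_mul, norm_cpow_exp_le hy]
      have h1 : ‖(-1 : ℂ) * y‖ = y := by simp [abs_of_pos hy]
      rw [h1]
      have h2 : y ^ t = y ^ (t - 1) * y := by
        rw [← Real.rpow_add_one hy.ne']; simp
      rw [h2, mul_right_comm]
      have : 0 < y ^ (t - 1) * y := mul_pos (Real.rpow_pos_of_pos hy _) hy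
      refine mul_le_mul_of_nonneg_left (Real.exp_le_exp.2 ?_) this.le
      simp at hz
      nlinarith
    · refine (ae_restrict_iff' measurableSet_Ioi).2 (ae_of_all _ fun y (hy : 0 < y) z hz => ?_)
      have h1 : HasDerivAt (fun z : ℂ => -z * y) (-1 * (y:ℂ)) z :=
        ((hasDerivAt_id z).neg).mul_const (y:ℂ)
      exact h1.cexp.const_mul _
  have hd2 : DifferentiableOn ℂ (fun z : ℂ =>
      Real.Gamma t * Complex.exp (-(t * Complex.log z))) {z : ℂ | 0 < z.re} := by
    intro μ hμ
    have : DifferentiableAt ℂ Complex.log μ := (Complex.hasDerivAt_log (Or.inl hμ)).differentiableAt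
    exact DifferentiableAt.differentiableWithinAt (by fun_prop)
  refine (hd1.analyticOnNhd hopen).eqOn_of_preconnected_of_frequently_eq
    (hd2.analyticOnNhd hopen) (convex_halfSpace_re_gt 0).isPreconnected (z₀ := 1) (by simp) ?_ hz
  have hreal : ∀ r : ℝ, 0 < r →
      ∫ y in Set.Ioi (0:ℝ), ((y ^ (t - 1) : ℝ) : ℂ) * Complex.exp (-(r:ℂ) * y)
      = Real.Gamma t * Complex.exp (-(t * Complex.log r)) := by
    intro r hr
    have := Real.integral_rpow_mul_exp_neg_mul_Ioi ht hr
    have h2 : ∫ y in Set.Ioi (0:ℝ), ((y ^ (t - 1) : ℝ) : ℂ) * Complex.exp (-(r:ℂ) * y)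
      = ((∫ y in Set.Ioi (0:ℝ), y ^ (t - 1) * Real.exp (-(r * y)) : ℝ) : ℂ) := by
      rw [← integral_complex_ofReal]
      congr 1; ext y; push_cast; simp
    rw [h2, this, ← Complex.ofReal_log hr.le, one_div, Real.inv_rpow hr.le,
      ← Real.rpow_neg hr.le, Real.rpow_def_of_pos hr]
    push_cast
    rw [mul_comm]
    congr 2; ring
  have hseq : Tendsto (fun n : ℕ => (((1 + 1/((n:ℝ)+1) : ℝ)) : ℂ)) atTop (nhdsWithin 1 {1}ᶜ) := by
    refine tendsto_nhdsWithin_iff.2 ⟨?_, Eventually.of_forall fun n => ?_⟩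
    · have := (Complex.continuous_ofReal.tendsto _).comp
        ((tendsto_one_div_add_atTop_nhds_zero_nat (𝕜 := ℝ)).const_add 1)
      simpa [Function.comp_def] using this
    · have : (0:ℝ) < 1/((n:ℝ)+1) := by positivity
      simp only [Set.mem_compl_iff, Set.mem_singleton_iff]
      intro h0
      have h1 := Complex.ofReal_eq_one.1 h0
      linarith
  exact hseq.frequently (Frequently.of_forall fun n => hreal _ (by positivity))

lemma charFun_gamma {t : ℝ} (ht : 0 < t) (θ : ℝ) :
    charFun (ProbabilityTheory.gammaMeasure t 1) θ
      = Complex.exp (t * (-Complex.log (1 - θ * Complex.I))) := by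
  have := gammaC_integral ht (z := 1 - θ * Complex.I) (by simp)
  rw [charFun_apply_real, ProbabilityTheory.gammaMeasure,
    integral_withDensity_eq_integral_toReal_smul₀ (f := ProbabilityTheory.gammaPDF t 1)
      (ProbabilityTheory.measurable_gammaPDFReal t 1).ennreal_ofReal.aemeasurable
      (ae_of_all _ fun x => ENNReal.ofReal_lt_top)]
  have hG : (Real.Gamma t : ℂ) ≠ 0 := by exact_mod_cast (Real.Gamma_pos_of_pos ht).ne'
  have h3 : ∀ x : ℝ, (ProbabilityTheory.gammaPDF t 1 x).toReal • Complex.exp (θ * x * Complex.I)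
      = (Set.Ici (0:ℝ)).indicator (fun y : ℝ => (Real.Gamma t : ℂ)⁻¹ * (((y ^ (t - 1) : ℝ) : ℂ) *
          Complex.exp (-(1 - θ * Complex.I) * y))) x := by
    intro x
    rw [ProbabilityTheory.gammaPDF, ENNReal.toReal_ofReal
      (ProbabilityTheory.gammaPDFReal_nonneg ht one_pos x), ProbabilityTheory.gammaPDFReal]
    by_cases hx : 0 ≤ x
    · rw [if_pos hx, Set.indicator_of_mem (Set.mem_Ici.2 hx), Complex.real_smul]
      have : -(1 - θ * Complex.I) * (x:ℂ) = ((-(1 * x) : ℝ) : ℂ) + θ * x * Complex.I := by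
        push_cast; ring
      rw [this, Complex.exp_add, ← Complex.ofReal_exp]
      push_cast
      simp
      ring
    · rw [if_neg hx, Set.indicator_of_notMem (by simpa using hx)]; simp
  simp_rw [h3]
  rw [integral_indicator measurableSet_Ici, integral_Ici_eq_integral_Ioi, integral_const_mul, this,
    inv_mul_cancel_left₀ hG]
  congr 1; ring

lemma integral_gamma {t : ℝ} (ht : 0 < t) (h : ℝ → ℝ) :
    ∫ y, h y ∂(ProbabilityTheory.gammaMeasure t 1) =
     ∫ z in Set.Ioi (0:ℝ), h z * (z ^ (t - 1) * Real.exp (-z) / Real.Gamma t) := by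
  rw [ProbabilityTheory.gammaMeasure,
    integral_withDensity_eq_integral_toReal_smul₀ (f := ProbabilityTheory.gammaPDF t 1)
      (ProbabilityTheory.measurable_gammaPDFReal t 1).ennreal_ofReal.aemeasurable
      (ae_of_all _ fun x => ENNReal.ofReal_lt_top)]
  have h3 : ∀ x : ℝ, (ProbabilityTheory.gammaPDF t 1 x).toReal • h x
      = (Set.Ici (0:ℝ)).indicator
          (fun z : ℝ => h z * (z ^ (t - 1) * Real.exp (-z) / Real.Gamma t)) x := by
    intro x
    rw [ProbabilityTheory.gammaPDF, ENNReal.toReal_ofReal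
      (ProbabilityTheory.gammaPDFReal_nonneg ht one_pos x), ProbabilityTheory.gammaPDFReal]
    by_cases hx : 0 ≤ x
    · rw [if_pos hx, Set.indicator_of_mem (Set.mem_Ici.2 hx), smul_eq_mul]
      simp
      ring
    · rw [if_neg hx, Set.indicator_of_notMem (by simpa using hx)]; simp
  simp_rw [h3]
  rw [integral_indicator measurableSet_Ici, integral_Ici_eq_integral_Ioi]

lemma coreLim (s : ℕ → ℝ) (hs_pos : ∀ n, 0 < s n) (hs : Tendsto s atTop atTop)
    (f : ℕ → ℝ → ℝ)
    (hf_cont : ∀ n, ContinuousOn (f n) (Set.Ioi 0))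
    (hf_mono : ∀ n, StrictMonoOn (f n) (Set.Ioi 0))
    (hf_pos : ∀ n x, 0 < x → 0 < f n x)
    (hS : ∀ x : ℝ, 0 ≤ x → Tendsto (fun n => f n (x ^ (1 / s n)) / f n 1) atTop (nhds x))
    (hW : ∃ ε₀ : ℝ, 0 < ε₀ ∧ ∃ δ : ℕ → ℝ, (∀ n, δ n ∈ Set.Ioc (0:ℝ) 1) ∧
      Tendsto (fun n => s n * f n (1 - δ n) / f n 1) atTop (nhds 0) ∧
      (∀ n, ∀ x : ℝ, 1 ≤ x → f n 1 * x ^ ε₀ ≤ f n (x ^ (1 / s n))) ∧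
      (∀ n, ∀ x : ℝ, (1 - δ n) ^ s n ≤ x → x ≤ 1 → f n (x ^ (1 / s n)) ≤ f n 1 * x ^ ε₀))
    (m : ℕ → ℂ) (μ : ℂ) (hμ : 0 < μ.re) (hm : Tendsto m atTop (nhds μ)) :
    Tendsto (fun n => (s n : ℂ) *
      ((∫ x in Set.Ioi (0:ℝ), Complex.exp (-(m n / f n 1 * f n x))) - 1)) atTop
      (nhds (limL μ)) := by
  obtain ⟨ε, hε, δ, hδ, hη, hWu, hWl⟩ := hW
  have hf1 : ∀ n, 0 < f n 1 := fun n => hf_pos n 1 one_pos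
  set K : ℕ → ℝ → ℂ := fun n x =>
    Complex.exp (-(m n / f n 1 * f n x)) - (if x ≤ 1 then 1 else 0) with hK
  set K2 : ℕ → ℝ → ℂ := fun n => (Set.Ici (1 - δ n)).indicator (K n) with hK2
  set Φ : ℕ → ℝ → ℂ := fun n y => (y ^ (1 / s n - 1)) • K2 n (y ^ (1 / s n)) with hΦ
  set bound : ℝ → ℝ := fun y => (Set.Ioc (0:ℝ) 1).indicator
    (fun y => 2 * (‖μ‖ + 1) * y ^ (ε - 1)) y + Real.exp (-(μ.re/2) * y ^ ε) with hbound
  have hbound_int : Integrable bound (volume.restrict (Set.Ioi 0)) := by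
    refine Integrable.add ?_ ?_
    · refine Integrable.integrableOn ?_
      rw [integrable_indicator_iff measurableSet_Ioc]
      refine Integrable.const_mul ?_ _
      have := (intervalIntegral.integrableOn_Ioo_rpow_iff (s := ε - 1) one_pos).2 (by linarith)
      exact (integrableOn_Ioc_iff_integrableOn_Ioo).2 this
    · have := integrableOn_rpow_mul_exp_neg_mul_rpow (s := 0) (p := ε) (b := μ.re / 2)
        (by linarith) hε (by linarith)
      simp only [Real.rpow_zero, one_mul] at this
      exact this
  have hKmeas : ∀ n, AEStronglyMeasurable (K n) (volume.restrict (Set.Ioi 0)) := by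
    intro n
    refine AEStronglyMeasurable.sub ?_ ?_
    · refine ContinuousOn.aestronglyMeasurable ?_ measurableSet_Ioi
      have := hf_cont n
      fun_prop
    · exact (Measurable.ite measurableSet_Iic measurable_const measurable_const).aestronglyMeasurable
  have hΦmeas : ∀ n, AEStronglyMeasurable (Φ n) (volume.restrict (Set.Ioi 0)) := by
    intro n
    have hpow : ContinuousOn (fun y : ℝ => y ^ (1 / s n)) (Set.Ioi 0) := fun y hy =>
      (Real.continuousAt_rpow_const _ _ (Or.inl (ne_of_gt hy))).continuousWithinAt
    have hmaps : Set.MapsTo (fun y : ℝ => y ^ (1 / s n)) (Set.Ioi 0) (Set.Ioi 0) :=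
      fun y hy => Real.rpow_pos_of_pos hy _
    have hfc : ContinuousOn (fun y : ℝ => f n (y ^ (1 / s n))) (Set.Ioi 0) :=
      (hf_cont n).comp hpow hmaps
    have hmp : Measurable (fun y : ℝ => y ^ (1 / s n)) := by fun_prop
    have hmq : Measurable (fun y : ℝ => y ^ (1 / s n - 1)) := by fun_prop
    refine AEStronglyMeasurable.smul hmq.aestronglyMeasurable ?_
    have : (fun y : ℝ => K2 n (y ^ (1 / s n))) =
      ((fun y : ℝ => y ^ (1 / s n)) ⁻¹' (Set.Ici (1 - δ n))).indicator
        (fun y => Complex.exp (-(m n / f n 1 * f n (y ^ (1 / s n))))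
          - (if y ^ (1 / s n) ≤ 1 then 1 else 0)) := by
      ext y; simp only [hK2, hK, Set.indicator, Set.mem_preimage]; rfl
    rw [this]
    refine AEStronglyMeasurable.indicator ?_ (hmp measurableSet_Ici)
    refine AEStronglyMeasurable.sub ?_ ?_
    · refine ContinuousOn.aestronglyMeasurable ?_ measurableSet_Ioi
      fun_prop
    · exact (Measurable.ite (hmp measurableSet_Iic) measurable_const
        measurable_const).aestronglyMeasurable
  have hev : ∀ᶠ n in atTop, 1 ≤ s n ∧ ‖m n‖ ≤ ‖μ‖ + 1 ∧ μ.re / 2 ≤ (m n).re := by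
    refine (hs.eventually_ge_atTop 1).and (((hm.norm.eventually_lt_const
      (lt_add_one _)).mono fun _ h => h.le).and ?_)
    exact (((Complex.continuous_re.tendsto _).comp hm).eventually_const_lt
      (half_lt_self hμ)).mono fun _ h => h.le
  have hdom : ∀ᶠ n in atTop, ∀ᵐ y ∂(volume.restrict (Set.Ioi (0:ℝ))), ‖Φ n y‖ ≤ bound y := by
    filter_upwards [hev] with n hn
    obtain ⟨h1, h2, h3⟩ := hn
    refine (ae_restrict_iff' measurableSet_Ioi).2 (ae_of_all _ fun y (hy : 0 < y) => ?_)
    have hsn := hs_pos n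
    have hp : 0 < 1 / s n := by positivity
    have hp1 : 1 / s n ≤ 1 := by rw [div_le_one hsn]; exact h1
    have hx : 0 < y ^ (1 / s n) := Real.rpow_pos_of_pos hy _
    have hbn : 0 ≤ bound y := by
      simp only [hbound]
      refine add_nonneg (Set.indicator_nonneg (fun y hy => ?_) _) (Real.exp_pos _).le
      have := Real.rpow_nonneg hy.1.le (ε - 1)
      positivity
    have hmre : 0 ≤ (m n).re := by linarith
    simp only [hΦ, hK2]
    by_cases hc : 1 - δ n ≤ y ^ (1 / s n)
    swap
    · rw [Set.indicator_of_notMem (by simpa using hc)]; simpa using hbn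
    rw [Set.indicator_of_mem (by simpa using hc), norm_smul, Real.norm_eq_abs,
      abs_of_pos (Real.rpow_pos_of_pos hy _)]
    have hz : m n / f n 1 * f n (y ^ (1 / s n)) =
        m n * ((f n (y ^ (1 / s n)) / f n 1 : ℝ) : ℂ) := by
      push_cast; ring
    simp only [hK]
    rw [hz]
    set g := f n (y ^ (1 / s n)) / f n 1 with hg
    have hg0 : 0 ≤ g := (div_pos (hf_pos n _ hx) (hf1 n)).le
    by_cases hy1 : y ≤ 1
    · have hx1 : y ^ (1 / s n) ≤ 1 := Real.rpow_le_one hy.le hy1 hp.le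
      rw [if_pos hx1]
      have hby : (1 - δ n) ^ s n ≤ y := by
        have := Real.rpow_le_rpow (by linarith [(hδ n).2]) hc hsn.le
        rwa [← Real.rpow_mul hy.le, one_div_mul_cancel hsn.ne', Real.rpow_one] at this
      have hgε : g ≤ y ^ ε := by
        rw [hg, div_le_iff₀ (hf1 n), mul_comm]; exact hWl n y hby hy1
      have hn1 := norm_exp_neg_sub_one_le' (z := m n * (g:ℂ))
        (by simp; exact mul_nonneg hmre hg0)
      rw [norm_mul, Complex.norm_real, Real.norm_eq_abs, abs_of_nonneg hg0] at hn1
      have hyp : y ^ (1 / s n - 1) ≤ y ^ (-1 : ℝ) :=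
        Real.rpow_le_rpow_of_exponent_ge hy hy1 (by linarith)
      have hsplit : y ^ (ε - 1) = y ^ (-1:ℝ) * y ^ ε := by
        rw [← Real.rpow_add hy]; congr 1; ring
      simp only [hbound]
      rw [Set.indicator_of_mem (show y ∈ Set.Ioc (0:ℝ) 1 from ⟨hy, hy1⟩), hsplit]
      have hb2 : ‖Complex.exp (-(m n * (g:ℂ))) - 1‖ ≤ 2 * (‖μ‖ + 1) * y ^ ε := by
        refine hn1.trans ?_
        rw [mul_assoc]
        have : ‖m n‖ * g ≤ (‖μ‖ + 1) * y ^ ε := by gcongr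
        linarith
      have := mul_le_mul hyp hb2 (norm_nonneg _) (Real.rpow_nonneg hy.le _)
      have he := Real.exp_pos (-(μ.re/2) * y ^ ε)
      linarith
    · push Not at hy1
      have hx1 : 1 < y ^ (1 / s n) := Real.one_lt_rpow hy1 hp
      rw [if_neg (not_le.2 hx1), sub_zero, Complex.norm_exp]
      have hyp : y ^ (1 / s n - 1) ≤ 1 :=
        Real.rpow_le_one_of_one_le_of_nonpos hy1.le (by linarith)
      have hgε : y ^ ε ≤ g := by
        rw [hg, le_div_iff₀ (hf1 n), mul_comm]; exact hWu n y hy1.le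
      simp only [hbound]
      rw [Set.indicator_of_notMem (by simp [hy1]), zero_add]
      have hre : (-(m n * (g:ℂ))).re = -((m n).re * g) := by simp
      rw [hre]
      have hyε : 0 ≤ y ^ ε := Real.rpow_nonneg hy.le _
      have : Real.exp (-((m n).re * g)) ≤ Real.exp (-(μ.re/2) * y ^ ε) := by
        refine Real.exp_le_exp.2 ?_
        have : μ.re / 2 * y ^ ε ≤ (m n).re * g := mul_le_mul h3 hgε hyε hmre
        linarith
      calc _ ≤ 1 * Real.exp (-((m n).re * g)) := by gcongr
        _ ≤ _ := by rw [one_mul]; exact this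
  have hinv : Tendsto (fun n => 1 / s n) atTop (nhds 0) := by
    simpa [Function.comp_def] using tendsto_inv_atTop_zero.comp hs
  have hη0 : Tendsto (fun n => f n (1 - δ n) / f n 1) atTop (nhds 0) := by
    have := hinv.mul hη
    rw [zero_mul] at this
    refine this.congr fun n => ?_
    have := (hs_pos n).ne'
    field_simp
  have hptw : ∀ᵐ y ∂(volume.restrict (Set.Ioi (0:ℝ))),
      Tendsto (fun n => Φ n y) atTop (nhds (limFun μ y)) := by
    refine (ae_restrict_iff' measurableSet_Ioi).2 (ae_of_all _ fun y (hy : 0 < y) => ?_)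
    have hgy := hS y hy.le
    have hmem : ∀ᶠ n in atTop, 1 - δ n ≤ y ^ (1 / s n) := by
      filter_upwards [hη0.eventually_lt_const (half_pos hy),
        hgy.eventually_const_lt (half_lt_self hy)] with n h1 h2
      by_contra hlt
      push Not at hlt
      have hx : 0 < y ^ (1 / s n) := Real.rpow_pos_of_pos hy _
      have h3 := (hf_mono n) (Set.mem_Ioi.2 hx) (Set.mem_Ioi.2 (hx.trans hlt)) hlt
      have := div_lt_div_of_pos_right h3 (hf1 n)
      linarith
    have hpow : Tendsto (fun n => y ^ (1 / s n - 1)) atTop (nhds (y ^ (0 - 1 : ℝ))) :=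
      (Real.continuous_const_rpow hy.ne').continuousAt.tendsto.comp (hinv.sub_const 1)
    have hexp : Tendsto (fun n => Complex.exp (-(m n * ((f n (y ^ (1 / s n)) / f n 1 : ℝ) : ℂ))))
        atTop (nhds (Complex.exp (-(μ * y)))) :=
      (Complex.continuous_exp.tendsto _).comp
        (hm.mul ((Complex.continuous_ofReal.tendsto _).comp hgy)).neg
    have hall := hpow.smul (hexp.sub_const (if y ≤ 1 then 1 else 0))
    have hlim : (y ^ (0 - 1 : ℝ)) • (Complex.exp (-(μ * y)) - (if y ≤ 1 then (1:ℂ) else 0))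
        = limFun μ y := by
      unfold limFun
      rw [zero_sub, Real.rpow_neg_one, Complex.real_smul, div_eq_inv_mul]
      push_cast; rfl
    rw [hlim] at hall
    refine hall.congr' ?_
    filter_upwards [hmem] with n hn
    simp only [hΦ, hK2]
    rw [Set.indicator_of_mem (by simpa using hn)]
    simp only [hK]
    have hiff : y ^ (1 / s n) ≤ 1 ↔ y ≤ 1 := by
      have := Real.rpow_le_rpow_iff hy.le zero_le_one (z := 1 / s n)
        (one_div_pos.2 (hs_pos n))
      rwa [Real.one_rpow] at this
    have hz : m n / f n 1 * f n (y ^ (1 / s n)) =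
        m n * ((f n (y ^ (1 / s n)) / f n 1 : ℝ) : ℂ) := by
      push_cast; ring
    simp only [hiff, hz]
  have hDCT := tendsto_integral_filter_of_dominated_convergence bound
    (Eventually.of_forall hΦmeas) hdom hbound_int hptw
  -- the small part
  set B : ℕ → ℂ := fun n => ∫ x in Set.Ioo 0 (1 - δ n), K n x with hB
  have hKbd : ∀ᶠ n in atTop, ∀ x ∈ Set.Ioo 0 (1 - δ n),
      ‖K n x‖ ≤ 2 * (‖μ‖ + 1) * (f n (1 - δ n) / f n 1) := by
    filter_upwards [hev] with n hn x hx
    obtain ⟨h1, h2, h3⟩ := hn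
    have hmre : 0 ≤ (m n).re := by linarith
    have hx1 : x ≤ 1 := by linarith [hx.2, (hδ n).1]
    simp only [hK]
    rw [if_pos hx1]
    have hz : m n / f n 1 * f n x = m n * ((f n x / f n 1 : ℝ) : ℂ) := by
      push_cast; ring
    rw [hz]
    have hg0 : 0 ≤ f n x / f n 1 := (div_pos (hf_pos n _ hx.1) (hf1 n)).le
    have hn1 := norm_exp_neg_sub_one_le' (z := m n * ((f n x / f n 1 : ℝ) : ℂ))
        (by rw [Complex.re_mul_ofReal]; exact mul_nonneg hmre hg0)
    rw [norm_mul, Complex.norm_real, Real.norm_eq_abs, abs_of_nonneg hg0] at hn1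
    have hle : f n x / f n 1 ≤ f n (1 - δ n) / f n 1 :=
      div_le_div_of_nonneg_right ((hf_mono n) (Set.mem_Ioi.2 hx.1)
        (Set.mem_Ioi.2 (hx.1.trans hx.2)) hx.2).le (hf1 n).le
    refine hn1.trans ?_
    rw [mul_assoc]
    have : ‖m n‖ * (f n x / f n 1) ≤ (‖μ‖ + 1) * (f n (1 - δ n) / f n 1) := by gcongr
    linarith
  have hBlim : Tendsto (fun n => (s n : ℂ) * B n) atTop (nhds 0) := by
    have hη' : Tendsto (fun n => 2 * (‖μ‖ + 1) * |s n * f n (1 - δ n) / f n 1|) atTop (nhds 0) := by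
      have := (hη.abs).const_mul (2 * (‖μ‖ + 1))
      simpa using this
    refine squeeze_zero_norm' ?_ hη'
    filter_upwards [hKbd] with n hn
    have hvol : volume (Set.Ioo 0 (1 - δ n)) < ⊤ := by simp
    have hB1 : ‖B n‖ ≤ _ := norm_setIntegral_le_of_norm_le_const hvol hn
    have hr : (volume : Measure ℝ).real (Set.Ioo 0 (1 - δ n)) = 1 - δ n := by
      rw [Real.volume_real_Ioo_of_le (by linarith [(hδ n).2])]; ring
    rw [hr] at hB1
    have hd0 : 0 ≤ 1 - δ n := by linarith [(hδ n).2]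
    have hd1 : 1 - δ n ≤ 1 := by linarith [(hδ n).1]
    rw [norm_mul, Complex.norm_real, Real.norm_eq_abs, abs_of_pos (hs_pos n)]
    have hM : 0 ≤ 2 * (‖μ‖ + 1) := by positivity
    have e1 : |s n * f n (1 - δ n) / f n 1| = s n * |f n (1 - δ n) / f n 1| := by
      rw [mul_div_assoc, abs_mul, abs_of_pos (hs_pos n)]
    rw [e1]
    have e2 : ‖B n‖ ≤ 2 * (‖μ‖ + 1) * |f n (1 - δ n) / f n 1| := by
      calc ‖B n‖ ≤ 2 * (‖μ‖ + 1) * (f n (1 - δ n) / f n 1) * (1 - δ n) := hB1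
        _ ≤ 2 * (‖μ‖ + 1) * |f n (1 - δ n) / f n 1| * 1 := by
            gcongr
            exact le_abs_self _
        _ = _ := mul_one _
    calc s n * ‖B n‖ ≤ s n * (2 * (‖μ‖ + 1) * |f n (1 - δ n) / f n 1|) :=
          mul_le_mul_of_nonneg_left e2 (hs_pos n).le
      _ = _ := by ring
  have hsum := hBlim.add hDCT
  rw [zero_add] at hsum
  refine hsum.congr' ?_
  filter_upwards [hKbd, hdom] with n hn hn2
  have hsn := hs_pos n
  have hsC : (s n : ℂ) ≠ 0 := by exact_mod_cast hsn.ne'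
  have hp : 0 < 1 / s n := by positivity
  have hΦint : IntegrableOn (Φ n) (Set.Ioi 0) := Integrable.mono' hbound_int (hΦmeas n) hn2
  have hK2int : IntegrableOn (K2 n) (Set.Ioi 0) := by
    refine (integrableOn_Ioi_comp_rpow_iff (K2 n) hp.ne').1 ?_
    have := hΦint.smul (1 / s n)
    refine this.congr (ae_of_all _ fun y => ?_)
    simp only [hΦ, Pi.smul_apply, abs_of_pos hp, smul_smul]
  have hK2sub : ∫ x in Set.Ioi (0:ℝ), K2 n x = (1 / s n : ℝ) • ∫ y in Set.Ioi (0:ℝ), Φ n y := by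
    rw [← integral_comp_rpow_Ioi_of_pos (g := K2 n) hp, ← integral_smul]
    simp only [hΦ, smul_smul]
  set K1 : ℝ → ℂ := (Set.Iio (1 - δ n)).indicator (K n) with hK1
  have hset : Set.Iio (1 - δ n) ∩ Set.Ioi 0 = Set.Ioo 0 (1 - δ n) := by
    ext x; simp [and_comm]
  have hK1int : IntegrableOn K1 (Set.Ioi 0) := by
    rw [hK1, IntegrableOn, integrable_indicator_iff measurableSet_Iio, IntegrableOn,
      Measure.restrict_restrict measurableSet_Iio, hset]
    refine Integrable.of_bound ?_ _ ((ae_restrict_iff' measurableSet_Ioo).2 (ae_of_all _ hn))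
    have := (hKmeas n).restrict (s := Set.Iio (1 - δ n))
    rwa [Measure.restrict_restrict measurableSet_Iio, hset] at this
  have hK1B : ∫ x in Set.Ioi (0:ℝ), K1 x = B n := by
    rw [hK1, integral_indicator measurableSet_Iio, Measure.restrict_restrict measurableSet_Iio, hset]
  have hKsum : K n = fun x => K1 x + K2 n x := by
    ext x
    simp only [hK1, hK2, Set.indicator]
    by_cases hx : x < 1 - δ n
    · simp [hx, not_le.2 hx]
    · simp [hx, not_lt.1 hx]
  have hKint : IntegrableOn (K n) (Set.Ioi 0) := by
    rw [hKsum]; exact hK1int.add hK2int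
  have hKval : ∫ x in Set.Ioi (0:ℝ), K n x = B n + (1 / s n : ℝ) • ∫ y in Set.Ioi (0:ℝ), Φ n y := by
    rw [hKsum, integral_add hK1int hK2int, hK1B, hK2sub]
  have hone : (fun x : ℝ => if x ≤ 1 then (1:ℂ) else 0) = (Set.Iic (1:ℝ)).indicator (fun _ => 1) := by
    ext x; simp [Set.indicator]
  have hset1 : Set.Iic (1:ℝ) ∩ Set.Ioi 0 = Set.Ioc 0 1 := by
    ext x; simp [and_comm]
  have hone_int : IntegrableOn (fun x : ℝ => if x ≤ 1 then (1:ℂ) else 0) (Set.Ioi 0) := by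
    rw [hone, IntegrableOn, integrable_indicator_iff measurableSet_Iic, IntegrableOn,
      Measure.restrict_restrict measurableSet_Iic, hset1]
    exact integrableOn_const (by simp)
  have hone_val : ∫ x in Set.Ioi (0:ℝ), (if x ≤ 1 then (1:ℂ) else 0) = 1 := by
    rw [hone, integral_indicator measurableSet_Iic, Measure.restrict_restrict measurableSet_Iic,
      hset1]
    simp
  have hEsum : (fun x : ℝ => Complex.exp (-(m n / f n 1 * f n x)))
      = fun x => K n x + (if x ≤ 1 then (1:ℂ) else 0) := by
    ext x; simp [hK]
  rw [hEsum, integral_add hKint hone_int, hone_val, hKval, add_sub_cancel_right, mul_add,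
    Complex.real_smul]
  push_cast
  field_simp

lemma nuMeasure_facts {f : ℝ → ℝ} (hf : ContinuousOn f (Set.Ioi 0)) {A l : ℝ} (hA : 0 < A)
    (h1 : A * ∫ x in Set.Ioi (0:ℝ), Real.exp (-(l * f x)) = 1) :
    IsProbabilityMeasure (nuMeasure f A l) ∧ ∀ τ : ℝ, charFun (nuMeasure f A l) τ =
      A * ∫ x in Set.Ioi (0:ℝ), Complex.exp (-((l - τ * Complex.I) * f x)) := by
  have hfm : AEMeasurable f (volume.restrict (Set.Ioi 0)) := hf.aemeasurable measurableSet_Ioi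
  have hdm : AEMeasurable (fun x => ENNReal.ofReal (A * Real.exp (-(l * f x))))
      (volume.restrict (Set.Ioi 0)) := by fun_prop
  have hfm' : AEMeasurable f ((volume.restrict (Set.Ioi 0)).withDensity
      fun x => ENNReal.ofReal (A * Real.exp (-(l * f x)))) :=
    hfm.mono_ac (withDensity_absolutelyContinuous _ _)
  have hint : Integrable (fun x => Real.exp (-(l * f x))) (volume.restrict (Set.Ioi 0)) := by
    by_contra hni
    rw [integral_undef hni] at h1
    simp at h1
  constructor
  · constructor
    rw [nuMeasure, Measure.map_apply_of_aemeasurable hfm' MeasurableSet.univ, Set.preimage_univ,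
      withDensity_apply _ MeasurableSet.univ, Measure.restrict_univ,
      ← ofReal_integral_eq_lintegral_ofReal (hint.const_mul A)
        (ae_of_all _ fun x => by positivity), integral_const_mul, h1, ENNReal.ofReal_one]
  · intro τ
    rw [charFun_apply_real, nuMeasure, integral_map hfm' (by fun_prop),
      integral_withDensity_eq_integral_toReal_smul₀ hdm (ae_of_all _ fun x => ENNReal.ofReal_lt_top),
      ← integral_const_mul]
    congr 1; ext x
    rw [ENNReal.toReal_ofReal (by positivity), Complex.real_smul]
    push_cast
    rw [mul_assoc, ← Complex.exp_add]
    congr 2; ring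

lemma sumLaw_facts {ν : Measure ℝ} [IsProbabilityMeasure ν] (k : ℕ) :
    IsProbabilityMeasure (sumLaw ν k) ∧ ∀ τ : ℝ, charFun (sumLaw ν k) τ = charFun ν τ ^ k := by
  induction k with
  | zero =>
    refine ⟨by simp only [sumLaw]; infer_instance, fun τ => ?_⟩
    simp [sumLaw]
  | succ k ih =>
    obtain ⟨h1, h2⟩ := ih
    refine ⟨?_, fun τ => ?_⟩
    · simp only [sumLaw]
      exact Measure.isProbabilityMeasure_map (by fun_prop)
    · simp only [sumLaw]
      rw [ProbabilityTheory.charFun_map_add_prod_eq_mul, Pi.mul_apply, h2, pow_succ]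

lemma tendsto_root {s : ℕ → ℝ} (hs : Tendsto s atTop atTop) (hs_pos : ∀ n, 0 < s n)
    {a : ℝ} (ha : 0 < a) :
    Tendsto (fun n => s n * (a ^ (1 / s n) - 1)) atTop (nhds (Real.log a)) := by
  have hd : HasDerivAt (fun x : ℝ => a ^ x) (Real.log a) 0 := by
    simpa using Real.hasStrictDerivAt_const_rpow ha 0 |>.hasDerivAt
  have h := hasDerivAt_iff_tendsto_slope_zero.1 hd
  have hseq : Tendsto (fun n => 1 / s n) atTop (nhdsWithin 0 {0}ᶜ) := by
    refine tendsto_nhdsWithin_iff.2 ⟨?_, Eventually.of_forall fun n => ?_⟩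
    · simpa [Function.comp_def] using tendsto_inv_atTop_zero.comp hs
    · exact (one_div_pos.2 (hs_pos n)).ne'
  refine (h.comp hseq).congr fun n => ?_
  simp

/-- the law of `λ_n(ã) (D_1 + ⋯ + D_{⌊s_n t⌋})` converges weakly to the
Gamma(t,1) distribution. -/
theorem statement11 (s : ℕ → ℝ) (hs_pos : ∀ n, 0 < s n) (hs : Tendsto s atTop atTop)
    (f : ℕ → ℝ → ℝ)
    (hf_cont : ∀ n, ContinuousOn (f n) (Set.Ioi 0))
    (hf_mono : ∀ n, StrictMonoOn (f n) (Set.Ioi 0))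
    (hf_pos : ∀ n x, 0 < x → 0 < f n x)
    -- Condition (S)
    (hS : ∀ x : ℝ, 0 ≤ x → Tendsto (fun n => f n (x ^ (1 / s n)) / f n 1) atTop (nhds x))
    -- Condition (W)
    (hW : ∃ ε₀ : ℝ, 0 < ε₀ ∧ ∃ δ : ℕ → ℝ, (∀ n, δ n ∈ Set.Ioc (0:ℝ) 1) ∧
      Tendsto (fun n => s n * f n (1 - δ n) / f n 1) atTop (nhds 0) ∧
      (∀ n, ∀ x : ℝ, 1 ≤ x → f n 1 * x ^ ε₀ ≤ f n (x ^ (1 / s n))) ∧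
      (∀ n, ∀ x : ℝ, (1 - δ n) ^ s n ≤ x → x ≤ 1 → f n (x ^ (1 / s n)) ≤ f n 1 * x ^ ε₀))
    (a : ℝ) (ha : 0 < a)
    (lam : ℕ → ℝ) (n₀ : ℕ)
    (hlam : ∀ n ≥ n₀, 0 < lam n ∧
      (∀ l : ℝ, 0 < l →
        (a ^ (1 / s n) * ∫ x in Set.Ioi (0:ℝ), Real.exp (-(l * f n x)) = 1 ↔ l = lam n))) :
    ∀ t : ℝ, 0 < t → ∀ h : ℝ → ℝ, Continuous h → (∃ C : ℝ, ∀ x, |h x| ≤ C) →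
      Tendsto (fun n => ∫ y, h y ∂(Measure.map (fun y => lam n * y)
          (sumLaw (nuMeasure (f n) (a ^ (1 / s n)) (lam n)) ⌊s n * t⌋₊)))
        atTop
        (nhds (∫ z in Set.Ioi (0:ℝ), h z * (z ^ (t - 1) * Real.exp (-z) / Real.Gamma t))) := by
  intro t ht h hh hC
  obtain ⟨C, hC⟩ := hC
  have hf1 : ∀ n, 0 < f n 1 := fun n => hf_pos n 1 one_pos
  have core := coreLim s hs_pos hs f hf_cont hf_mono hf_pos hS hW
  have hApos : ∀ n, 0 < a ^ (1 / s n) := fun n => Real.rpow_pos_of_pos ha _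
  have hlameq : ∀ n ≥ n₀, a ^ (1 / s n) * ∫ x in Set.Ioi (0:ℝ), Real.exp (-(lam n * f n x)) = 1 :=
    fun n hn => ((hlam n hn).2 (lam n) (hlam n hn).1).2 rfl
  set l1 : ℝ := (limL 1).re with hl1
  -- the real version of the limit
  set R : ℕ → ℝ → ℝ := fun n c =>
    s n * ((∫ x in Set.Ioi (0:ℝ), Real.exp (-(c / f n 1 * f n x))) - 1) with hR
  have hRlim : ∀ c : ℝ, 0 < c → Tendsto (fun n => R n c) atTop (nhds (l1 - Real.log c)) := by
    intro c hc
    have h1 := core (fun _ => (c:ℂ)) c (by simpa using hc) tendsto_const_nhds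
    rw [limL_eq (by simpa using hc), limL_one_real, ← Complex.ofReal_log hc.le,
      ← Complex.ofReal_sub] at h1
    have h2 := (Complex.continuous_re.tendsto _).comp h1
    rw [Complex.ofReal_re] at h2
    refine h2.congr fun n => ?_
    simp only [Function.comp, hR]
    have : ∫ x in Set.Ioi (0:ℝ), Complex.exp (-((c:ℂ) / f n 1 * f n x)) =
        ((∫ x in Set.Ioi (0:ℝ), Real.exp (-(c / f n 1 * f n x)) : ℝ) : ℂ) := by
      rw [← integral_complex_ofReal]
      congr 1; ext x; push_cast; rfl
    rw [this, ← Complex.ofReal_one, ← Complex.ofReal_sub, ← Complex.ofReal_mul, Complex.ofReal_re]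
  -- nonzero integral means integrable
  have hRint : ∀ c : ℝ, 0 < c → ∀ᶠ n in atTop,
      Integrable (fun x => Real.exp (-(c / f n 1 * f n x))) (volume.restrict (Set.Ioi 0)) := by
    intro c hc
    have h1 := hRlim c hc
    have hlt := (hs.eventually_gt_atTop (-(l1 - Real.log c) + 1))
    filter_upwards [hlt, h1.eventually_const_lt (sub_one_lt _)] with n h2 h3
    by_contra hni
    simp only [hR] at h3
    rw [integral_undef hni] at h3
    linarith
  have hanti : ∀ n c d, c ≤ d →
      Integrable (fun x => Real.exp (-(c / f n 1 * f n x))) (volume.restrict (Set.Ioi 0)) →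
      R n d ≤ R n c := by
    intro n c d hcd hi
    simp only [hR]
    refine mul_le_mul_of_nonneg_left (sub_le_sub_right ?_ _) (hs_pos n).le
    refine integral_mono_of_nonneg (ae_of_all _ fun x => (Real.exp_pos _).le) hi ?_
    refine (ae_restrict_iff' measurableSet_Ioi).2 (ae_of_all _ fun y (hy : 0 < y) => ?_)
    refine Real.exp_le_exp.2 (neg_le_neg ?_)
    exact mul_le_mul_of_nonneg_right (div_le_div_of_nonneg_right hcd (hf1 n).le) (hf_pos n y hy).le
  set M : ℕ → ℝ := fun n => lam n * f n 1 with hM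
  have hMlam : ∀ n, M n / f n 1 = lam n := fun n => mul_div_cancel_right₀ _ (hf1 n).ne'
  have hMint : ∀ n ≥ n₀,
      Integrable (fun x => Real.exp (-(M n / f n 1 * f n x))) (volume.restrict (Set.Ioi 0)) := by
    intro n hn
    rw [hMlam]
    by_contra hni
    have := hlameq n hn
    rw [integral_undef hni] at this
    simp at this
  have hRM : Tendsto (fun n => R n (M n)) atTop (nhds (-Real.log a)) := by
    have := tendsto_root hs hs_pos (inv_pos.2 ha)
    rw [Real.log_inv] at this
    refine this.congr' ?_
    filter_upwards [eventually_ge_atTop n₀] with n hn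
    simp only [hR, hMlam]
    rw [Real.inv_rpow ha.le, eq_comm]
    congr 2
    exact eq_inv_of_mul_eq_one_right (hlameq n hn)
  set M0 : ℝ := a * Real.exp l1 with hM0
  have hM0pos : 0 < M0 := by positivity
  have hlogM0 : Real.log M0 = Real.log a + l1 := by
    rw [hM0, Real.log_mul ha.ne' (Real.exp_pos _).ne', Real.log_exp]
  have hlow : ∀ c, 0 < c → c < M0 → ∀ᶠ n in atTop, c < M n := by
    intro c hc hcM
    have hlt := Real.log_lt_log hc hcM
    have hd := (hRM.sub (hRlim c hc)).eventually_lt_const (u := 0) (by linarith)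
    filter_upwards [hd, eventually_ge_atTop n₀] with n h1 hn
    by_contra hle
    push Not at hle
    have := hanti n _ _ hle (hMint n hn)
    linarith
  have hup : ∀ c, M0 < c → ∀ᶠ n in atTop, M n < c := by
    intro c hcM
    have hc := hM0pos.trans hcM
    have hlt := Real.log_lt_log hM0pos hcM
    have hd := ((hRlim c hc).sub hRM).eventually_lt_const (u := 0) (by linarith)
    filter_upwards [hd, hRint c hc] with n h1 hn
    by_contra hle
    push Not at hle
    have := hanti n _ _ hle hn
    linarith
  have hMlim : Tendsto M atTop (nhds M0) := by
    refine tendsto_order.2 ⟨fun c hc => ?_, fun c hc => hup c hc⟩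
    have h1 : max c (M0 / 2) < M0 := max_lt hc (by linarith)
    filter_upwards [hlow (max c (M0/2)) (lt_max_of_lt_right (by linarith)) h1] with n hn
    exact (le_max_left _ _).trans_lt hn
  -- characteristic functions
  set ν : ℕ → Measure ℝ := fun n => nuMeasure (f n) (a ^ (1 / s n)) (lam n) with hν
  set P : ℕ → Measure ℝ := fun n => Measure.map (fun y => lam n * y)
    (sumLaw (ν n) ⌊s n * t⌋₊) with hP
  have hνp : ∀ n ≥ n₀, IsProbabilityMeasure (ν n) := fun n hn =>
    (nuMeasure_facts (hf_cont n) (hApos n) (hlameq n hn)).1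
  have hPp : ∀ n ≥ n₀, IsProbabilityMeasure (P n) := by
    intro n hn
    have := hνp n hn
    have := (sumLaw_facts (ν := ν n) ⌊s n * t⌋₊).1
    exact Measure.isProbabilityMeasure_map (by fun_prop)
  have hchar : ∀ θ : ℝ, Tendsto (fun n => charFun (P n) θ) atTop
      (nhds (charFun (ProbabilityTheory.gammaMeasure t 1) θ)) := by
    intro θ
    rw [charFun_gamma ht]
    set w : ℂ := 1 - θ * Complex.I with hw
    have hwre : 0 < w.re := by simp [hw]
    set φ : ℕ → ℂ := fun n => (a ^ (1 / s n) : ℝ) *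
      ∫ x in Set.Ioi (0:ℝ), Complex.exp (-((M n * w) / f n 1 * f n x)) with hφ
    have hmre : 0 < ((M0:ℂ) * w).re := by
      rw [Complex.re_ofReal_mul]; exact mul_pos hM0pos hwre
    have h1 := core (fun n => (M n : ℂ) * w) (M0 * w) hmre
      (((Complex.continuous_ofReal.tendsto _).comp hMlim).mul_const w)
    rw [limL_eq hmre, limL_one_real, Complex.log_ofReal_mul hM0pos (by
      intro h0; rw [h0] at hwre; simp at hwre), hlogM0] at h1
    have hroot := tendsto_root hs hs_pos ha
    have hrootC := (Complex.continuous_ofReal.tendsto _).comp hroot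
    have hA1 : Tendsto (fun n => ((a ^ (1 / s n) : ℝ) : ℂ)) atTop (nhds 1) := by
      have hinv : Tendsto (fun n => 1 / s n) atTop (nhds 0) := by
        simpa [Function.comp_def] using tendsto_inv_atTop_zero.comp hs
      have h2 := (Real.continuous_const_rpow ha.ne').continuousAt.tendsto.comp hinv
      rw [Real.rpow_zero] at h2
      have := (Complex.continuous_ofReal.tendsto _).comp h2
      rwa [Complex.ofReal_one] at this
    have hφlim : Tendsto (fun n => (s n : ℂ) * (φ n - 1)) atTop (nhds (-Complex.log w)) := by
      have h3 := (hA1.mul h1).add hrootC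
      have hval : (1:ℂ) * ((l1:ℂ) - (((Real.log a + l1 : ℝ) : ℂ) + Complex.log w))
          + ((Real.log a : ℝ) : ℂ) = -Complex.log w := by
        push_cast; ring
      rw [← hl1, hval] at h3
      refine h3.congr fun n => ?_
      simp only [hφ, Function.comp]
      have e : ((s n * (a ^ (1 / s n) - 1) : ℝ) : ℂ)
          = (s n : ℂ) * (((a ^ (1 / s n) : ℝ) : ℂ) - 1) := by
        rw [Complex.ofReal_mul, Complex.ofReal_sub, Complex.ofReal_one]
      rw [e]
      ring
    refine (pow_lim hs_pos hs hφlim ht).congr' ?_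
    filter_upwards [eventually_ge_atTop n₀] with n hn
    have := hνp n hn
    simp only [hP]
    rw [charFun_map_mul, (sumLaw_facts (ν := ν n) ⌊s n * t⌋₊).2,
      (nuMeasure_facts (hf_cont n) (hApos n) (hlameq n hn)).2]
    congr 1
    simp only [hφ]
    congr 2
    ext x
    congr 3
    have e : ((M n : ℂ)) / f n 1 = lam n := by
      rw [← Complex.ofReal_div, hMlam]
    rw [mul_div_right_comm, e, hw]
    push_cast
    ring
  rw [← integral_gamma ht h]
  have hγ := ProbabilityTheory.isProbabilityMeasure_gammaMeasure ht one_pos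
  let Q : ℕ → ProbabilityMeasure ℝ := fun n => ⟨P (n + n₀), hPp _ (Nat.le_add_left _ _)⟩
  let Q0 : ProbabilityMeasure ℝ := ⟨ProbabilityTheory.gammaMeasure t 1, hγ⟩
  have hQ : Tendsto Q atTop (nhds Q0) :=
    ProbabilityMeasure.tendsto_of_tendsto_charFun fun θ =>
      (tendsto_add_atTop_iff_nat n₀).2 (hchar θ)
  have hfin := ProbabilityMeasure.tendsto_iff_forall_integral_tendsto.1 hQ
    (BoundedContinuousFunction.ofNormedAddCommGroup h hh C hC)
  exact (tendsto_add_atTop_iff_nat n₀).1 hfin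
end

section
/- Let (s_n) be a positive sequence with s_n → ∞ and (f_n) continuous strictly increasing functions from (0,∞) to (0,∞) satisfying Conditions (S) and (W). Fix a > 0, write ã = a^{1/s_n}, and for all sufficiently large n let λ_n(ã) > 0 be the unique solution of ã ∫_0^∞ e^{−λ f_n(x)} dx = 1; let ν_ã be the probability measure on (0,∞) with ν_ã(B) = ∫_0^∞ 1_B(f_n(x)) ã e^{−λ_n(ã) f_n(x)} dx, let m_n = ∫ y dν_ã(y), and let ν*_ã be the size-biased measure dν*_ã(y) = y dν_ã(y)/m_n. Then the image of ν*_ã under the map y ↦ λ_n(ã) y converges weakly as n → ∞ to the exponential distribution with mean 1. -/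
open MeasureTheory Filter

lemma measurable_ind_of_contOn {k : ℝ → ℝ} (hk : ContinuousOn k (Set.Ioi 0)) :
    Measurable ((Set.Ioi (0:ℝ)).indicator k) := by
  classical
  rw [← Set.piecewise_eq_indicator]
  exact hk.measurable_piecewise continuousOn_const measurableSet_Ioi

lemma lemmaA (s : ℕ → ℝ) (hs_pos : ∀ n, 0 < s n) (hs : Tendsto s atTop atTop)
    (f : ℕ → ℝ → ℝ)
    (hf_mono : ∀ n, StrictMonoOn (f n) (Set.Ioi 0))
    (hf_pos : ∀ n x, 0 < x → 0 < f n x)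
    (hS : ∀ x : ℝ, 0 ≤ x → Tendsto (fun n => f n (x ^ (1 / s n)) / f n 1) atTop (nhds x))
    (e : ℝ) (he : 0 < e) (δ : ℕ → ℝ) (hδ : ∀ n, δ n ∈ Set.Ioc (0:ℝ) 1)
    (hW1 : Tendsto (fun n => s n * f n (1 - δ n) / f n 1) atTop (nhds 0))
    (hW2 : ∀ n, ∀ x : ℝ, 1 ≤ x → f n 1 * x ^ e ≤ f n (x ^ (1 / s n)))
    (hW3 : ∀ n, ∀ x : ℝ, (1 - δ n) ^ s n ≤ x → x ≤ 1 → f n (x ^ (1 / s n)) ≤ f n 1 * x ^ e)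
    (G : ℕ → ℝ → ℝ) (v : ℝ → ℝ) (C c : ℝ) (hC : 0 < C) (hc : 0 < c)
    (hm : ∀ n, Measurable ((Set.Ioi (0:ℝ)).indicator (G n)))
    (hb1 : ∀ᶠ n in atTop, ∀ x, 0 < x → x < 1 → |G n x| ≤ C * (f n x / f n 1))
    (hb2 : ∀ᶠ n in atTop, ∀ x, 1 ≤ x → |G n x| ≤ C * Real.exp (-(c * (f n x / f n 1))))
    (hlim : ∀ t, 0 < t → Tendsto (fun n => G n (t ^ (1 / s n))) atTop (nhds (v t))) :
    (∀ᶠ n in atTop, IntegrableOn (G n) (Set.Ioi 0)) ∧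
    IntegrableOn (fun t => v t / t) (Set.Ioi 0) ∧
    Tendsto (fun n => s n * ∫ x in Set.Ioi (0:ℝ), G n x) atTop
      (nhds (∫ t in Set.Ioi (0:ℝ), v t / t)) := by
  -- the part above `1 - δ`
  set H : ℕ → ℝ → ℝ := fun n => (Set.Ici (1 - δ n)).indicator (G n) with hH
  set W : ℕ → ℝ → ℝ := fun n t => t ^ (1 / s n - 1) * H n (t ^ (1 / s n)) with hWdef
  set B : ℝ → ℝ := fun t => (C * Real.exp c) * (t ^ (e - 1) * Real.exp (-c * t ^ e))
    + C * (t ^ (0:ℝ) * Real.exp (-c * t ^ e)) with hB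
  have hBint : IntegrableOn B (Set.Ioi 0) := by
    apply Integrable.add
    · exact (integrableOn_rpow_mul_exp_neg_mul_rpow (by linarith) he hc).const_mul _
    · exact (integrableOn_rpow_mul_exp_neg_mul_rpow (by norm_num) he hc).const_mul _
  have hHmeas : ∀ n, Measurable ((Set.Ioi (0:ℝ)).indicator (H n)) := by
    intro n
    rw [hH]; simp only
    rw [Set.indicator_indicator, Set.inter_comm, ← Set.indicator_indicator]
    exact (hm n).indicator measurableSet_Ici
  have hWmeas : ∀ n, AEStronglyMeasurable (W n) (volume.restrict (Set.Ioi 0)) := by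
    intro n
    have h1 : Measurable (fun t : ℝ => t ^ (1 / s n - 1) *
        ((Set.Ioi (0:ℝ)).indicator (H n)) (t ^ (1 / s n))) := by
      apply Measurable.mul
      · fun_prop
      · exact (hHmeas n).comp (by fun_prop)
    refine h1.aestronglyMeasurable.congr ?_
    filter_upwards [ae_restrict_mem measurableSet_Ioi] with t ht
    simp only [hWdef]
    rw [Set.indicator_of_mem]
    exact Real.rpow_pos_of_pos ht _
  have hWb : ∀ᶠ n in atTop, ∀ t, 0 < t → ‖W n t‖ ≤ B t := by
    filter_upwards [hb1, hb2, hs.eventually_ge_atTop 1] with n h1 h2 h3 t ht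
    have hf1 : 0 < f n 1 := hf_pos n 1 one_pos
    have hi0 : 0 < 1 / s n := one_div_pos.2 (hs_pos n)
    have hi1 : 1 / s n ≤ 1 := by rw [div_le_one (hs_pos n)]; exact h3
    have hp : 0 < t ^ (1 / s n) := Real.rpow_pos_of_pos ht _
    have hB0 : 0 ≤ B t := by simp only [hB]; positivity
    by_cases hin : t ^ (1 / s n) ∈ Set.Ici (1 - δ n)
    swap
    · simp only [hWdef, hH]; rw [Set.indicator_of_notMem hin]; simpa using hB0
    simp only [hWdef, hH]; rw [Set.indicator_of_mem hin, norm_mul, Real.norm_eq_abs, Real.norm_eq_abs,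
      abs_of_pos (Real.rpow_pos_of_pos ht _)]
    rcases lt_or_ge t 1 with hlt | hge
    · have hr : (1 - δ n) ^ s n ≤ t := by
        have := Real.rpow_le_rpow (by linarith [(hδ n).2]) hin (hs_pos n).le
        rwa [← Real.rpow_mul ht.le, one_div_mul_cancel (hs_pos n).ne', Real.rpow_one] at this
      have hg := hW3 n t hr hlt.le
      have hG := h1 _ hp (Real.rpow_lt_one ht.le hlt hi0)
      have hg' : f n (t ^ (1 / s n)) / f n 1 ≤ t ^ e := by
        rw [div_le_iff₀ hf1]; linarith
      have hw : t ^ (1 / s n - 1) ≤ t ^ (-1:ℝ) :=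
        Real.rpow_le_rpow_of_exponent_ge ht hlt.le (by linarith)
      have hte : t ^ e ≤ 1 := Real.rpow_le_one ht.le hlt.le he.le
      calc t ^ (1 / s n - 1) * |G n (t ^ (1 / s n))| ≤ t ^ (-1:ℝ) * (C * t ^ e) := by
            gcongr
            exact hG.trans (by gcongr)
        _ = C * t ^ (e - 1) := by
            rw [sub_eq_add_neg, Real.rpow_add ht]; ring
        _ ≤ C * t ^ (e - 1) * Real.exp (c + -c * t ^ e) := by
            apply le_mul_of_one_le_right (by positivity)
            apply Real.one_le_exp
            nlinarith
        _ = (C * Real.exp c) * (t ^ (e - 1) * Real.exp (-c * t ^ e)) := by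
            rw [Real.exp_add]; ring
        _ ≤ B t := by
            simp only [hB]
            have : 0 ≤ C * (t ^ (0:ℝ) * Real.exp (-c * t ^ e)) := by positivity
            linarith
    · have hg := hW2 n t hge
      have hG := h2 _ (Real.one_le_rpow hge hi0.le)
      have hg' : t ^ e ≤ f n (t ^ (1 / s n)) / f n 1 := by
        rw [le_div_iff₀ hf1]; linarith
      have hw : t ^ (1 / s n - 1) ≤ 1 :=
        Real.rpow_le_one_of_one_le_of_nonpos hge (by linarith)
      calc t ^ (1 / s n - 1) * |G n (t ^ (1 / s n))| ≤ 1 * (C * Real.exp (-c * t ^ e)) := by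
            gcongr
            refine hG.trans ?_
            gcongr
            nlinarith
        _ = C * (t ^ (0:ℝ) * Real.exp (-c * t ^ e)) := by
            rw [Real.rpow_zero]; ring
        _ ≤ B t := by
            simp only [hB]
            have : 0 ≤ (C * Real.exp c) * (t ^ (e - 1) * Real.exp (-c * t ^ e)) := by positivity
            linarith
  have hsinv : Tendsto (fun n => 1 / s n) atTop (nhds 0) := by
    simp only [one_div]; exact hs.inv_tendsto_atTop
  have hWlim : ∀ t, 0 < t → Tendsto (fun n => W n t) atTop (nhds (v t / t)) := by
    intro t ht
    have h1 : Tendsto (fun n => t ^ (1 / s n - 1)) atTop (nhds (t ^ (-1:ℝ))) := by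
      have : Tendsto (fun n => 1 / s n - 1) atTop (nhds (-1)) := by
        simpa using hsinv.sub_const 1
      exact tendsto_const_nhds.rpow this (Or.inl ht.ne')
    have h2 : ∀ᶠ n in atTop, t ^ (1 / s n) ∈ Set.Ici (1 - δ n) := by
      have hz : Tendsto (fun n => (f n (t ^ (1 / s n)) / f n 1) - s n * f n (1 - δ n) / f n 1)
        atTop (nhds t) := by simpa using (hS t ht.le).sub hW1
      filter_upwards [hz.eventually (lt_mem_nhds ht), hs.eventually_ge_atTop 1] with n h1 h3
      by_contra hcon
      have hcon : t ^ (1 / s n) < 1 - δ n := not_le.1 hcon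
      have hp : 0 < t ^ (1 / s n) := Real.rpow_pos_of_pos ht _
      have hf1 : 0 < f n 1 := hf_pos n 1 one_pos
      have hlt := hf_mono n hp (Set.mem_Ioi.2 (hp.trans hcon)) hcon
      have h4 : f n (1 - δ n) ≤ s n * f n (1 - δ n) :=
        le_mul_of_one_le_left (hf_pos n _ (hp.trans hcon)).le h3
      rw [← sub_div] at h1
      have := (div_pos_iff_of_pos_right hf1).1 h1
      linarith
    have h3 := h1.mul (hlim t ht)
    rw [Real.rpow_neg_one, inv_mul_eq_div] at h3
    refine h3.congr' ?_
    filter_upwards [h2] with n hn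
    simp only [hWdef, hH]; rw [Set.indicator_of_mem hn]
  have hWtend : Tendsto (fun n => ∫ t in Set.Ioi (0:ℝ), W n t) atTop
      (nhds (∫ t in Set.Ioi (0:ℝ), v t / t)) := by
    apply tendsto_integral_filter_of_dominated_convergence B
    · exact Eventually.of_forall hWmeas
    · filter_upwards [hWb] with n hn
      filter_upwards [ae_restrict_mem measurableSet_Ioi] with t ht using hn t ht
    · exact hBint
    · filter_upwards [ae_restrict_mem measurableSet_Ioi] with t ht using hWlim t ht
  have hWint : ∀ᶠ n in atTop, IntegrableOn (W n) (Set.Ioi 0) := by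
    filter_upwards [hWb] with n hn
    refine hBint.mono' (hWmeas n) ?_
    filter_upwards [ae_restrict_mem measurableSet_Ioi] with t ht using hn t ht
  have hHint : ∀ᶠ n in atTop, IntegrableOn (H n) (Set.Ioi 0) := by
    filter_upwards [hWint] with n hn
    rw [← integrableOn_Ioi_comp_rpow_iff (H n) (one_div_pos.2 (hs_pos n)).ne']
    have := hn.const_mul (|1 / s n|)
    refine this.congr (Eventually.of_forall fun t => ?_)
    simp only [hWdef, smul_eq_mul]; ring
  have hHeq : ∀ n, s n * ∫ x in Set.Ioi (0:ℝ), H n x = ∫ t in Set.Ioi (0:ℝ), W n t := by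
    intro n
    rw [← integral_comp_rpow_Ioi (H n) (one_div_pos.2 (hs_pos n)).ne', ← integral_const_mul]
    congr 1; ext t
    simp only [hWdef, smul_eq_mul]
    rw [abs_of_pos (one_div_pos.2 (hs_pos n))]
    have := (hs_pos n).ne'
    field_simp
  -- the part below
  set K : ℕ → ℝ → ℝ := fun n => (Set.Iio (1 - δ n)).indicator (G n) with hK
  have hKb : ∀ᶠ n in atTop, ∀ x ∈ Set.Ioo 0 (1 - δ n), ‖G n x‖ ≤ C * |f n (1 - δ n) / f n 1| := by
    filter_upwards [hb1] with n hn x hx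
    have hδ0 := (hδ n).1
    have hf1 : 0 < f n 1 := hf_pos n 1 one_pos
    refine (hn x hx.1 (by linarith [hx.2])).trans ?_
    gcongr
    refine le_trans ?_ (le_abs_self _)
    gcongr
    exact (hf_mono n hx.1 (Set.mem_Ioi.2 (hx.1.trans hx.2)) hx.2).le
  have hmae : ∀ n, AEStronglyMeasurable (G n) (volume.restrict (Set.Ioi 0)) := by
    intro n
    refine (hm n).aestronglyMeasurable.congr ?_
    filter_upwards [ae_restrict_mem measurableSet_Ioi] with t ht
    rw [Set.indicator_of_mem ht]
  have hGint' : ∀ᶠ n in atTop, IntegrableOn (G n) (Set.Ioo 0 (1 - δ n)) := by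
    filter_upwards [hKb] with n hn
    have hcst : IntegrableOn (fun _ : ℝ => C * |f n (1 - δ n) / f n 1|) (Set.Ioo 0 (1 - δ n)) :=
      integrableOn_const (by simp)
    refine Integrable.mono' hcst ?_ ?_
    · exact ((hmae n).mono_measure (Measure.restrict_mono (fun x hx => hx.1) le_rfl))
    · filter_upwards [ae_restrict_mem measurableSet_Ioo] with x hx using hn x hx
  have hset : ∀ n, Set.Ioi (0:ℝ) ∩ Set.Iio (1 - δ n) = Set.Ioo 0 (1 - δ n) := fun n => rfl
  have hKint : ∀ᶠ n in atTop, IntegrableOn (K n) (Set.Ioi 0) := by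
    filter_upwards [hGint'] with n hn
    rw [hK]; simp only
    rw [IntegrableOn, integrable_indicator_iff measurableSet_Iio, IntegrableOn,
      Measure.restrict_restrict measurableSet_Iio, Set.inter_comm, hset]
    exact hn
  have hsum : ∀ n, G n = fun x => K n x + H n x := by
    intro n; ext x
    simp only [hK, hH, Set.indicator_apply, Set.mem_Iio, Set.mem_Ici]
    rcases lt_or_ge x (1 - δ n) with h | h
    · simp [h, not_le.2 h]
    · simp [h, not_lt.2 h]
  have hKeq : ∀ n, ∫ x in Set.Ioi (0:ℝ), K n x = ∫ x in Set.Ioo 0 (1 - δ n), G n x := by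
    intro n
    simp only [hK]
    rw [setIntegral_indicator measurableSet_Iio, hset]
  have hKtend : Tendsto (fun n => s n * ∫ x in Set.Ioi (0:ℝ), K n x) atTop (nhds 0) := by
    have hz : Tendsto (fun n => C * |s n * f n (1 - δ n) / f n 1|) atTop (nhds 0) := by
      simpa using hW1.abs.const_mul C
    refine squeeze_zero_norm' ?_ hz
    filter_upwards [hKb] with n hn
    rw [hKeq, norm_mul, Real.norm_of_nonneg (hs_pos n).le]
    have h1 := norm_setIntegral_le_of_norm_le_const (μ := volume) (by simp) hn
    have h2 : volume.real (Set.Ioo 0 (1 - δ n)) ≤ 1 := by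
      rw [Real.volume_real_Ioo_of_le (by linarith [(hδ n).2])]; linarith [(hδ n).1]
    rw [mul_div_assoc, abs_mul, abs_of_pos (hs_pos n)]
    have h3 : C * |f n (1 - δ n) / f n 1| * volume.real (Set.Ioo 0 (1 - δ n)) ≤
      C * |f n (1 - δ n) / f n 1| := mul_le_of_le_one_right (by positivity) h2
    calc _ ≤ s n * (C * |f n (1 - δ n) / f n 1|) :=
          mul_le_mul_of_nonneg_left (h1.trans h3) (hs_pos n).le
      _ = _ := by ring
  refine ⟨?_, ?_, ?_⟩
  · filter_upwards [hKint, hHint] with n h1 h2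
    rw [hsum n]; exact h1.add h2
  · refine Integrable.mono' hBint ?_ ?_
    · refine aestronglyMeasurable_of_tendsto_ae (u := atTop) (f := W) hWmeas ?_
      filter_upwards [ae_restrict_mem measurableSet_Ioi] with t ht using hWlim t ht
    · filter_upwards [ae_restrict_mem measurableSet_Ioi] with t ht
      refine le_of_tendsto (hWlim t ht).norm ?_
      filter_upwards [hWb] with n hn using hn t ht
  · have := hKtend.add hWtend
    rw [zero_add] at this
    refine this.congr' ?_
    filter_upwards [hKint, hHint] with n h1 h2
    rw [hsum n, integral_add h1 h2, mul_add, hHeq]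

lemma frull (L : ℝ) (hL : 0 < L)
    (h1 : IntegrableOn (fun t => (Real.exp (-(L * t)) - (Set.Iio (1:ℝ)).indicator (fun _ => (1:ℝ)) t) / t) (Set.Ioi 0))
    (h2 : IntegrableOn (fun t => (Real.exp (-(1 * t)) - (Set.Iio (1:ℝ)).indicator (fun _ => (1:ℝ)) t) / t) (Set.Ioi 0)) :
    ∫ t in Set.Ioi (0:ℝ), (Real.exp (-(L * t)) - (Set.Iio (1:ℝ)).indicator (fun _ => (1:ℝ)) t) / t
     = (∫ t in Set.Ioi (0:ℝ), (Real.exp (-(1 * t)) - (Set.Iio (1:ℝ)).indicator (fun _ => (1:ℝ)) t) / t)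
      - Real.log L := by
  have key : ∀ t : ℝ, (Real.exp (-(L * t)) - (Set.Iio (1:ℝ)).indicator (fun _ => (1:ℝ)) t) / t
      - (Real.exp (-(1 * t)) - (Set.Iio (1:ℝ)).indicator (fun _ => (1:ℝ)) t) / t =
      t⁻¹ • (Real.exp (-(L * t)) - Real.exp (-(1 * t))) := by
    intro t; rw [smul_eq_mul]; ring
  have hcont : Continuous (fun t : ℝ => Real.exp (-t)) := by fun_prop
  have := Frullani.integral_Ioi_eq (f := fun t => Real.exp (-t)) (a := L) (b := 1) (L := 1) (R := 0)
    (hcont.locallyIntegrable.locallyIntegrableOn _) hL one_pos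
    (by
      have := (hcont.tendsto 0).mono_left (nhdsWithin_le_nhds (s := Set.Ioi 0))
      simpa using this)
    (Real.tendsto_exp_neg_atTop_nhds_zero)
    ((h1.sub h2).congr (Eventually.of_forall fun t => key t))
  have h3 := integral_sub h1 h2
  simp only [key] at h3
  rw [this] at h3
  simp only [one_div, Real.log_inv, smul_eq_mul] at h3
  linarith

lemma expsub (y : ℝ) (hy : 0 ≤ y) : |Real.exp (-y) - 1| ≤ y := by
  have := Real.add_one_le_exp (-y)
  have h2 : Real.exp (-y) ≤ 1 := Real.exp_le_one_iff.2 (by linarith)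
  rw [abs_le]; constructor <;> linarith

lemma yexp (y : ℝ) : y * Real.exp (-y) ≤ Real.exp (-(y/2)) := by
  have h : y ≤ Real.exp (y/2) := by
    have := Real.quadratic_le_exp_of_nonneg (x := |y|/2) (by positivity)
    rcases le_or_gt y 0 with h | h
    · exact h.trans (Real.exp_pos _).le
    · rw [abs_of_pos h] at this
      nlinarith [sq_nonneg (y - 2)]
  calc y * Real.exp (-y) ≤ Real.exp (y/2) * Real.exp (-y) := by gcongr
    _ = _ := by rw [← Real.exp_add]; congr 1; ring

lemma inner_eq (f : ℝ → ℝ) (hf_cont : ContinuousOn f (Set.Ioi 0))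
    (hf_pos : ∀ x, 0 < x → 0 < f x) (atil lam : ℝ) (ha : 0 < atil)
    (k : ℝ → ℝ) (hk : Measurable k) :
    ∫ y, k y ∂(nuMeasure f atil lam) =
      atil * ∫ x in Set.Ioi (0:ℝ), k (f x) * Real.exp (-(lam * f x)) := by
  have hfm : AEMeasurable f (volume.restrict (Set.Ioi 0)) :=
    hf_cont.aemeasurable measurableSet_Ioi
  unfold nuMeasure
  rw [integral_map (hfm.mono_ac (withDensity_absolutelyContinuous _ _)) hk.aestronglyMeasurable,
    integral_withDensity_eq_integral_toReal_smul₀ (by fun_prop) (by simp), ← integral_const_mul]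
  congr 1; ext x
  rw [ENNReal.toReal_ofReal (by positivity), smul_eq_mul]; ring

lemma outer_eq (f : ℝ → ℝ) (hf_cont : ContinuousOn f (Set.Ioi 0))
    (hf_pos : ∀ x, 0 < x → 0 < f x) (atil lam : ℝ) (ha : 0 < atil) (hlam : 0 < lam)
    (h : ℝ → ℝ) (hh : Continuous h) (σ : ℝ) (hσ : 0 < σ) :
    ∫ y, h y ∂(Measure.map (fun y => lam * y) ((nuMeasure f atil lam).withDensity
            fun y => ENNReal.ofReal (y / ∫ z, z ∂(nuMeasure f atil lam)))) =
    (σ * ∫ x in Set.Ioi (0:ℝ), h (lam * f x) * ((lam * f x) * Real.exp (-(lam * f x)))) /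
     (σ * ∫ x in Set.Ioi (0:ℝ), 1 * ((lam * f x) * Real.exp (-(lam * f x)))) := by
  set m := ∫ z, z ∂(nuMeasure f atil lam) with hm
  have hm1 : m = atil * ∫ x in Set.Ioi (0:ℝ), f x * Real.exp (-(lam * f x)) :=
    inner_eq f hf_cont hf_pos atil lam ha (fun z => z) measurable_id
  have hm0 : 0 ≤ m := by
    rw [hm1]
    refine mul_nonneg ha.le (setIntegral_nonneg measurableSet_Ioi fun x hx => ?_)
    have := hf_pos x hx
    positivity
  rw [integral_map (by fun_prop) hh.aestronglyMeasurable,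
    integral_withDensity_eq_integral_toReal_smul₀ (by fun_prop) (by simp)]
  have hmeas : Measurable (fun y => (ENNReal.ofReal (y / m)).toReal • h (lam * y)) := by
    have := hh.measurable
    fun_prop
  rw [inner_eq f hf_cont hf_pos atil lam ha _ hmeas, mul_div_mul_left _ _ hσ.ne']
  have e1 : ∫ x in Set.Ioi (0:ℝ), (ENNReal.ofReal (f x / m)).toReal • h (lam * f x) * Real.exp (-(lam * f x))
      = (lam * m)⁻¹ * ∫ x in Set.Ioi (0:ℝ), h (lam * f x) * ((lam * f x) * Real.exp (-(lam * f x))) := by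
    rw [← integral_const_mul]
    refine setIntegral_congr_fun measurableSet_Ioi fun x hx => ?_
    have := hf_pos x hx
    simp only [smul_eq_mul]
    rw [ENNReal.toReal_ofReal (by positivity)]
    rcases eq_or_ne m 0 with h0 | h0
    · simp [h0]
    · field_simp
  have e2 : ∫ x in Set.Ioi (0:ℝ), 1 * ((lam * f x) * Real.exp (-(lam * f x))) = lam * (m / atil) := by
    rw [hm1, mul_div_cancel_left₀ _ ha.ne', ← integral_const_mul]
    congr 1; ext x; ring
  rw [e1, e2]
  rcases eq_or_ne m 0 with h0 | h0
  · simp [h0]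
  · field_simp


/-- the size-biased measure `ν*_ã`, rescaled by `λ_n(ã)`, converges weakly to the
mean-one exponential distribution. -/
theorem statement12 (s : ℕ → ℝ) (hs_pos : ∀ n, 0 < s n) (hs : Tendsto s atTop atTop)
    (f : ℕ → ℝ → ℝ)
    (hf_cont : ∀ n, ContinuousOn (f n) (Set.Ioi 0))
    (hf_mono : ∀ n, StrictMonoOn (f n) (Set.Ioi 0))
    (hf_pos : ∀ n x, 0 < x → 0 < f n x)
    -- Condition (S)
    (hS : ∀ x : ℝ, 0 ≤ x → Tendsto (fun n => f n (x ^ (1 / s n)) / f n 1) atTop (nhds x))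
    -- Condition (W)
    (hW : ∃ ε₀ : ℝ, 0 < ε₀ ∧ ∃ δ : ℕ → ℝ, (∀ n, δ n ∈ Set.Ioc (0:ℝ) 1) ∧
      Tendsto (fun n => s n * f n (1 - δ n) / f n 1) atTop (nhds 0) ∧
      (∀ n, ∀ x : ℝ, 1 ≤ x → f n 1 * x ^ ε₀ ≤ f n (x ^ (1 / s n))) ∧
      (∀ n, ∀ x : ℝ, (1 - δ n) ^ s n ≤ x → x ≤ 1 → f n (x ^ (1 / s n)) ≤ f n 1 * x ^ ε₀))
    (a : ℝ) (ha : 0 < a)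
    (lam : ℕ → ℝ) (n₀ : ℕ)
    (hlam : ∀ n ≥ n₀, 0 < lam n ∧
      (∀ l : ℝ, 0 < l →
        (a ^ (1 / s n) * ∫ x in Set.Ioi (0:ℝ), Real.exp (-(l * f n x)) = 1 ↔ l = lam n))) :
    ∀ h : ℝ → ℝ, Continuous h → (∃ C : ℝ, ∀ x, |h x| ≤ C) →
      Tendsto (fun n => ∫ y, h y ∂(Measure.map (fun y => lam n * y)
          ((nuMeasure (f n) (a ^ (1 / s n)) (lam n)).withDensity
            fun y => ENNReal.ofReal
              (y / ∫ z, z ∂(nuMeasure (f n) (a ^ (1 / s n)) (lam n))))))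
        atTop
        (nhds (∫ z in Set.Ioi (0:ℝ), h z * Real.exp (-z))) := by
  intro h hh hbd
  obtain ⟨Ch, hCh⟩ := hbd
  obtain ⟨e, he, δ, hδ, hW1, hW2, hW3⟩ := hW
  have A := lemmaA s hs_pos hs f hf_mono hf_pos hS e he δ hδ hW1 hW2 hW3
  have hf1 : ∀ n, 0 < f n 1 := fun n => hf_pos n 1 one_pos
  have hi0 : ∀ n, 0 < 1 / s n := fun n => one_div_pos.2 (hs_pos n)
  have hsinv : Tendsto (fun n => 1 / s n) atTop (nhds 0) := by
    simp only [one_div]; exact hs.inv_tendsto_atTop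
  set ind : ℝ → ℝ := (Set.Iio (1:ℝ)).indicator (fun _ => (1:ℝ)) with hind
  have hindint : IntegrableOn ind (Set.Ioi 0) := by
    rw [hind, IntegrableOn, integrable_indicator_iff measurableSet_Iio, IntegrableOn,
      Measure.restrict_restrict measurableSet_Iio, Set.inter_comm, Set.Ioi_inter_Iio]
    exact integrableOn_const (by simp)
  have hindval : ∫ x in Set.Ioi (0:ℝ), ind x = 1 := by
    rw [hind, setIntegral_indicator measurableSet_Iio, Set.Ioi_inter_Iio]
    simp
  have F1 : ∀ L : ℝ, 0 < L →
      (∀ᶠ n in atTop, IntegrableOn (fun x => Real.exp (-(L * (f n x / f n 1)))) (Set.Ioi 0)) ∧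
      IntegrableOn (fun t => (Real.exp (-(L * t)) - ind t) / t) (Set.Ioi 0) ∧
      Tendsto (fun n => s n * ((∫ x in Set.Ioi (0:ℝ), Real.exp (-(L * (f n x / f n 1)))) - 1)) atTop
        (nhds (∫ t in Set.Ioi (0:ℝ), (Real.exp (-(L * t)) - ind t) / t)) := by
    intro L hL
    obtain ⟨a1, a2, a3⟩ := A (fun n x => Real.exp (-(L * (f n x / f n 1))) - ind x)
      (fun t => Real.exp (-(L * t)) - ind t) (max L 1) L (by positivity) hL
      (by
        intro n
        have h1 : ContinuousOn (fun x => Real.exp (-(L * (f n x / f n 1)))) (Set.Ioi 0) := by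
          have := hf_cont n
          fun_prop
        have h2 := measurable_ind_of_contOn h1
        have h3 : Measurable ((Set.Ioi (0:ℝ)).indicator ind) :=
          ((measurable_const.indicator measurableSet_Iio)).indicator measurableSet_Ioi
        have := h2.sub h3
        rwa [← Set.indicator_sub'] at this)
      (by
        refine Eventually.of_forall fun n x hx hx1 => ?_
        have hfx := hf_pos n x hx
        have hq : 0 < f n x / f n 1 := div_pos hfx (hf1 n)
        have : ind x = 1 := Set.indicator_of_mem (show x ∈ Set.Iio (1:ℝ) from hx1) _
        rw [this]
        refine (expsub _ (by positivity)).trans ?_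
        gcongr
        exact le_max_left _ _)
      (by
        refine Eventually.of_forall fun n x hx1 => ?_
        have : ind x = 0 := Set.indicator_of_notMem (by simpa using hx1) _
        rw [this, sub_zero, abs_of_pos (Real.exp_pos _)]
        exact le_mul_of_one_le_left (Real.exp_pos _).le (le_max_right _ _))
      (by
        intro t ht
        have h1 : ∀ n, ind (t ^ (1 / s n)) = ind t := by
          intro n
          simp only [hind, Set.indicator_apply, Set.mem_Iio]
          rcases lt_or_ge t 1 with h | h
          · rw [if_pos (Real.rpow_lt_one ht.le h (hi0 n)), if_pos h]
          · rw [if_neg (not_lt.2 (Real.one_le_rpow h (hi0 n).le)), if_neg (not_lt.2 h)]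
        simp only [h1]
        refine Tendsto.sub_const ?_ _
        exact (Real.continuous_exp.tendsto _).comp (((hS t ht.le).const_mul L).neg))
    have b1 : ∀ᶠ n in atTop, IntegrableOn (fun x => Real.exp (-(L * (f n x / f n 1)))) (Set.Ioi 0) := by
      filter_upwards [a1] with n hn
      refine (hn.add hindint).congr (Eventually.of_forall fun x => ?_)
      simp
    refine ⟨b1, a2, a3.congr' ?_⟩
    filter_upwards [b1] with n hn
    rw [integral_sub hn hindint, hindval]
  set Φ : ℝ → ℝ := fun L => ∫ t in Set.Ioi (0:ℝ), (Real.exp (-(L * t)) - ind t) / t with hΦ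
  have hΦeq : ∀ L, 0 < L → Φ L = Φ 1 - Real.log L := fun L hL =>
    frull L hL (F1 L hL).2.1 (F1 1 one_pos).2.1
  set Λ : ℕ → ℝ := fun n => lam n * f n 1 with hΛ
  have hΛf : ∀ n x, Λ n * (f n x / f n 1) = lam n * f n x := by
    intro n x
    have := (hf1 n).ne'
    simp only [hΛ]; field_simp
  have hat : ∀ n, 0 < a ^ (1 / s n) := fun n => Real.rpow_pos_of_pos ha _
  have hval : ∀ n ≥ n₀, ∫ x in Set.Ioi (0:ℝ), Real.exp (-(Λ n * (f n x / f n 1))) =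
      a⁻¹ ^ (1 / s n) := by
    intro n hn
    have := ((hlam n hn).2 (lam n) (hlam n hn).1).2 rfl
    simp only [hΛf]
    rw [Real.inv_rpow ha.le]
    exact eq_inv_of_mul_eq_one_right this
  have hΛint : ∀ n ≥ n₀, IntegrableOn (fun x => Real.exp (-(Λ n * (f n x / f n 1)))) (Set.Ioi 0) := by
    intro n hn
    by_contra hcon
    have h1 := hval n hn
    rw [integral_undef hcon] at h1
    exact (Real.rpow_pos_of_pos (inv_pos.2 ha) _).ne h1
  have hFΛ : Tendsto (fun n => s n * ((∫ x in Set.Ioi (0:ℝ), Real.exp (-(Λ n * (f n x / f n 1)))) - 1))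
      atTop (nhds (-Real.log a)) := by
    have h1 := (tendsto_rpow_sub_one_log (inv_pos.2 ha)).comp
      (tendsto_nhdsWithin_iff.2 ⟨hsinv, Eventually.of_forall hi0⟩)
    rw [Real.log_inv] at h1
    refine h1.congr' ?_
    filter_upwards [eventually_ge_atTop n₀] with n hn
    rw [hval n hn]
    simp
  have hmonoF : ∀ n, ∀ p q : ℝ, p ≤ q →
      IntegrableOn (fun x => Real.exp (-(p * (f n x / f n 1)))) (Set.Ioi 0) →
      IntegrableOn (fun x => Real.exp (-(q * (f n x / f n 1)))) (Set.Ioi 0) →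
      s n * ((∫ x in Set.Ioi (0:ℝ), Real.exp (-(q * (f n x / f n 1)))) - 1) ≤
      s n * ((∫ x in Set.Ioi (0:ℝ), Real.exp (-(p * (f n x / f n 1)))) - 1) := by
    intro n p q hpq h1 h2
    have := setIntegral_mono_on h2 h1 measurableSet_Ioi (fun x hx => by
      have hq : 0 < f n x / f n 1 := div_pos (hf_pos n x hx) (hf1 n)
      gcongr)
    have hsn := hs_pos n
    gcongr
  set L := a * Real.exp (Φ 1) with hLdef
  have hL : 0 < L := by positivity
  have hlogL : Real.log L = Real.log a + Φ 1 := by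
    rw [hLdef, Real.log_mul ha.ne' (Real.exp_pos _).ne', Real.log_exp]
  have hΛlim : Tendsto Λ atTop (nhds L) := by
    rw [tendsto_order]
    constructor
    · intro l hl
      rcases le_or_gt l 0 with hl0 | hl0
      · filter_upwards [eventually_ge_atTop n₀] with n hn
        exact hl0.trans_lt (mul_pos (hlam n hn).1 (hf1 n))
      have h1 : -Real.log a < Φ l := by
        rw [hΦeq l hl0]
        have := Real.log_lt_log hl0 hl
        linarith
      filter_upwards [hFΛ.eventually_lt (F1 l hl0).2.2 h1, (F1 l hl0).1,
        eventually_ge_atTop n₀] with n k1 k2 k3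
      by_contra hcon
      exact absurd k1 (not_lt.2 (hmonoF n _ _ (not_lt.1 hcon) (hΛint n k3) k2))
    · intro l hl
      have hl0 := hL.trans hl
      have h1 : Φ l < -Real.log a := by
        rw [hΦeq l hl0]
        have := Real.log_lt_log hL hl
        linarith
      filter_upwards [(F1 l hl0).2.2.eventually_lt hFΛ h1, (F1 l hl0).1,
        eventually_ge_atTop n₀] with n k1 k2 k3
      by_contra hcon
      exact absurd k1 (not_lt.2 (hmonoF n _ _ (not_lt.1 hcon) k2 (hΛint n k3)))
  -- main convergence
  have M1 : ∀ (k : ℝ → ℝ) (D : ℝ), Continuous k → (∀ x, |k x| ≤ D) →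
      Tendsto (fun n => s n * ∫ x in Set.Ioi (0:ℝ),
        k (lam n * f n x) * ((lam n * f n x) * Real.exp (-(lam n * f n x)))) atTop
        (nhds (∫ z in Set.Ioi (0:ℝ), k z * Real.exp (-z))) := by
    intro k D hk hD
    have hD0 : 0 ≤ D := (abs_nonneg _).trans (hD 0)
    have hev : ∀ᶠ n in atTop, L / 2 < Λ n ∧ Λ n < 2 * L :=
      (hΛlim.eventually (lt_mem_nhds (by linarith))).and (hΛlim.eventually (gt_mem_nhds (by linarith)))
    obtain ⟨-, -, a3⟩ := A (fun n x => k (Λ n * (f n x / f n 1)) *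
        ((Λ n * (f n x / f n 1)) * Real.exp (-(Λ n * (f n x / f n 1)))))
      (fun t => k (L * t) * ((L * t) * Real.exp (-(L * t)))) ((D + 1) * (2 * L + 1)) (L / 4)
      (by positivity) (by positivity)
      (by
        intro n
        apply measurable_ind_of_contOn
        have := hf_cont n
        fun_prop)
      (by
        filter_upwards [hev] with n hn x hx hx1
        have hq : 0 < f n x / f n 1 := div_pos (hf_pos n x hx) (hf1 n)
        have hΛ0 : 0 < Λ n := by linarith [hn.1]
        rw [abs_mul, mul_assoc (D + 1)]
        have hy : 0 < Λ n * (f n x / f n 1) := mul_pos hΛ0 hq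
        gcongr
        · linarith [hD (Λ n * (f n x / f n 1))]
        · rw [abs_of_pos (by positivity)]
          calc _ ≤ Λ n * (f n x / f n 1) * 1 := by
                gcongr
                exact Real.exp_le_one_iff.2 (by linarith)
            _ ≤ _ := by
                rw [mul_one]
                gcongr
                linarith [hn.2])
      (by
        filter_upwards [hev] with n hn x hx1
        have hx : 0 < x := by linarith
        have hq : 0 < f n x / f n 1 := div_pos (hf_pos n x hx) (hf1 n)
        have hΛ0 : 0 < Λ n := by linarith [hn.1]
        rw [abs_mul, mul_assoc (D + 1)]
        have hy : 0 < Λ n * (f n x / f n 1) := mul_pos hΛ0 hq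
        gcongr
        · linarith [hD (Λ n * (f n x / f n 1))]
        · rw [abs_of_pos (by positivity)]
          refine (yexp _).trans ?_
          calc _ ≤ Real.exp (-(L / 4 * (f n x / f n 1))) := by
                apply Real.exp_le_exp.2
                nlinarith [hn.1]
            _ ≤ _ := le_mul_of_one_le_left (Real.exp_pos _).le (by linarith))
      (by
        intro t ht
        have h1 : Tendsto (fun n => Λ n * (f n (t ^ (1 / s n)) / f n 1)) atTop (nhds (L * t)) :=
          hΛlim.mul (hS t ht.le)
        have h2 : Continuous (fun y : ℝ => k y * (y * Real.exp (-y))) := by fun_prop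
        exact (h2.tendsto _).comp h1)
    simp only [hΛf] at a3
    convert a3 using 2
    have h1 := integral_comp_mul_left_Ioi' (fun z => k z * Real.exp (-z)) 0 hL
    rw [mul_zero] at h1
    rw [← h1, smul_eq_mul, ← integral_const_mul]
    refine setIntegral_congr_fun measurableSet_Ioi fun t ht => ?_
    have : t ≠ 0 := (Set.mem_Ioi.1 ht).ne'
    field_simp
  have N := M1 h Ch hh hCh
  have N1 := M1 (fun _ => 1) 1 continuous_const (by simp)
  simp only [one_mul] at N1
  rw [integral_exp_neg_Ioi_zero] at N1
  have R := N.div N1 one_ne_zero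
  rw [div_one] at R
  refine R.congr' ?_
  filter_upwards [eventually_ge_atTop n₀] with n hn
  rw [outer_eq (f n) (hf_cont n) (hf_pos n) _ _ (hat n) (hlam n hn).1 h hh (s n) (hs_pos n)]
  simp only [one_mul, Pi.div_apply]
end

section
/- Let μ be a Borel measure on (0,∞) with Laplace transform μ̂(ℓ) = ∫ e^{−ℓ y} dμ(y), let A ⊂ (0,∞) be open, and let λ : A → (0,∞) satisfy a · μ̂(λ(a)) = 1 for all a ∈ A. Suppose μ̂ is finite on an open interval containing λ(A), and suppose that for each a ∈ A the first moment E_a(D) := ∫ y · a e^{−λ(a) y} dμ(y) satisfies 0 < E_a(D) < ∞. Then λ is differentiable on A, with λ′(a) = 1/( a · E_a(D) ) for every a ∈ A. -/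
open MeasureTheory

/-- if `a μ̂(λ(a)) = 1` on an open set `A`, `μ̂` is finite on an open interval
containing `λ(A)`, and the first moment `E_a(D) = ∫ y · a e^{-λ(a) y} dμ(y)` is finite and
positive, then `λ` is differentiable with `λ'(a) = 1/(a E_a(D))`. -/
theorem statement13 (μ : Measure ℝ) (hμ0 : μ (Set.Iic 0) = 0)
    (A : Set ℝ) (hA : IsOpen A) (hA' : A ⊆ Set.Ioi 0)
    (lam : ℝ → ℝ) (hlam_pos : ∀ a ∈ A, 0 < lam a)
    (hlam_eq : ∀ a ∈ A, a * ∫ y, Real.exp (-(lam a * y)) ∂μ = 1)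
    (U : Set ℝ) (hU_open : IsOpen U) (hU_conn : U.OrdConnected)
    (hU_mem : ∀ a ∈ A, lam a ∈ U)
    (hU_fin : ∀ ℓ ∈ U, Integrable (fun y => Real.exp (-(ℓ * y))) μ)
    (hmom : ∀ a ∈ A, Integrable (fun y => y * (a * Real.exp (-(lam a * y)))) μ ∧
      0 < ∫ y, y * (a * Real.exp (-(lam a * y))) ∂μ) :
    ∀ a ∈ A, HasDerivAt lam (1 / (a * ∫ y, y * (a * Real.exp (-(lam a * y))) ∂μ)) a := by
  have hint : ∀ ℓ ∈ U, Integrable (fun y : ℝ => Real.exp (ℓ * (-y))) μ := by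
    intro ℓ hℓ
    simpa only [mul_neg] using hU_fin ℓ hℓ
  have hpos : ∀ᵐ y ∂μ, 0 < y := by
    rw [ae_iff]
    have : {y : ℝ | ¬ 0 < y} = Set.Iic 0 := by ext y; simp
    rw [this, hμ0]
  intro a ha
  have ha0 : 0 < a := hA' ha
  set g : ℝ → ℝ := ProbabilityTheory.mgf (fun y : ℝ => -y) μ with hg
  have hgdef : ∀ ℓ, g ℓ = ∫ y, Real.exp (-(ℓ * y)) ∂μ := by
    intro ℓ
    simp only [hg, ProbabilityTheory.mgf, mul_neg]
  have hgb : ∀ b ∈ A, g (lam b) = b⁻¹ := by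
    intro b hb
    rw [hgdef]
    exact eq_inv_of_mul_eq_one_right (hlam_eq b hb)
  have hanti : StrictAntiOn g U := by
    intro l₁ h₁ l₂ h₂ h
    have hnn : 0 ≤ᵐ[μ] fun y => Real.exp (-(l₁ * y)) - Real.exp (-(l₂ * y)) := by
      filter_upwards [hpos] with y hy
      have : Real.exp (-(l₂ * y)) ≤ Real.exp (-(l₁ * y)) := by
        apply Real.exp_le_exp.mpr
        nlinarith
      simpa using this
    have hi := (hU_fin _ h₁).sub (hU_fin _ h₂)
    have hsub : g l₁ - g l₂ = ∫ y, (Real.exp (-(l₁ * y)) - Real.exp (-(l₂ * y))) ∂μ := by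
      rw [hgdef, hgdef, integral_sub (hU_fin _ h₁) (hU_fin _ h₂)]
    have hge : 0 ≤ g l₁ - g l₂ := by
      rw [hsub]; exact integral_nonneg_of_ae hnn
    rcases hge.lt_or_eq with h0 | h0
    · linarith
    · exfalso
      rw [hsub] at h0
      have hz := (integral_eq_zero_iff_of_nonneg_ae hnn hi).1 h0.symm
      have hF : ∀ᵐ y ∂μ, False := by
        filter_upwards [hz, hpos] with y hy hy0
        have : Real.exp (-(l₂ * y)) < Real.exp (-(l₁ * y)) := by
          apply Real.exp_lt_exp.mpr
          nlinarith
        simp at hy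
        linarith
      have hμ : μ = 0 := by
        simpa [Filter.eventually_false_iff_eq_bot] using hF
      have := hlam_eq a ha
      simp [hμ] at this
  have hinv : Filter.Tendsto (fun b : ℝ => b⁻¹) (nhds a) (nhds (g (lam a))) := by
    rw [hgb a ha]; exact (continuousAt_inv₀ ha0.ne').tendsto
  obtain ⟨ε, hε, hball⟩ := Metric.isOpen_iff.1 hU_open _ (hU_mem a ha)
  have hmemA : ∀ᶠ b in nhds a, b ∈ A := hA.mem_nhds ha
  have hcont : ContinuousAt lam a := by
    refine tendsto_order.2 ⟨fun l hl => ?_, fun l hl => ?_⟩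
    · have h1 : max l (lam a - ε / 2) < lam a := max_lt hl (by linarith)
      have hm : max l (lam a - ε / 2) ∈ U := hball (by
        rw [Metric.mem_ball, Real.dist_eq, abs_lt]
        have := le_max_right l (lam a - ε / 2)
        constructor <;> linarith)
      filter_upwards [hmemA, hinv.eventually_lt_const (hanti hm (hU_mem a ha) h1)] with b hb hlt
      rw [← hgb b hb] at hlt
      exact (le_max_left _ _).trans_lt ((hanti.lt_iff_gt (hU_mem b hb) hm).1 hlt)
    · have h1 : lam a < min l (lam a + ε / 2) := lt_min hl (by linarith)
      have hm : min l (lam a + ε / 2) ∈ U := hball (by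
        rw [Metric.mem_ball, Real.dist_eq, abs_lt]
        have := min_le_right l (lam a + ε / 2)
        constructor <;> linarith)
      filter_upwards [hmemA, hinv.eventually_const_lt (hanti (hU_mem a ha) hm h1)] with b hb hlt
      rw [← hgb b hb] at hlt
      exact ((hanti.lt_iff_gt hm (hU_mem b hb)).1 hlt).trans_le (min_le_left _ _)
  have hintr : lam a ∈ interior (ProbabilityTheory.integrableExpSet (fun y : ℝ => -y) μ) :=
    mem_interior.2 ⟨U, hint, hU_open, hU_mem a ha⟩
  have hd : HasDerivAt g _ (lam a) := ProbabilityTheory.hasDerivAt_mgf hintr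
  have hga : g (lam a) ≠ 0 := by rw [hgb a ha]; exact inv_ne_zero ha0.ne'
  have hE := (hmom a ha).2
  have hEq : ∫ y, y * (a * Real.exp (-(lam a * y))) ∂μ
      = -(a * ∫ y, (-y) * Real.exp (lam a * (-y)) ∂μ) := by
    rw [← integral_const_mul, ← integral_neg]
    congr 1
    ext y
    rw [mul_neg]
    ring
  rw [hEq] at hE ⊢
  set I := ∫ y, (-y) * Real.exp (lam a * (-y)) ∂μ with hI
  have hI0 : I ≠ 0 := by
    rintro h; rw [h] at hE; simp at hE
  have hd' := hd.fun_inv hga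
  have hres := HasDerivAt.of_local_left_inverse hcont hd'
    (div_ne_zero (neg_ne_zero.2 hI0) (pow_ne_zero 2 hga))
    (by filter_upwards [hmemA] with b hb; rw [hgb b hb, inv_inv])
  have hval : 1 / (a * -(a * I)) = (-I / g (lam a) ^ 2)⁻¹ := by
    rw [hgb a ha]
    field_simp
  rw [hval]
  exact hres
end
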